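/- arXiv:math/9902104 — 3 statements merged into one kernel-verified Lean document; each statement's English description precedes it below -/
import Mathlib

section
/- (Genus-zero case of Theorem 1.1; Hurwitz's formula.) For any n ≥ 1 and positive integers k1, …, kn with k = k1 + ⋯ + kn, the genus-zero Hurwitz number satisfies h_{0;k1,…,kn} = ((k + n − 2)! · k^{n−3} / #Aut(k1, …, kn)) · ∏_{i=1}^n (k_i^{k_i} / k_i!). Equivalently, the number of (k+n−2)-tuples (τ1, …, τ_{k+n−2}) of transpositions in S_k whose product has cycle type (k1, …, kn) and which generate a transitive subgroup of S_k equals k! · (k + n − 2)! · k^{n−3} · ∏_{i=1}^n (k_i^{k_i} / k_i!) / #Aut(k1, …, kn). -/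
open Equiv

/-- The cycle type of a permutation of `Fin k` where fixed points are counted as
cycles of length 1 (Mathlib's `cycleType` records only nontrivial cycles). -/
def fullCycleType {k : ℕ} (σ : Perm (Fin k)) : Multiset ℕ :=
  σ.cycleType + Multiset.replicate (k - σ.support.card) 1

/-- The subgroup generated by the family `τ` acts transitively on `Fin k`. -/
def IsTransitiveFamily {k d : ℕ} (τ : Fin d → Perm (Fin k)) : Prop :=
  ∀ x y : Fin k, ∃ p ∈ Subgroup.closure (Set.range τ), p x = y

/-- The number of `d`-tuples (`d = k + n + 2g - 2`, `k = k₁ + ⋯ + kₙ`) of transpositions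
in `S_k` whose product has cycle type `(k₁, …, kₙ)` (fixed points counted as 1-cycles)
and which generate a transitive subgroup of `S_k`. -/
noncomputable def hurwitzCount (g n : ℕ) (kk : Fin n → ℕ) : ℕ :=
  Nat.card {τ : Fin ((∑ i, kk i) + n + 2 * g - 2) → Perm (Fin (∑ i, kk i)) //
    (∀ i, (τ i).IsSwap) ∧
    fullCycleType (List.ofFn τ).prod = (List.ofFn kk : Multiset ℕ) ∧
    IsTransitiveFamily τ}

/-- The Hurwitz number `h_{g; k₁, …, kₙ}`: `1/k!` times the number of transitive
transposition factorizations counted by `hurwitzCount`. -/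
noncomputable def hurwitzNumber (g n : ℕ) (kk : Fin n → ℕ) : ℚ :=
  (hurwitzCount g n kk : ℚ) / ((∑ i, kk i).factorial : ℚ)

/-- `#Aut(k₁, …, kₙ)`: the number of permutations `π` of `{1, …, n}` with
`k_{π(i)} = k_i` for all `i`. -/
noncomputable def autCount (n : ℕ) (kk : Fin n → ℕ) : ℕ :=
  Nat.card {π : Perm (Fin n) // ∀ i, kk (π i) = kk i}

section AbelIdentities

open Finset

/-- Finite differences of order exceeding the degree vanish. -/
lemma sum_powerset_neg_one_pow_mul_pow {ι : Type*} [DecidableEq ι] (f : ι → ℚ) (S : Finset ι)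
    (m : ℕ) (hm : m < S.card) (x : ℚ) :
    ∑ J ∈ S.powerset, (-1) ^ J.card * (x + ∑ j ∈ J, f j) ^ m = 0 := by
  induction S using Finset.induction_on generalizing m x with
  | empty => simp at hm
  | insert a S ha ih =>
    rw [Finset.sum_powerset_insert ha, ← Finset.sum_add_distrib]
    have key : ∀ J ∈ S.powerset,
        (-1 : ℚ) ^ J.card * (x + ∑ j ∈ J, f j) ^ m
          + (-1) ^ (insert a J).card * (x + ∑ j ∈ insert a J, f j) ^ m
        = ∑ t ∈ range m, -(f a ^ (m - t) * (m.choose t)) *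
            ((-1) ^ J.card * (x + ∑ j ∈ J, f j) ^ t) := by
      intro J hJ
      have haJ : a ∉ J := fun h => ha (mem_powerset.1 hJ h)
      rw [card_insert_of_notMem haJ, sum_insert haJ,
        show x + (f a + ∑ j ∈ J, f j) = (x + ∑ j ∈ J, f j) + f a by ring, pow_succ]
      generalize x + ∑ j ∈ J, f j = y
      rw [add_pow, sum_range_succ]
      have : ∑ t ∈ range m, -(f a ^ (m - t) * (m.choose t)) * ((-1 : ℚ) ^ J.card * y ^ t)
          = - ((-1 : ℚ) ^ J.card * ∑ t ∈ range m, y ^ t * f a ^ (m - t) * (m.choose t)) := by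
        rw [mul_sum, ← sum_neg_distrib]
        exact sum_congr rfl fun t _ => by ring
      rw [this]
      simp only [Nat.sub_self, pow_zero, Nat.choose_self, Nat.cast_one, mul_one]
      ring
    rw [sum_congr rfl key, sum_comm]
    refine sum_eq_zero fun t ht => ?_
    rw [card_insert_of_notMem ha] at hm
    rw [← mul_sum, ih t (by have := mem_range.1 ht; omega), mul_zero]

/-- Reduction of Hurwitz's multinomial Abel sums to finite differences. -/
lemma sum_powerset_pow_mul_zpow {ι : Type*} [DecidableEq ι] (f : ι → ℚ) (S : Finset ι)
    (hf : ∀ i ∈ S, 0 ≤ f i) (b K : ℚ) (hb : 0 < b) (e : ℤ) :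
    ∑ I ∈ S.powerset, (K - (b + ∑ j ∈ S \ I, f j)) ^ I.card *
        (b + ∑ j ∈ S \ I, f j) ^ (((S \ I).card : ℤ) - e)
      = ∑ T ∈ S.powerset, K ^ T.card * ∑ I ∈ (S \ T).powerset, (-1) ^ I.card *
          (b + ∑ j ∈ (S \ T) \ I, f j) ^ (((S \ T).card : ℤ) - e) := by
  have h1 : ∀ I ∈ S.powerset, (K - (b + ∑ j ∈ S \ I, f j)) ^ I.card *
        (b + ∑ j ∈ S \ I, f j) ^ (((S \ I).card : ℤ) - e)
      = ∑ T ∈ I.powerset, K ^ T.card * ((-1) ^ (I \ T).card *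
          (b + ∑ j ∈ S \ I, f j) ^ (((S \ T).card : ℤ) - e)) := by
    intro I hI
    have hI := mem_powerset.1 hI
    have hB : b + ∑ j ∈ S \ I, f j ≠ 0 :=
      (add_pos_of_pos_of_nonneg hb (sum_nonneg fun i hi => hf i (mem_sdiff.1 hi).1)).ne'
    rw [sub_eq_add_neg, ← sum_pow_mul_eq_add_pow, sum_mul]
    refine sum_congr rfl fun T hT => ?_
    have hT := mem_powerset.1 hT
    have := card_le_card hI
    have := card_le_card hT
    rw [neg_pow, card_sdiff_of_subset hT, card_sdiff_of_subset hI,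
      card_sdiff_of_subset (hT.trans hI),
      show ((S.card - T.card : ℕ) : ℤ) - e
        = ((I.card - T.card : ℕ) : ℤ) + (((S.card - I.card : ℕ) : ℤ) - e) by omega,
      zpow_add₀ hB, zpow_natCast]
    ring
  rw [sum_congr rfl h1, sum_comm' (t' := S.powerset) (s' := fun T => Icc T S)]
  · refine sum_congr rfl fun T hT => ?_
    have hT := mem_powerset.1 hT
    rw [Icc_eq_image_powerset hT, sum_image, mul_sum]
    · refine sum_congr rfl fun I hI => ?_
      have hI := mem_powerset.1 hI
      have hd : Disjoint T I := (disjoint_sdiff.mono_right hI)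
      rw [union_sdiff_cancel_left hd, sdiff_sdiff_left, sup_eq_union]
    · intro I hI J hJ h
      have hI := mem_powerset.1 hI
      have hJ := mem_powerset.1 hJ
      have h1 : Disjoint T I := (disjoint_sdiff.mono_right hI)
      have h2 : Disjoint T J := (disjoint_sdiff.mono_right hJ)
      simp only at h
      rw [← union_sdiff_cancel_left h1, h, union_sdiff_cancel_left h2]
  · intro I T
    simp only [mem_powerset, mem_Icc]
    constructor
    · rintro ⟨h, h'⟩; exact ⟨⟨h', h⟩, h'.trans h⟩
    · rintro ⟨⟨h, h'⟩, -⟩; exact ⟨h', h⟩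

lemma sum_powerset_neg_one_pow_mul_pow_sdiff {ι : Type*} [DecidableEq ι] (f : ι → ℚ) (S : Finset ι)
    (m : ℤ) (h0 : 0 ≤ m) (hm : m < S.card) (x : ℚ) :
    ∑ J ∈ S.powerset, (-1) ^ J.card * (x + ∑ j ∈ S \ J, f j) ^ m = 0 := by
  lift m to ℕ using h0
  have := sum_powerset_neg_one_pow_mul_pow (fun i => - f i) S m (by exact_mod_cast hm)
    (x + ∑ j ∈ S, f j)
  rw [← this]
  refine sum_congr rfl fun J hJ => ?_
  rw [← sum_sdiff (mem_powerset.1 hJ), zpow_natCast, sum_neg_distrib]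
  congr 2
  ring

/-- Hurwitz's extension of Abel's binomial identity. -/
lemma hurwitz_abel_one {ι : Type*} [DecidableEq ι] (f : ι → ℚ) (S : Finset ι)
    (hf : ∀ i ∈ S, 0 ≤ f i) (b K : ℚ) (hb : 0 < b) :
    ∑ I ∈ S.powerset, (K - (b + ∑ j ∈ S \ I, f j)) ^ I.card *
        (b + ∑ j ∈ S \ I, f j) ^ (((S \ I).card : ℤ) - 1) = K ^ S.card / b := by
  rw [sum_powerset_pow_mul_zpow f S hf b K hb, sum_eq_single S]
  · simp [div_eq_mul_inv]
  · intro T hT hTS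
    have hlt : 0 < (S \ T).card :=
      card_pos.2 (sdiff_nonempty.2 fun h => hTS ((mem_powerset.1 hT).antisymm h))
    rw [sum_powerset_neg_one_pow_mul_pow_sdiff _ _ _ (by omega) (by omega), mul_zero]
  · simp

lemma hurwitz_abel_two {ι : Type*} [DecidableEq ι] (f : ι → ℚ) (S : Finset ι)
    (hf : ∀ i ∈ S, 0 ≤ f i) (b K : ℚ) (hb : 0 < b) (hK : K ≠ 0) :
    ∑ I ∈ S.powerset, (K - (b + ∑ j ∈ S \ I, f j)) ^ I.card *
        (b + ∑ j ∈ S \ I, f j) ^ (((S \ I).card : ℤ) - 2)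
      = K ^ S.card * (1 / b ^ 2 - (∑ j ∈ S, f j / (b + f j)) / (b * K)) := by
  rw [sum_powerset_pow_mul_zpow f S hf b K hb]
  rw [← sum_subset (s₁ := insert S (S.image fun j => S.erase j)), sum_insert]
  · rw [sum_image, mul_sub, ]
    · simp only [sdiff_self]
      have : ∀ j ∈ S, K ^ (S.erase j).card * ∑ I ∈ (S \ S.erase j).powerset, (-1) ^ I.card *
          (b + ∑ j ∈ (S \ S.erase j) \ I, f j) ^ (((S \ S.erase j).card : ℤ) - 2)
          = - (K ^ S.card * (f j / (b + f j)) / (b * K)) := by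
        intro j hj
        have h := hf j hj
        rw [sdiff_erase_self hj, show ({j} : Finset ι).powerset = {∅, {j}} from rfl,
          sum_pair (singleton_ne_empty j).symm, card_erase_of_mem hj]
        obtain ⟨n, hn⟩ : ∃ n, S.card = n + 1 := ⟨S.card - 1, by have := card_pos.2 ⟨j, hj⟩; omega⟩
        simp [hn]
        have : b + f j ≠ 0 := by positivity
        field_simp
        ring
      rw [sum_congr rfl this, sum_neg_distrib, ← sum_div, ← mul_sum]
      simp [zpow_neg]
      ring_nf
    · intro i hi j hj h
      by_contra hne
      have : i ∈ S.erase i := by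
        simp only at h; rw [h]; exact mem_erase.2 ⟨hne, hi⟩
      simp at this
  · intro h
    obtain ⟨j, hj, h⟩ := mem_image.1 h
    rw [← h] at hj
    simp at hj
  · intro T hT
    simp only [mem_insert, mem_image] at hT
    rw [mem_powerset]
    rcases hT with rfl | ⟨j, hj, rfl⟩
    · rfl
    · exact erase_subset _ _
  · intro T hT hT'
    have hT := mem_powerset.1 hT
    have h1 : 2 ≤ (S \ T).card := by
      by_contra! hlt
      apply hT'
      rcases Nat.lt_succ_iff_lt_or_eq.1 hlt with h | h
      · have : S \ T = ∅ := card_eq_zero.1 (by omega)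
        rw [mem_insert]; left; exact hT.antisymm (sdiff_eq_empty_iff_subset.1 this)
      · obtain ⟨j, hj⟩ := card_eq_one.1 h
        refine mem_insert_of_mem (mem_image.2 ⟨j, (mem_sdiff.1 (hj ▸ mem_singleton_self j)).1, ?_⟩)
        rw [erase_eq, ← hj, Finset.sdiff_sdiff_eq_self hT]
    rw [sum_powerset_neg_one_pow_mul_pow_sdiff _ _ _ (by omega) (by omega), mul_zero]

/-- The coefficients `m ^ m / m!`. -/
def selfPowDivFactorial (m : ℕ) : ℚ := (m : ℚ) ^ m / (m.factorial : ℚ)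

local notation "w" => selfPowDivFactorial

lemma selfPowDivFactorial_pos (m : ℕ) : 0 < w m := by
  unfold selfPowDivFactorial
  rcases Nat.eq_zero_or_pos m with rfl | h
  · simp
  · positivity

@[simp] lemma selfPowDivFactorial_zero : w 0 = 1 := by simp [selfPowDivFactorial]

@[simp] lemma selfPowDivFactorial_one : w 1 = 1 := by simp [selfPowDivFactorial]

lemma hurwitz_abel_two_two {ι : Type*} [DecidableEq ι] (f : ι → ℚ) (S : Finset ι)
    (hf : ∀ i ∈ S, 0 ≤ f i) (a b K : ℚ) (ha : 0 < a) (hb : 0 < b) (hK : K = a + b + ∑ j ∈ S, f j) :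
    ∑ I ∈ S.powerset, (a + ∑ j ∈ I, f j) ^ ((I.card : ℤ) - 2) *
        (b + ∑ j ∈ S \ I, f j) ^ (((S \ I).card : ℤ) - 2)
      = K ^ S.card * ((1 / a ^ 2 + 1 / b ^ 2) / K ^ 2 + 2 * (1 / a + 1 / b) / K ^ 3
          - ((∑ j ∈ S, f j / (b + f j)) / b + (∑ j ∈ S, f j / (a + f j)) / a) / K ^ 3) := by
  have hK0 : 0 < K := by
    rw [hK]; exact add_pos_of_pos_of_nonneg (by positivity) (sum_nonneg hf)
  have refl : ∀ (a b : ℚ), K = a + b + ∑ j ∈ S, f j → ∀ e : ℤ,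
      ∑ I ∈ S.powerset, (a + ∑ j ∈ I, f j) ^ ((I.card : ℤ) - e) *
        (b + ∑ j ∈ S \ I, f j) ^ (S \ I).card
      = ∑ I ∈ S.powerset, (K - (a + ∑ j ∈ S \ I, f j)) ^ I.card *
        (a + ∑ j ∈ S \ I, f j) ^ (((S \ I).card : ℤ) - e) := by
    intro a b hK e
    refine sum_nbij' (S \ ·) (S \ ·) (by simp) (by simp) ?_ ?_ ?_
    · intro I hI; exact Finset.sdiff_sdiff_eq_self (mem_powerset.1 hI)
    · intro I hI; exact Finset.sdiff_sdiff_eq_self (mem_powerset.1 hI)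
    · intro I hI
      have hI := mem_powerset.1 hI
      rw [Finset.sdiff_sdiff_eq_self hI, mul_comm, hK, ← sum_sdiff hI]
      congr 2
      ring
  have e : ∀ I ∈ S.powerset, (a + ∑ j ∈ I, f j) ^ ((I.card : ℤ) - 2) *
        (b + ∑ j ∈ S \ I, f j) ^ (((S \ I).card : ℤ) - 2)
      = ((K - (b + ∑ j ∈ S \ I, f j)) ^ I.card *
          (b + ∑ j ∈ S \ I, f j) ^ (((S \ I).card : ℤ) - 2)) / K ^ 2
        + ((a + ∑ j ∈ I, f j) ^ ((I.card : ℤ) - 2) *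
          (b + ∑ j ∈ S \ I, f j) ^ (S \ I).card) / K ^ 2
        + 2 / K ^ 3 * ((K - (b + ∑ j ∈ S \ I, f j)) ^ I.card *
          (b + ∑ j ∈ S \ I, f j) ^ (((S \ I).card : ℤ) - 1))
        + 2 / K ^ 3 * ((a + ∑ j ∈ I, f j) ^ ((I.card : ℤ) - 1) *
          (b + ∑ j ∈ S \ I, f j) ^ (S \ I).card) := by
    intro I hI
    have hI := mem_powerset.1 hI
    have hA : 0 < a + ∑ j ∈ I, f j :=
      add_pos_of_pos_of_nonneg ha (sum_nonneg fun i hi => hf i (hI hi))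
    have hB : 0 < b + ∑ j ∈ S \ I, f j :=
      add_pos_of_pos_of_nonneg hb (sum_nonneg fun i hi => hf i (mem_sdiff.1 hi).1)
    have hKAB : K = (a + ∑ j ∈ I, f j) + (b + ∑ j ∈ S \ I, f j) := by
      rw [hK, ← sum_sdiff hI]; ring
    generalize a + ∑ j ∈ I, f j = A at *
    generalize b + ∑ j ∈ S \ I, f j = B at *
    rw [show K - B = A by rw [hKAB]; ring, zpow_sub₀ hA.ne', zpow_sub₀ hA.ne', zpow_sub₀ hB.ne',
      zpow_sub₀ hB.ne', zpow_natCast, zpow_natCast, zpow_one, zpow_one]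
    rw [show ((2 : ℤ) = ((2 : ℕ) : ℤ)) from rfl, zpow_natCast, zpow_natCast]
    field_simp
    rw [hKAB]
    ring
  rw [sum_congr rfl e]
  simp only [sum_add_distrib, ← sum_div, ← mul_sum]
  rw [hurwitz_abel_two f S hf b K hb hK0.ne', hurwitz_abel_one f S hf b K hb,
    refl a b hK, refl a b hK, hurwitz_abel_one f S hf a K ha,
      hurwitz_abel_two f S hf a K ha hK0.ne']
  field_simp
  ring

/-- Abel's identity. -/
lemma sum_antidiagonal_selfPow (m : ℕ) (hm : m ≠ 0) :
    ∑ p ∈ antidiagonal m, w p.1 * (w p.2 / p.2) = w m := by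
  obtain ⟨M, rfl⟩ := Nat.exists_eq_succ_of_ne_zero hm
  have h := hurwitz_abel_one (fun _ : ℕ => (1 : ℚ)) (range M) (by simp) 1 (M + 1) one_pos
  have h2 : ∀ I ∈ (range M).powerset,
      ((M : ℚ) + 1 - (1 + ∑ j ∈ range M \ I, (1 : ℚ))) ^ I.card *
        (1 + ∑ j ∈ range M \ I, (1 : ℚ)) ^ (((range M \ I).card : ℤ) - 1) =
      (fun i : ℕ => (i : ℚ) ^ i * (1 + (M - i : ℕ) : ℚ) ^ (((M - i : ℕ) : ℤ) - 1)) I.card := by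
    intro I hI
    have hI := mem_powerset.1 hI
    have := card_le_card hI
    rw [card_range] at this
    simp only [sum_const, card_sdiff_of_subset hI, card_range, nsmul_eq_mul, mul_one]
    push_cast [this]
    congr 2
    ring
  rw [sum_congr rfl h2, sum_powerset_apply_card
    (fun i : ℕ => (i : ℚ) ^ i * (1 + (M - i : ℕ) : ℚ) ^ (((M - i : ℕ) : ℤ) - 1)), card_range] at h
  rw [Nat.sum_antidiagonal_eq_sum_range_succ (fun i j => w i * (w j / (j : ℚ))), sum_range_succ]
  simp only [Nat.succ_eq_add_one, Nat.sub_self, Nat.cast_zero, div_zero, mul_zero, add_zero]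
  have h3 : w (M + 1) = ((M : ℚ) + 1) ^ M / 1 / (M.factorial : ℚ) := by
    simp only [selfPowDivFactorial, Nat.factorial_succ]
    push_cast
    have : (M : ℚ) + 1 ≠ 0 := by positivity
    field_simp
    ring
  rw [h3, ← h, sum_div]
  refine sum_congr rfl fun i hi => ?_
  have hi := Nat.lt_succ_iff.1 (mem_range.1 hi)
  obtain ⟨j, rfl⟩ := Nat.exists_eq_add_of_le hi
  rw [show i + j + 1 - i = j + 1 by omega, show i + j - i = j by omega, nsmul_eq_mul,
    Nat.cast_add_choose]
  simp only [selfPowDivFactorial, Nat.factorial_succ]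
  have : (j : ℚ) + 1 ≠ 0 := by positivity
  rw [zpow_sub₀ (by positivity), zpow_natCast, zpow_one]
  push_cast
  rw [pow_succ, add_comm (1 : ℚ)]
  field_simp

open PowerSeries in
lemma X_mul_derivative_selfPow :
    (X : PowerSeries ℚ) * PowerSeries.derivative ℚ (mk selfPowDivFactorial)
      = (mk selfPowDivFactorial - 1) * mk selfPowDivFactorial ^ 2 := by
  set W : PowerSeries ℚ := mk selfPowDivFactorial with hW
  set T : PowerSeries ℚ := mk fun m => w m / m with hT
  have h1 : W * T = W - 1 := by
    ext n
    rw [coeff_mul, map_sub, coeff_one]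
    simp only [hW, hT, coeff_mk]
    rcases eq_or_ne n 0 with rfl | hn
    · simp
    · rw [sum_antidiagonal_selfPow n hn]; simp [hn]
  have h2 : X * PowerSeries.derivative ℚ T = W - 1 := by
    ext n
    rcases n with _ | n
    · simp [hW]
    · rw [coeff_succ_X_mul, coeff_derivative]
      have : (n : ℚ) + 1 ≠ 0 := by positivity
      simp [hW, hT, coeff_one]
      field_simp
  have h3 := congrArg (fun f => X * PowerSeries.derivative ℚ f * W) h1
  simp only [Derivation.leibniz, map_sub, smul_eq_mul] at h3
  rw [show PowerSeries.derivative ℚ (1 : PowerSeries ℚ) = 0 from Derivation.map_one_eq_zero _] at h3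
  linear_combination (-1 : PowerSeries ℚ) * h3 + W ^ 2 * h2 +
    (X * PowerSeries.derivative ℚ W) * h1

namespace PowerSeries

/-- The Euler operator `x ∂/∂x + y ∂/∂y` on power series in two variables. -/
noncomputable def euler (f : PowerSeries (PowerSeries ℚ)) : PowerSeries (PowerSeries ℚ) :=
  mk fun p => mk fun q => ((p : ℚ) + q) * coeff q (coeff p f)

lemma coeff_coeff_mul (f g : PowerSeries (PowerSeries ℚ)) (p q : ℕ) :
    coeff q (coeff p (f * g)) = ∑ a ∈ antidiagonal p, ∑ c ∈ antidiagonal q,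
      coeff c.1 (coeff a.1 f) * coeff c.2 (coeff a.2 g) := by
  rw [coeff_mul, map_sum]
  exact sum_congr rfl fun a _ => coeff_mul _ _ _

lemma coeff_coeff_euler (f : PowerSeries (PowerSeries ℚ)) (p q : ℕ) :
    coeff q (coeff p (euler f)) = ((p : ℚ) + q) * coeff q (coeff p f) := by
  simp [euler]

lemma euler_sub (f g : PowerSeries (PowerSeries ℚ)) : euler (f - g) = euler f - euler g := by
  ext p q
  simp only [coeff_coeff_euler, map_sub]
  ring

lemma euler_add (f g : PowerSeries (PowerSeries ℚ)) : euler (f + g) = euler f + euler g := by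
  ext p q
  simp only [coeff_coeff_euler, map_add]
  ring

lemma euler_mul (f g : PowerSeries (PowerSeries ℚ)) :
    euler (f * g) = euler f * g + f * euler g := by
  ext p q
  simp only [coeff_coeff_euler, map_add, coeff_coeff_mul, mul_sum, ← sum_add_distrib]
  refine sum_congr rfl fun a ha => sum_congr rfl fun c hc => ?_
  rw [← mem_antidiagonal.1 ha, ← mem_antidiagonal.1 hc]
  push_cast
  ring

lemma euler_one : euler 1 = 0 := by
  ext p q
  rw [coeff_coeff_euler, coeff_one]
  split_ifs with h
  · rw [coeff_one]
    split_ifs with h'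
    · simp [h, h']
    · simp
  · simp

lemma euler_X : euler X = X := by
  ext p q
  rw [coeff_coeff_euler, coeff_X]
  split_ifs with h
  · rw [coeff_one]
    split_ifs with h'
    · simp [h, h']
    · simp
  · simp

lemma euler_C (f : PowerSeries ℚ) : euler (C f) = C (X * derivative ℚ f) := by
  ext p q
  rw [coeff_coeff_euler, coeff_C, coeff_C]
  split_ifs with h
  · rcases q with _ | q
    · simp [h]
    · rw [coeff_succ_X_mul, coeff_derivative]
      simp [h]
      ring
  · simp

lemma euler_map_C (f : PowerSeries ℚ) : euler (map C f) = map C (X * derivative ℚ f) := by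
  ext p q
  rw [coeff_coeff_euler, coeff_map, coeff_map, coeff_C, coeff_C]
  split_ifs with h
  · rcases p with _ | p
    · simp [h]
    · rw [coeff_succ_X_mul, coeff_derivative]
      simp [h]
      ring
  · simp

/-- Uniqueness for the differential equation `E z = (2 + ε) z`. -/
lemma eq_zero_of_euler_eq (z ε : PowerSeries (PowerSeries ℚ)) (hε : coeff 0 (coeff 0 ε) = 0)
    (h : euler z = (2 + ε) * z) (hz : ∀ p q, p + q = 2 → coeff q (coeff p z) = 0) : z = 0 := by
  suffices H : ∀ n p q, p + q = n → coeff q (coeff p z) = 0 by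
    ext p q; simpa using H _ p q rfl
  intro n
  induction n using Nat.strong_induction_on with
  | _ n ih =>
  intro p q hpq
  by_cases hn : n = 2
  · exact hz p q (hpq.trans hn)
  have h1 := congrArg (fun f => coeff q (coeff p f)) h
  have h0 : coeff q (coeff p (ε * z)) = 0 := by
    rw [coeff_coeff_mul]
    refine sum_eq_zero fun a ha => sum_eq_zero fun c hc => ?_
    have ha := mem_antidiagonal.1 ha
    have hc := mem_antidiagonal.1 hc
    by_cases h00 : a.1 = 0 ∧ c.1 = 0
    · rw [h00.1, h00.2, hε, zero_mul]
    · rw [ih (a.2 + c.2) (by omega) a.2 c.2 rfl, mul_zero]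
  simp only [coeff_coeff_euler] at h1
  rw [show (2 + ε) * z = z + z + ε * z by ring] at h1
  simp only [map_add, h0] at h1
  have : ((p : ℚ) + q - 2) * coeff q (coeff p z) = 0 := by linarith
  rcases mul_eq_zero.1 this with h | h
  · exfalso
    apply hn
    rw [← hpq]
    exact_mod_cast (sub_eq_zero.1 h)
  · exact h

end PowerSeries

open PowerSeries in
lemma selfPow_add_antidiagonal (p q : ℕ) (hp : p ≠ 0) (hq : q ≠ 0) :
    w (p + q) = ∑ a ∈ antidiagonal p, q * w q * w a.1 / (a.1 + q) * (if a.2 = 0 then 0 else w a.2)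
      + ∑ a ∈ antidiagonal q, p * w p * w a.1 / (a.1 + p) * (if a.2 = 0 then 0 else w a.2) := by
  set W : PowerSeries ℚ := PowerSeries.mk selfPowDivFactorial with hW
  set U : PowerSeries (PowerSeries ℚ) := PowerSeries.map C W with hU
  set V : PowerSeries (PowerSeries ℚ) := C W with hV
  set x : PowerSeries (PowerSeries ℚ) := X with hx
  set y : PowerSeries (PowerSeries ℚ) := C X with hy
  set A : PowerSeries (PowerSeries ℚ) :=
    PowerSeries.mk fun p => PowerSeries.mk fun q => q * w q * w p / (p + q) with hA
  set B : PowerSeries (PowerSeries ℚ) :=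
    PowerSeries.mk fun p => PowerSeries.mk fun q => p * w p * w q / (q + p) with hB
  set L : PowerSeries (PowerSeries ℚ) :=
    PowerSeries.mk fun p => PowerSeries.mk fun q => if p = 0 ∨ q = 0 then 0 else w (p + q) with hL
  have hUV : ∀ p q, coeff q (coeff p (U * V)) = w p * w q := by
    intro p q
    rw [hV, coeff_mul_C, hU, coeff_map, coeff_C_mul, hW]
    simp
  have hB' : B = U * V - 1 - A := by
    ext p q
    rw [map_sub, map_sub, map_sub, map_sub, hUV, hA, hB]
    simp only [coeff_mk, coeff_one]
    by_cases hpq : p = 0 ∧ q = 0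
    · simp [hpq.1, hpq.2]
    · have : (p : ℚ) + q ≠ 0 := by
        intro h
        have : p + q = 0 := by exact_mod_cast h
        omega
      have h0 : coeff q (if p = 0 then (1 : PowerSeries ℚ) else 0) = 0 := by
        split_ifs with h
        · rw [coeff_one, if_neg]; tauto
        · simp
      rw [h0, add_comm (q : ℚ) p]
      field_simp
      ring
  have eU : euler U = (U - 1) * U ^ 2 := by
    rw [hU, euler_map_C, X_mul_derivative_selfPow]; simp [hW]
  have eV : euler V = (V - 1) * V ^ 2 := by
    rw [hV, euler_C, X_mul_derivative_selfPow]; simp [hW]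
  have ex : euler x = x := euler_X
  have ey : euler y = y := by rw [hy, euler_C]; simp
  have eA : euler A = U * ((V - 1) * V ^ 2) := by
    rw [← eV, hV, euler_C]
    ext p q
    rw [coeff_coeff_euler, coeff_mul_C, hU, coeff_map, coeff_C_mul, hA]
    rcases q with _ | q
    · simp
    · rw [coeff_succ_X_mul, coeff_derivative]
      simp only [coeff_mk, hW]
      have : (p : ℚ) + (q + 1 : ℕ) ≠ 0 := by positivity
      field_simp
      push_cast
      ring
  have hxy : x - y ≠ 0 := by
    intro h
    have := congrArg (fun f => coeff 0 (coeff 1 f)) h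
    simp [hx, hy] at this
  have hxL : (x - y) * L = y * (U - 1) - x * (V - 1) := by
    ext p q
    rw [sub_mul, map_sub, map_sub, map_sub, map_sub, hx, hy, coeff_C_mul, coeff_C_mul]
    rcases p with _ | p <;> rcases q with _ | q
    · simp
    · rw [coeff_zero_X_mul, coeff_zero_X_mul, coeff_succ_X_mul, coeff_succ_X_mul]
      simp [-coeff_zero_eq_constantCoeff, hL, hU, hW, coeff_one]
    · rw [coeff_zero_X_mul, coeff_zero_X_mul, coeff_succ_X_mul, coeff_succ_X_mul]
      simp [hL, hV, hW, coeff_C, coeff_one]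
      split_ifs <;> simp
    · rw [coeff_succ_X_mul, coeff_succ_X_mul, coeff_succ_X_mul, coeff_succ_X_mul]
      simp [hL, hV, hU, hW, coeff_C, coeff_one]
      rcases p with _ | p <;> rcases q with _ | q <;> simp
      · rw [add_comm]
      · rw [show p + 1 + (q + 1 + 1) = p + 1 + 1 + (q + 1) by omega]; ring
  have hU' : ∀ p q, coeff q (coeff p U) = if q = 0 then w p else 0 := by
    intro p q; rw [hU, coeff_map, coeff_C, hW, coeff_mk]
  have hV' : ∀ p q, coeff q (coeff p V) = if p = 0 then w q else 0 := by
    intro p q; rw [hV, coeff_C]; split_ifs <;> simp [hW]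
  have h1 : ∀ p q, coeff q (coeff p (1 : PowerSeries (PowerSeries ℚ)))
      = if p = 0 ∧ q = 0 then 1 else 0 := by
    intro p q; rw [coeff_one]; split_ifs with h h' h' <;> simp_all [coeff_one]
  have hD : ∀ p q, p + q = 1 → coeff q (coeff p (L - (A * (U - 1) + B * (V - 1)))) = 0 := by
    intro p q hpq
    have : (p = 0 ∧ q = 1) ∨ (p = 1 ∧ q = 0) := by omega
    simp only [map_sub, map_add, coeff_coeff_mul, hU', hV', h1]
    rcases this with ⟨rfl, rfl⟩ | ⟨rfl, rfl⟩ <;>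
    simp [-coeff_zero_eq_constantCoeff, hA, hB, hL, Finset.Nat.antidiagonal_succ]
  have key : L = A * (U - 1) + B * (V - 1) := by
    apply mul_left_cancel₀ hxy
    rw [← sub_eq_zero]
    refine eq_zero_of_euler_eq _ (U ^ 2 + U * V + V ^ 2 - U - V - 1) ?_ ?_ ?_
    · simp [-coeff_zero_eq_constantCoeff, pow_two, coeff_coeff_mul, hU', hV']
    · rw [hxL, hB']
      simp only [euler_add, euler_sub, euler_mul, eU, eV, eA, ex, ey, euler_one]
      ring
    · intro p q hpq
      rw [← mul_sub, sub_mul, map_sub, map_sub, hx, hy, coeff_C_mul]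
      rcases p with _ | p <;> rcases q with _ | q
      · simp at hpq
      · rw [coeff_zero_X_mul, coeff_succ_X_mul, hD _ _ (by omega)]; simp
      · rw [coeff_zero_X_mul, coeff_succ_X_mul, hD _ _ (by omega)]; simp
      · rw [coeff_succ_X_mul, coeff_succ_X_mul, hD _ _ (by omega), hD _ _ (by omega)]; simp
  have hc := congrArg (fun f => coeff q (coeff p f)) key
  simp only [map_add] at hc
  rw [coeff_mul, hV, ← map_one C, ← map_sub C, coeff_mul_C, coeff_mul, map_sum] at hc
  simp only [hL, coeff_mk, hp, hq, or_self, if_false] at hc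
  rw [hc]
  congr 1
  · refine sum_congr rfl fun a ha => ?_
    rw [map_sub, hU, coeff_map, map_one, coeff_one]
    split_ifs with h0
    · simp [h0, hW]
    · simp [hA, hW]
  · refine sum_congr rfl fun a ha => ?_
    rw [map_sub, coeff_one]
    split_ifs with h0
    · simp [h0, hW]
    · simp [hB, hW]

lemma sum_Ico_selfPow_div (m : ℕ) (hm : m ≠ 0) :
    ∑ r ∈ Ico 1 m, w r * w (m - r) / (m - r : ℕ) = w m - w m / m := by
  have h := sum_antidiagonal_selfPow m hm
  rw [Nat.sum_antidiagonal_eq_sum_range_succ (fun i j => w i * (w j / (j : ℚ))), sum_range_succ,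
    range_eq_Ico, sum_eq_sum_Ico_succ_bot (by omega)] at h
  simp only [Nat.sub_self, Nat.cast_zero, div_zero, mul_zero, add_zero, Nat.sub_zero,
    selfPowDivFactorial_zero, one_mul, zero_add] at h
  simp only [mul_div_assoc]
  linarith

lemma sum_Ico_selfPow_div_mul (m : ℕ) (hm : m ≠ 0) :
    ∑ r ∈ Ico 1 m, w r * w (m - r) / (r * (m - r : ℕ)) = 2 * (m - 1) / m ^ 2 * w m := by
  have h1 := sum_Ico_selfPow_div m hm
  have h2 : ∑ r ∈ Ico 1 m, w r * w (m - r) / r = w m - w m / m := by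
    rw [← h1]
    refine sum_nbij' (m - ·) (m - ·) ?_ ?_ ?_ ?_ ?_ <;> simp only [mem_Ico] <;> intro r hr
    · omega
    · omega
    · omega
    · omega
    · rw [Nat.sub_sub_self (by omega), mul_comm]
  have hm' : (m : ℚ) ≠ 0 := by exact_mod_cast hm
  have : ∀ r ∈ Ico 1 m, w r * w (m - r) / (r * (m - r : ℕ)) =
      (w r * w (m - r) / r + w r * w (m - r) / (m - r : ℕ)) / m := by
    intro r hr
    rw [mem_Ico] at hr
    obtain ⟨s, rfl⟩ := Nat.exists_eq_add_of_le hr.2.le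
    have : (r : ℚ) ≠ 0 := by have := hr.1; positivity
    have : (s : ℚ) ≠ 0 := by norm_cast; omega
    rw [Nat.add_sub_cancel_left]
    push_cast at hm' ⊢
    field_simp
    ring
  rw [sum_congr rfl this, ← sum_div, sum_add_distrib, h1, h2]
  field_simp
  ring

/-- The sums `∑ w_r w_{m-r} / (r + q)`. -/
noncomputable def selfPowSum (m : ℕ) (q : ℚ) : ℚ := ∑ r ∈ Ico 1 m, w r * w (m - r) / (r + q)

local notation "R" => selfPowSum

lemma selfPow_add (p q : ℕ) (hp : p ≠ 0) (hq : q ≠ 0) :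
    w (p + q) = 2 * w p * w q + q * w q * R p q + p * w p * R q p := by
  have aux : ∀ p q : ℕ, p ≠ 0 → q ≠ 0 →
      ∑ a ∈ antidiagonal p, q * w q * w a.1 / (a.1 + q) * (if a.2 = 0 then 0 else w a.2)
        = w p * w q + q * w q * R p q := by
    intro p q hp hq
    rw [Nat.sum_antidiagonal_eq_sum_range_succ
      (fun i j => q * w q * w i / (i + q) * (if j = 0 then 0 else w j)), sum_range_succ,
      range_eq_Ico, sum_eq_sum_Ico_succ_bot (by omega), selfPowSum, mul_sum]
    have hq' : (q : ℚ) ≠ 0 := by exact_mod_cast hq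
    simp only [Nat.sub_self, if_true, mul_zero, add_zero, Nat.sub_zero, if_neg hp, zero_add,
      Nat.cast_zero, selfPowDivFactorial_zero]
    congr 1
    · field_simp
    · refine sum_congr rfl fun r hr => ?_
      rw [mem_Ico] at hr
      rw [if_neg (by omega)]
      ring
  rw [selfPow_add_antidiagonal p q hp hq, aux p q hp hq, aux q p hq hp]
  ring

lemma sum_Ico_hurwitz {ι : Type*} (f : ι → ℚ) (S : Finset ι) (hf : ∀ i ∈ S, 0 ≤ f i)
    (m : ℕ) (hm : m ≠ 0) (K : ℚ) (hK : K = m + ∑ j ∈ S, f j) :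
    ∑ r ∈ Ico 1 m, (r * w r) * ((m - r : ℕ) * w (m - r)) *
      ((1 / (r : ℚ) ^ 2 + 1 / ((m - r : ℕ) : ℚ) ^ 2) / K ^ 2
          + 2 * (1 / (r : ℚ) + 1 / ((m - r : ℕ) : ℚ)) / K ^ 3
          - ((∑ j ∈ S, f j / ((m - r : ℕ) + f j)) / ((m - r : ℕ) : ℚ)
              + (∑ j ∈ S, f j / (r + f j)) / r) / K ^ 3)
      = (2 * K * (m - 1) * w m - 2 * ∑ j ∈ S, f j * (m + f j) * R m (f j)) / K ^ 3 := by
  have hK0 : 0 < K := by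
    rw [hK]; exact add_pos_of_pos_of_nonneg (by positivity) (sum_nonneg hf)
  have hR : ∀ j, ∑ r ∈ Ico 1 m, w r * w (m - r) / ((m - r : ℕ) + f j) = R m (f j) := by
    intro j
    rw [selfPowSum]
    refine sum_nbij' (m - ·) (m - ·) ?_ ?_ ?_ ?_ ?_ <;> simp only [mem_Ico] <;> intro r hr
    · omega
    · omega
    · omega
    · omega
    · rw [Nat.sub_sub_self (by omega), mul_comm (w r)]
  have e : ∀ r ∈ Ico 1 m, (r * w r) * ((m - r : ℕ) * w (m - r)) *
      ((1 / (r : ℚ) ^ 2 + 1 / ((m - r : ℕ) : ℚ) ^ 2) / K ^ 2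
          + 2 * (1 / (r : ℚ) + 1 / ((m - r : ℕ) : ℚ)) / K ^ 3
          - ((∑ j ∈ S, f j / ((m - r : ℕ) + f j)) / ((m - r : ℕ) : ℚ)
              + (∑ j ∈ S, f j / (r + f j)) / r) / K ^ 3)
      = (K * m ^ 2 * (w r * w (m - r) / (r * (m - r : ℕ)))
          - ∑ j ∈ S, (f j * (m + f j) * (w r * w (m - r) / (r + f j))
              + f j * (m + f j) * (w r * w (m - r) / ((m - r : ℕ) + f j)))) / K ^ 3 := by
    intro r hr
    rw [mem_Ico] at hr
    obtain ⟨s, rfl⟩ := Nat.exists_eq_add_of_le hr.2.le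
    have hr0 : (0 : ℚ) < r := by have := hr.1; positivity
    have hs0 : (0 : ℚ) < s := by norm_cast; omega
    rw [Nat.add_sub_cancel_left]
    have h1 : ∀ j ∈ S, f j * ((r + s : ℕ) + f j) * (w r * w s / (r + f j))
              + f j * ((r + s : ℕ) + f j) * (w r * w s / (s + f j))
        = w r * w s * (s * (f j / (r + f j)) + r * (f j / (s + f j)) + 2 * f j) := by
      intro j hj
      have := hf j hj
      have : (r : ℚ) + f j ≠ 0 := by positivity
      have : (s : ℚ) + f j ≠ 0 := by positivity
      push_cast
      field_simp
      ring
    have h2 : ∑ j ∈ S, f j = K - r - s := by rw [hK]; push_cast; ring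
    rw [sum_congr rfl h1]
    simp only [sum_add_distrib, ← mul_sum]
    rw [h2]
    push_cast
    field_simp
    ring
  rw [sum_congr rfl e, ← sum_div, sum_sub_distrib, ← mul_sum, sum_Ico_selfPow_div_mul m hm,
    sum_comm]
  congr 2
  · have : (m : ℚ) ≠ 0 := by exact_mod_cast hm
    field_simp
  · rw [mul_sum]
    refine sum_congr rfl fun j _ => ?_
    rw [sum_add_distrib, ← mul_sum, ← mul_sum, hR, selfPowSum]
    ring

/-- The weight `m ^ (m + 1) / m!` of a cycle of length `m`. -/
def cycleWeight (m : ℕ) : ℚ := m * w m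

local notation "v" => cycleWeight

lemma cycleWeight_pos {m : ℕ} (hm : 0 < m) : 0 < v m :=
  mul_pos (by exact_mod_cast hm) (selfPowDivFactorial_pos m)

/-- Hurwitz's recursion for the numbers `K ^ (n - 3) * ∏ kᵢ ^ (kᵢ + 1) / kᵢ!`. -/
lemma hurwitz_recursion {ι : Type*} [DecidableEq ι] (C : Finset ι) (k : ι → ℕ)
    (hC : C.Nonempty) (hk : ∀ i ∈ C, 0 < k i) :
    (∑ i ∈ C, ∑ j ∈ C.erase i, (k i : ℚ) * k j * ((∑ c ∈ C, (k c : ℚ)) ^ ((C.card : ℤ) - 4) *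
        (v (k i + k j) * ∏ c ∈ (C.erase i).erase j, v (k c))))
      + ∑ i ∈ C, (k i : ℚ) * ∑ r ∈ Ico 1 (k i), ∑ I ∈ (C.erase i).powerset,
        (((r : ℚ) + ∑ c ∈ I, (k c : ℚ)) ^ ((I.card : ℤ) - 2) * (v r * ∏ c ∈ I, v (k c))) *
        ((((k i - r : ℕ) : ℚ) + ∑ c ∈ C.erase i \ I, (k c : ℚ)) ^
            (((C.erase i \ I).card : ℤ) - 2) *
          (v (k i - r) * ∏ c ∈ C.erase i \ I, v (k c)))
      = 2 * ((∑ c ∈ C, (k c : ℚ)) + C.card - 2) *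
          ((∑ c ∈ C, (k c : ℚ)) ^ ((C.card : ℤ) - 3) * ∏ c ∈ C, v (k c)) := by
  set K := ∑ c ∈ C, (k c : ℚ) with hK
  set P := ∏ c ∈ C, v (k c) with hP
  have hK0 : 0 < K := sum_pos (fun i hi => by exact_mod_cast hk i hi) hC
  have hw : ∀ m, w m ≠ 0 := fun m => (selfPowDivFactorial_pos m).ne'
  have hk' : ∀ i ∈ C, (k i : ℚ) ≠ 0 := fun i hi => by exact_mod_cast (hk i hi).ne'
  have hPi : ∀ i ∈ C, ∏ c ∈ C.erase i, v (k c) = P / v (k i) := by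
    intro i hi
    rw [hP, ← mul_prod_erase _ _ hi, mul_div_cancel_left₀]
    exact (cycleWeight_pos (hk i hi)).ne'
  have h1 : ∀ i ∈ C, ∀ j ∈ C.erase i, (k i : ℚ) * k j * (K ^ ((C.card : ℤ) - 4) *
        (v (k i + k j) * ∏ c ∈ (C.erase i).erase j, v (k c)))
      = K ^ ((C.card : ℤ) - 4) * P * (2 * (k i + k j) + (k i + k j) * k j * R (k i) (k j) / w (k i)
          + (k j + k i) * k i * R (k j) (k i) / w (k j)) := by
    intro i hi j hj
    have hj' := (mem_erase.1 hj).2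
    have h := hPi i hi
    rw [← mul_prod_erase _ _ hj] at h
    have : ∏ c ∈ (C.erase i).erase j, v (k c) = P / v (k i) / v (k j) := by
      rw [← h, mul_div_cancel_left₀]
      exact (cycleWeight_pos (hk j hj')).ne'
    rw [this]
    simp only [cycleWeight]
    rw [selfPow_add _ _ (hk i hi).ne' (hk j hj').ne']
    have := hk' i hi
    have := hk' j hj'
    have := hw (k i)
    have := hw (k j)
    push_cast
    field_simp
    ring
  have h2 : ∀ i ∈ C, (k i : ℚ) * ∑ r ∈ Ico 1 (k i), ∑ I ∈ (C.erase i).powerset,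
        (((r : ℚ) + ∑ c ∈ I, (k c : ℚ)) ^ ((I.card : ℤ) - 2) * (v r * ∏ c ∈ I, v (k c))) *
        ((((k i - r : ℕ) : ℚ) + ∑ c ∈ C.erase i \ I, (k c : ℚ)) ^
            (((C.erase i \ I).card : ℤ) - 2) *
          (v (k i - r) * ∏ c ∈ C.erase i \ I, v (k c)))
      = K ^ ((C.card : ℤ) - 4) * P * (2 * K * (k i - 1)
        - 2 * ∑ j ∈ C.erase i, (k i + k j) * k j * R (k i) (k j) / w (k i)) := by
    intro i hi
    have hKi : K = k i + ∑ j ∈ C.erase i, (k j : ℚ) := by rw [hK, ← add_sum_erase _ _ hi]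
    have hf : ∀ j ∈ C.erase i, (0 : ℚ) ≤ k j := fun j _ => by positivity
    have hr : ∀ r ∈ Ico 1 (k i), ∑ I ∈ (C.erase i).powerset,
        (((r : ℚ) + ∑ c ∈ I, (k c : ℚ)) ^ ((I.card : ℤ) - 2) * (v r * ∏ c ∈ I, v (k c))) *
        ((((k i - r : ℕ) : ℚ) + ∑ c ∈ C.erase i \ I, (k c : ℚ)) ^
            (((C.erase i \ I).card : ℤ) - 2) *
          (v (k i - r) * ∏ c ∈ C.erase i \ I, v (k c)))
        = P / v (k i) * K ^ (C.erase i).card * ((r * w r) * ((k i - r : ℕ) * w (k i - r)) *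
      ((1 / (r : ℚ) ^ 2 + 1 / ((k i - r : ℕ) : ℚ) ^ 2) / K ^ 2
          + 2 * (1 / (r : ℚ) + 1 / ((k i - r : ℕ) : ℚ)) / K ^ 3
          - ((∑ j ∈ C.erase i, (k j : ℚ) / ((k i - r : ℕ) + k j)) / ((k i - r : ℕ) : ℚ)
              + (∑ j ∈ C.erase i, (k j : ℚ) / (r + k j)) / r) / K ^ 3)) := by
      intro r hr
      rw [mem_Ico] at hr
      have := hurwitz_abel_two_two (fun j => (k j : ℚ)) (C.erase i) hf r (k i - r : ℕ) K
        (by exact_mod_cast hr.1) (by norm_cast; omega)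
        (by rw [hKi]; push_cast [hr.2.le]; ring)
      have e3 : ∀ a b c d e : ℚ, a * b * (c * d * e) = a * c * d * (b * e) := by intros; ring
      rw [e3, ← this, mul_sum]
      refine sum_congr rfl fun I hI => ?_
      rw [← hPi i hi, ← prod_sdiff (mem_powerset.1 hI), cycleWeight, cycleWeight]
      ring
    rw [sum_congr rfl hr, ← mul_sum,
      sum_Ico_hurwitz (fun j => (k j : ℚ)) _ hf _ (hk i hi).ne' K hKi]
    have e1 : K ^ (C.erase i).card = K ^ ((C.card : ℤ) - 4) * K ^ 3 := by
      rw [card_erase_of_mem hi, ← zpow_natCast, ← zpow_natCast, ← zpow_add₀ hK0.ne']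
      have := card_pos.2 hC
      congr 1
      push_cast [Nat.one_le_iff_ne_zero.2 this.ne']
      ring
    rw [e1]
    have e2 : ∑ j ∈ C.erase i, ((k i : ℚ) + k j) * k j * R (k i) (k j) / w (k i)
        = (∑ j ∈ C.erase i, (k j : ℚ) * (k i + k j) * R (k i) (k j)) / w (k i) := by
      rw [sum_div]
      exact sum_congr rfl fun j _ => by ring
    rw [e2]
    simp only [cycleWeight]
    have := hk' i hi
    have := hw (k i)
    field_simp
  rw [sum_congr rfl fun i hi => sum_congr rfl (h1 i hi), sum_congr rfl h2]
  simp only [← mul_sum, sum_sub_distrib, sum_add_distrib]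
  have h3 : ∑ i ∈ C, ∑ j ∈ C.erase i, ((k j : ℚ) + k i) * k i * R (k j) (k i) / w (k j)
      = ∑ i ∈ C, ∑ j ∈ C.erase i, ((k i : ℚ) + k j) * k j * R (k i) (k j) / w (k i) := by
    refine sum_comm' fun i j => ?_
    simp only [mem_erase, ne_eq]
    tauto
  have h4 : ∑ i ∈ C, ∑ j ∈ C.erase i, (k j : ℚ) = C.card * K - K := by
    rw [sum_congr rfl fun i hi => (eq_sub_of_add_eq' (add_sum_erase C (fun j => (k j : ℚ)) hi))]
    simp [hK]
  have h5 : ∑ i ∈ C, ∑ j ∈ C.erase i, (k i : ℚ) = C.card * K - K := by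
    rw [← h4]
    refine sum_comm' fun i j => ?_
    simp only [mem_erase, ne_eq]
    tauto
  rw [h3, h4, h5, show ((C.card : ℤ) - 3) = (C.card : ℤ) - 4 + 1 by ring, zpow_add_one₀ hK0.ne']
  rw [← hK]
  simp
  ring

end AbelIdentities

section TranspositionFactorizations

open Finset

set_option linter.unusedSectionVars false

noncomputable section Orbits

variable {α : Type*} [Fintype α] [DecidableEq α]

/-- The orbit of `x` under `σ`. -/
def permOrbit (σ : Perm α) (x : α) : Finset α :=
  (range (Function.minimalPeriod σ x)).image fun j => (σ ^ j) x

/-- The orbits of `σ` meeting `S`. -/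
def permOrbits (σ : Perm α) (S : Finset α) : Finset (Finset α) := S.image (permOrbit σ)

/-- `S` is stable under `σ`. -/
def PermStable (σ : Perm α) (S : Finset α) : Prop := ∀ z ∈ S, σ z ∈ S

lemma minimalPeriod_perm_pos (σ : Perm α) (x : α) : 0 < Function.minimalPeriod σ x :=
  Function.minimalPeriod_pos_of_mem_periodicPts (σ.injective.mem_periodicPts x)

lemma mem_permOrbit {σ : Perm α} {x y : α} : y ∈ permOrbit σ x ↔ σ.SameCycle x y := by
  simp only [permOrbit, mem_image, mem_range]
  constructor
  · rintro ⟨j, -, rfl⟩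
    exact ⟨j, by simp⟩
  · intro h
    obtain ⟨i, rfl⟩ := h.exists_nat_pow_eq
    refine ⟨i % Function.minimalPeriod σ x, Nat.mod_lt _ (minimalPeriod_perm_pos σ x), ?_⟩
    rw [← Equiv.Perm.iterate_eq_pow, ← Equiv.Perm.iterate_eq_pow,
      Function.iterate_mod_minimalPeriod_eq]

lemma injOn_pow_minimalPeriod (σ : Perm α) (x : α) :
    Set.InjOn (fun j => (σ ^ j) x) (Set.Iio (Function.minimalPeriod σ x)) := by
  simpa only [Equiv.Perm.iterate_eq_pow] using
    Function.iterate_injOn_Iio_minimalPeriod (f := σ) (x := x)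

lemma card_permOrbit (σ : Perm α) (x : α) :
    (permOrbit σ x).card = Function.minimalPeriod σ x := by
  rw [permOrbit, card_image_of_injOn, card_range]
  simpa using injOn_pow_minimalPeriod σ x

lemma self_mem_permOrbit (σ : Perm α) (x : α) : x ∈ permOrbit σ x := mem_permOrbit.2 (.refl _ _)

lemma permOrbit_eq {σ : Perm α} {x y : α} (h : σ.SameCycle x y) :
    permOrbit σ x = permOrbit σ y := by
  ext z
  rw [mem_permOrbit, mem_permOrbit]
  exact ⟨h.symm.trans, h.trans⟩

lemma sum_permOrbit_erase {M : Type*} [AddCommMonoid M] (σ : Perm α) (x : α) (g : α → M) :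
    ∑ y ∈ (permOrbit σ x).erase x, g y = ∑ r ∈ Ico 1 (permOrbit σ x).card, g ((σ ^ r) x) := by
  have h := injOn_pow_minimalPeriod σ x
  have h0 := minimalPeriod_perm_pos σ x
  rw [card_permOrbit]
  symm
  refine sum_bij (fun r _ => (σ ^ r) x) ?_ ?_ ?_ fun _ _ => rfl
  · intro r hr
    rw [mem_Ico] at hr
    rw [mem_erase, mem_permOrbit]
    refine ⟨fun e => ?_, r, by simp⟩
    have := h (x₁ := r) (x₂ := 0) hr.2 h0 (by simpa using e)
    omega
  · intro r hr s hs e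
    rw [mem_Ico] at hr hs
    exact h hr.2 hs.2 e
  · intro y hy
    rw [mem_erase, permOrbit, mem_image] at hy
    obtain ⟨hyx, r, hr, rfl⟩ := hy
    refine ⟨r, ?_, rfl⟩
    rw [mem_range] at hr
    rw [mem_Ico]
    refine ⟨Nat.one_le_iff_ne_zero.2 ?_, hr⟩
    rintro rfl
    simp at hyx

namespace PermStable

variable {σ : Perm α} {S O : Finset α} {x y : α}

lemma mem_of_sameCycle (hS : PermStable σ S) (hx : x ∈ S) (h : σ.SameCycle x y) : y ∈ S := by
  obtain ⟨i, rfl⟩ := h.exists_nat_pow_eq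
  induction i with
  | zero => exact hx
  | succ n ih => rw [pow_succ']; exact hS _ (ih ⟨n, by simp⟩)

lemma permOrbit_subset (hS : PermStable σ S) (hx : x ∈ S) : permOrbit σ x ⊆ S :=
  fun _ hy => hS.mem_of_sameCycle hx (mem_permOrbit.1 hy)

lemma sdiff (hS : PermStable σ S) (hO : PermStable σ O) : PermStable σ (S \ O) := by
  intro z hz
  rw [mem_sdiff] at hz ⊢
  exact ⟨hS z hz.1, fun h => hz.2 (hO.mem_of_sameCycle h (Perm.sameCycle_apply_left.2 (.refl _ _)))⟩

lemma union (hS : PermStable σ S) (hO : PermStable σ O) : PermStable σ (S ∪ O) := by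
  intro z hz
  rw [mem_union] at hz ⊢
  exact hz.imp (hS z) (hO z)

lemma swap_mul (hS : PermStable σ S) (hx : x ∈ S) (hy : y ∈ S) :
    PermStable (swap x y * σ) S := by
  intro z hz
  rw [Perm.mul_apply, swap_apply_def]
  split_ifs
  exacts [hy, hx, hS z hz]

end PermStable

lemma permStable_permOrbit (σ : Perm α) (x : α) : PermStable σ (permOrbit σ x) := by
  intro z hz
  rw [mem_permOrbit] at hz ⊢
  exact Perm.sameCycle_apply_right.2 hz

lemma mem_permOrbits {σ : Perm α} {S c : Finset α} :
    c ∈ permOrbits σ S ↔ ∃ x ∈ S, permOrbit σ x = c := mem_image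

lemma permStable_of_mem_permOrbits {σ : Perm α} {S c : Finset α} (hc : c ∈ permOrbits σ S) :
    PermStable σ c := by
  obtain ⟨x, -, rfl⟩ := mem_permOrbits.1 hc
  exact permStable_permOrbit σ x

lemma eq_permOrbit_of_mem {σ : Perm α} {S c : Finset α} {x : α} (hc : c ∈ permOrbits σ S)
    (hx : x ∈ c) : c = permOrbit σ x := by
  obtain ⟨y, -, rfl⟩ := mem_permOrbits.1 hc
  exact permOrbit_eq (mem_permOrbit.1 hx)

lemma pairwiseDisjoint_permOrbits (σ : Perm α) (S : Finset α) :
    Set.PairwiseDisjoint (permOrbits σ S : Set (Finset α)) id := by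
  intro c hc c' hc' hne
  rw [Function.onFun, disjoint_left]
  intro x hx hx'
  exact hne ((eq_permOrbit_of_mem hc hx).trans (eq_permOrbit_of_mem hc' hx').symm)

lemma permOrbits_permOrbit (σ : Perm α) (x : α) :
    permOrbits σ (permOrbit σ x) = {permOrbit σ x} := by
  ext c
  rw [mem_permOrbits, mem_singleton]
  constructor
  · rintro ⟨y, hy, rfl⟩
    exact (permOrbit_eq (mem_permOrbit.1 hy)).symm
  · rintro rfl
    exact ⟨x, self_mem_permOrbit σ x, rfl⟩

lemma permOrbits_union (σ : Perm α) (S O : Finset α) :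
    permOrbits σ (S ∪ O) = permOrbits σ S ∪ permOrbits σ O := image_union _ _

namespace PermStable

variable {σ : Perm α} {S O : Finset α}

lemma biUnion_permOrbits (hS : PermStable σ S) : (permOrbits σ S).biUnion id = S := by
  ext z
  rw [mem_biUnion]
  constructor
  · rintro ⟨c, hc, hz⟩
    obtain ⟨x, hx, rfl⟩ := mem_permOrbits.1 hc
    exact hS.permOrbit_subset hx hz
  · intro hz
    exact ⟨_, mem_permOrbits.2 ⟨z, hz, rfl⟩, self_mem_permOrbit σ z⟩

lemma subset_of_mem (hS : PermStable σ S) {c : Finset α} (hc : c ∈ permOrbits σ S) : c ⊆ S := by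
  obtain ⟨x, hx, rfl⟩ := mem_permOrbits.1 hc
  exact hS.permOrbit_subset hx

lemma sum_permOrbits {M : Type*} [AddCommMonoid M] (hS : PermStable σ S) (g : α → M) :
    ∑ c ∈ permOrbits σ S, ∑ x ∈ c, g x = ∑ x ∈ S, g x := by
  conv_rhs => rw [← hS.biUnion_permOrbits, sum_biUnion (pairwiseDisjoint_permOrbits σ S)]
  rfl

lemma sum_card_permOrbits (hS : PermStable σ S) : ∑ c ∈ permOrbits σ S, c.card = S.card := by
  simp only [card_eq_sum_ones]
  exact hS.sum_permOrbits _

lemma permOrbits_sdiff (hO : PermStable σ O) (S : Finset α) :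
    permOrbits σ (S \ O) = permOrbits σ S \ permOrbits σ O := by
  ext c
  rw [mem_sdiff, mem_permOrbits, mem_permOrbits]
  constructor
  · rintro ⟨x, hx, rfl⟩
    rw [mem_sdiff] at hx
    refine ⟨⟨x, hx.1, rfl⟩, fun h => hx.2 (hO.subset_of_mem h (self_mem_permOrbit σ x))⟩
  · rintro ⟨⟨x, hx, rfl⟩, h⟩
    exact ⟨x, mem_sdiff.2 ⟨hx, fun h' => h (mem_permOrbits.2 ⟨x, h', rfl⟩)⟩, rfl⟩

end PermStable

/-- Unions of orbits are stable, and their orbits are the given ones. -/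
lemma permStable_biUnion {σ : Perm α} {S : Finset α} {I : Finset (Finset α)}
    (hI : I ⊆ permOrbits σ S) : PermStable σ (I.biUnion id) := by
  intro z hz
  rw [mem_biUnion] at hz ⊢
  obtain ⟨c, hc, hz⟩ := hz
  exact ⟨c, hc, permStable_of_mem_permOrbits (hI hc) z hz⟩

lemma permOrbits_biUnion {σ : Perm α} {S : Finset α} {I : Finset (Finset α)}
    (hI : I ⊆ permOrbits σ S) : permOrbits σ (I.biUnion id) = I := by
  ext c
  rw [mem_permOrbits]
  constructor
  · rintro ⟨x, hx, rfl⟩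
    obtain ⟨c, hc, hx⟩ := mem_biUnion.1 hx
    rwa [← eq_permOrbit_of_mem (hI hc) hx]
  · intro hc
    obtain ⟨x, hx, rfl⟩ := mem_permOrbits.1 (hI hc)
    exact ⟨x, mem_biUnion.2 ⟨_, hc, self_mem_permOrbit σ x⟩, rfl⟩

variable {σ : Perm α} {x y : α}

lemma swap_mul_pow_apply {r : ℕ} (hx : ∀ j, 0 < j → j ≤ r → (σ ^ j) x ≠ x)
    (hy : ∀ j, 0 < j → j ≤ r → (σ ^ j) x ≠ y) :
    ∀ j ≤ r, ((swap x y * σ) ^ j) x = (σ ^ j) x := by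
  intro j
  induction j with
  | zero => intro _; rfl
  | succ n ih =>
    intro hn
    have := hx (n + 1) (by omega) hn
    have := hy (n + 1) (by omega) hn
    rw [pow_succ', Perm.mul_apply, ih (by omega), Perm.mul_apply, ← Perm.mul_apply σ, ← pow_succ']
    exact swap_apply_of_ne_of_ne ‹_› ‹_›

lemma permOrbit_swap_mul_of_notMem {z : α} (hx : x ∉ permOrbit σ z) (hy : y ∉ permOrbit σ z) :
    permOrbit (swap x y * σ) z = permOrbit σ z := by
  have : ∀ j : ℕ, ((swap x y * σ) ^ j) z = (σ ^ j) z := by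
    intro j
    induction j with
    | zero => rfl
    | succ n ih =>
      have h : σ ((σ ^ n) z) ∈ permOrbit σ z :=
        mem_permOrbit.2 ⟨n + 1, by rw [add_comm, zpow_add]; simp⟩
      rw [pow_succ', Perm.mul_apply, ih, Perm.mul_apply, pow_succ', Perm.mul_apply]
      exact swap_apply_of_ne_of_ne (fun e => hx (e ▸ h)) (fun e => hy (e ▸ h))
  have h : ∀ u, (swap x y * σ).SameCycle z u ↔ σ.SameCycle z u := by
    intro u
    constructor
    · intro h
      obtain ⟨i, rfl⟩ := h.exists_nat_pow_eq
      exact ⟨i, by rw [this]; simp⟩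
    · intro h
      obtain ⟨i, rfl⟩ := h.exists_nat_pow_eq
      exact ⟨i, by rw [← this]; simp⟩
  ext u
  rw [mem_permOrbit, mem_permOrbit, h]

lemma permOrbits_swap_mul_of_notMem {S : Finset α} (hS : PermStable σ S) (hx : x ∉ S)
    (hy : y ∉ S) : permOrbits (swap x y * σ) S = permOrbits σ S :=
  image_congr fun _ hz => permOrbit_swap_mul_of_notMem (fun h => hx (hS.permOrbit_subset hz h))
    (fun h => hy (hS.permOrbit_subset hz h))

lemma sameCycle_swap_mul_of_not (h : ¬ σ.SameCycle x y) : (swap x y * σ).SameCycle x y := by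
  obtain ⟨m, hm⟩ : ∃ m, Function.minimalPeriod σ x = m + 1 :=
    Nat.exists_eq_succ_of_ne_zero (minimalPeriod_perm_pos σ x).ne'
  have hp : (σ ^ (m + 1)) x = x := by
    rw [← hm, ← Perm.iterate_eq_pow, Function.iterate_minimalPeriod]
  have := swap_mul_pow_apply (σ := σ) (x := x) (y := y) (r := m)
    (fun j h0 h1 e => by
      have := (injOn_pow_minimalPeriod σ x) (x₁ := j) (x₂ := 0) (by rw [Set.mem_Iio]; omega)
        (by rw [Set.mem_Iio]; omega) (by simpa using e)
      omega)
    (fun j _ _ e => h ⟨j, by simpa using e⟩) m le_rfl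
  refine ⟨(m + 1 : ℕ), ?_⟩
  rw [zpow_natCast, pow_succ', Perm.mul_apply, this, Perm.mul_apply, ← Perm.mul_apply σ,
    ← pow_succ', hp, swap_apply_left]

/-- Multiplying by a transposition inside a cycle splits off a cycle of length `r`. -/
lemma minimalPeriod_swap_mul {r : ℕ} (h0 : 0 < r) (hr : r < Function.minimalPeriod σ x)
    (hy : (σ ^ r) x = y) : Function.minimalPeriod (swap x y * σ) x = r ∧
      ¬ (swap x y * σ).SameCycle x y := by
  have hinj := injOn_pow_minimalPeriod σ x
  obtain ⟨m, rfl⟩ := Nat.exists_eq_succ_of_ne_zero h0.ne'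
  have hx : ∀ j, 0 < j → j < Function.minimalPeriod σ x → (σ ^ j) x ≠ x := by
    intro j hj hj' e
    have := hinj (x₁ := j) (x₂ := 0) hj' (h0.trans hr) (by simpa using e)
    omega
  have hy' : ∀ j ≤ m, (σ ^ j) x ≠ y := by
    intro j hj e
    rw [← hy] at e
    have := hinj (x₁ := j) (x₂ := m + 1) (by rw [Set.mem_Iio]; omega) hr e
    omega
  have hpow := swap_mul_pow_apply (σ := σ) (x := x) (y := y) (r := m)
    (fun j h1 h2 => hx j h1 (by omega)) (fun j h1 h2 => hy' j h2)
  have hper : ((swap x y * σ) ^ (m + 1)) x = x := by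
    rw [pow_succ', Perm.mul_apply, hpow m le_rfl, Perm.mul_apply, ← Perm.mul_apply σ, ← pow_succ',
      hy, swap_apply_right]
  have hdvd : Function.minimalPeriod (swap x y * σ) x ∣ m + 1 := by
    apply Function.IsPeriodicPt.minimalPeriod_dvd
    rw [Function.IsPeriodicPt, Function.IsFixedPt, Perm.iterate_eq_pow, hper]
  have hle := Nat.le_of_dvd (by omega) hdvd
  have hmp : Function.minimalPeriod (swap x y * σ) x = m + 1 := by
    by_contra hne
    have h1 := hpow (Function.minimalPeriod (swap x y * σ) x) (by omega)
    rw [← Perm.iterate_eq_pow, Function.iterate_minimalPeriod] at h1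
    exact hx _ (minimalPeriod_perm_pos _ x) (by omega) h1.symm
  refine ⟨hmp, fun h => ?_⟩
  rw [← mem_permOrbit, permOrbit, hmp, mem_image] at h
  obtain ⟨j, hj, e⟩ := h
  rw [mem_range] at hj
  rw [hpow j (by omega)] at e
  exact hy' j (by omega) e

/-- The effect of `σ ↦ swap x y * σ` on the cycle of `x` when `y` is on that cycle. -/
lemma permOrbit_cut {r : ℕ} (h0 : 0 < r) (hr : r < (permOrbit σ x).card) (hy : (σ ^ r) x = y) :
    ¬ (swap x y * σ).SameCycle x y ∧ (permOrbit (swap x y * σ) x).card = r ∧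
    (permOrbit (swap x y * σ) y).card = (permOrbit σ x).card - r ∧
    permOrbit (swap x y * σ) x ∪ permOrbit (swap x y * σ) y = permOrbit σ x := by
  have hxy : σ.SameCycle x y := ⟨r, by simpa using hy⟩
  have hc := card_permOrbit σ x
  have hc' := card_permOrbit σ y
  rw [← permOrbit_eq hxy] at hc'
  rw [hc] at hr
  obtain ⟨h1, h2⟩ := minimalPeriod_swap_mul h0 hr hy
  have h3 : (σ ^ (Function.minimalPeriod σ x - r)) y = x := by
    rw [← hy, ← Perm.mul_apply, ← pow_add, Nat.sub_add_cancel hr.le, ← Perm.iterate_eq_pow,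
      Function.iterate_minimalPeriod]
  obtain ⟨h4, -⟩ := minimalPeriod_swap_mul (σ := σ) (x := y) (y := x)
    (r := Function.minimalPeriod σ x - r) (by omega) (by omega) h3
  rw [swap_comm] at h4
  have hst : PermStable (swap x y * σ) (permOrbit σ x) :=
    (permStable_permOrbit σ x).swap_mul (self_mem_permOrbit σ x) (mem_permOrbit.2 hxy)
  refine ⟨h2, by rw [card_permOrbit, h1], by rw [card_permOrbit, h4, hc], ?_⟩
  apply eq_of_subset_of_card_le
  · exact union_subset (hst.permOrbit_subset (self_mem_permOrbit σ x))
      (hst.permOrbit_subset (mem_permOrbit.2 hxy))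
  · rw [card_union_of_disjoint, hc, card_permOrbit, h1, card_permOrbit, h4]
    · omega
    · rw [disjoint_left]
      intro z hz hz'
      rw [mem_permOrbit] at hz hz'
      exact h2 (hz.trans hz'.symm)

lemma exists_pow_of_sameCycle (h : σ.SameCycle x y) (hne : x ≠ y) :
    ∃ r, 0 < r ∧ r < (permOrbit σ x).card ∧ (σ ^ r) x = y := by
  rw [← mem_permOrbit, permOrbit, mem_image] at h
  obtain ⟨r, hr, e⟩ := h
  rw [mem_range] at hr
  refine ⟨r, Nat.pos_of_ne_zero ?_, by rwa [card_permOrbit], e⟩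
  rintro rfl
  exact hne (by simpa using e)

lemma permOrbits_cut {S : Finset α} (hS : PermStable σ S) (hx : x ∈ S) (h : σ.SameCycle x y)
    (hne : x ≠ y) : permOrbits (swap x y * σ) S =
      insert (permOrbit (swap x y * σ) x) (insert (permOrbit (swap x y * σ) y)
        ((permOrbits σ S).erase (permOrbit σ x))) := by
  obtain ⟨r, h0, hr, e⟩ := exists_pow_of_sameCycle h hne
  obtain ⟨-, -, -, hu⟩ := permOrbit_cut h0 hr e
  have hc := permStable_permOrbit σ x
  have hsub := hS.permOrbit_subset hx
  conv_lhs => rw [← union_sdiff_of_subset hsub, permOrbits_union, ← hu, permOrbits_union,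
    permOrbits_permOrbit, permOrbits_permOrbit, hu]
  rw [permOrbits_swap_mul_of_notMem (hS.sdiff hc), hc.permOrbits_sdiff, permOrbits_permOrbit,
    sdiff_singleton_eq_erase, insert_eq, insert_eq, union_assoc]
  · simp [self_mem_permOrbit]
  · simp [mem_permOrbit, h]

lemma permOrbits_join {S : Finset α} (hS : PermStable σ S) (hx : x ∈ S) (hy : y ∈ S)
    (h : ¬ σ.SameCycle x y) : permOrbits (swap x y * σ) S =
      insert (permOrbit σ x ∪ permOrbit σ y)
        (((permOrbits σ S).erase (permOrbit σ x)).erase (permOrbit σ y)) := by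
  have hne : x ≠ y := by rintro rfl; exact h (.refl _ _)
  have hxy := sameCycle_swap_mul_of_not h
  obtain ⟨r, h0, hr, e⟩ := exists_pow_of_sameCycle hxy hne
  obtain ⟨-, -, -, hu⟩ := permOrbit_cut h0 hr e
  rw [swap_mul_self_mul] at hu
  have hcx := permStable_permOrbit σ x
  have hcy := permStable_permOrbit σ y
  have hc := hcx.union hcy
  have hsub := union_subset (hS.permOrbit_subset hx) (hS.permOrbit_subset hy)
  conv_lhs => rw [← union_sdiff_of_subset hsub, permOrbits_union, hu, permOrbits_permOrbit]
  rw [← hu, permOrbits_swap_mul_of_notMem (hS.sdiff hc), hc.permOrbits_sdiff, permOrbits_union,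
    permOrbits_permOrbit, permOrbits_permOrbit, ← insert_eq,
    union_comm {permOrbit σ x}, ← insert_eq, sdiff_insert, sdiff_singleton_eq_erase]
  · simp [self_mem_permOrbit]
  · simp [self_mem_permOrbit]

end Orbits

section ListSum

variable {β : Type*} [DecidableEq β]

/-- The sum of `f` over all lists of length `d` with entries in `A`. -/
def listSum (A : Finset β) : ℕ → (List β → ℚ) → ℚ
  | 0, f => f []
  | d + 1, f => ∑ a ∈ A, listSum A d fun l => f (a :: l)

lemma listSum_congr {A : Finset β} {d : ℕ} {f g : List β → ℚ}
    (h : ∀ l : List β, l.length = d → (∀ a ∈ l, a ∈ A) → f l = g l) :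
    listSum A d f = listSum A d g := by
  induction d generalizing f g with
  | zero => exact h [] rfl (by simp)
  | succ d ih =>
    refine sum_congr rfl fun a ha => ih fun l hl hA => h _ (by simp [hl]) ?_
    simpa [ha] using hA

lemma listSum_zero (A : Finset β) (d : ℕ) : listSum A d (fun _ => 0) = 0 := by
  induction d with
  | zero => rfl
  | succ d ih => exact sum_eq_zero fun _ _ => ih

lemma listSum_add (A : Finset β) (d : ℕ) (f g : List β → ℚ) :
    listSum A d (fun l => f l + g l) = listSum A d f + listSum A d g := by
  induction d generalizing f g with
  | zero => rfl
  | succ d ih => simp only [listSum, ih, sum_add_distrib]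

lemma listSum_sum {ι : Type*} (A : Finset β) (d : ℕ) (s : Finset ι) (f : ι → List β → ℚ) :
    listSum A d (fun l => ∑ i ∈ s, f i l) = ∑ i ∈ s, listSum A d (f i) := by
  induction d generalizing f with
  | zero => rfl
  | succ d ih => simp only [listSum, ih]; exact sum_comm

lemma listSum_eq_of_subset {A B : Finset β} (h : B ⊆ A) {d : ℕ} {f : List β → ℚ}
    (hf : ∀ l : List β, (∃ a ∈ l, a ∉ B) → f l = 0) : listSum A d f = listSum B d f := by
  induction d generalizing f with
  | zero => rfl
  | succ d ih =>
    have hcons : ∀ a, listSum A d (fun l => f (a :: l)) = listSum B d fun l => f (a :: l) :=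
      fun a => ih fun l ⟨b, hb, hb'⟩ => hf _ ⟨b, by simp [hb], hb'⟩
    simp only [listSum, hcons]
    refine (sum_subset h fun a _ ha => ?_).symm
    rw [listSum_congr (g := fun _ => 0) fun l _ _ => hf _ ⟨a, by simp, ha⟩, listSum_zero]

lemma listSum_eq_sum_piFinset (A : Finset β) (d : ℕ) (f : List β → ℚ) :
    listSum A d f = ∑ t ∈ Fintype.piFinset fun _ : Fin d => A, f (List.ofFn t) := by
  induction d generalizing f with
  | zero => simp [listSum]
  | succ d ih =>
    simp only [listSum, ih]
    rw [← sum_product']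
    refine sum_bij (fun p _ => Fin.cons p.1 p.2) ?_ ?_ ?_ ?_
    · intro p hp
      simp only [mem_product, Fintype.mem_piFinset] at hp ⊢
      exact Fin.cases (by simpa using hp.1) (by simpa using hp.2)
    · rintro ⟨a, p⟩ - ⟨b, q⟩ - h
      rw [Fin.cons_inj] at h
      exact Prod.ext h.1 h.2
    · intro t ht
      simp only [Fintype.mem_piFinset] at ht
      exact ⟨(t 0, Fin.tail t), by simp [Fin.tail, ht], Fin.cons_self_tail t⟩
    · rintro ⟨a, p⟩ -
      simp [List.ofFn_succ]

/-- A list over `A ∪ B` is a shuffle of a list over `A` and a list over `B`. -/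
lemma listSum_shuffle {A B : Finset β} (h : Disjoint A B) (d : ℕ) (f g : List β → ℚ) :
    listSum (A ∪ B) d (fun l => f (l.filter (· ∈ A)) * g (l.filter (· ∈ B)))
      = ∑ p ∈ antidiagonal d, (d.choose p.1 : ℚ) * (listSum A p.1 f * listSum B p.2 g) := by
  induction d generalizing f g with
  | zero => simp [listSum]
  | succ d ih =>
    have hA : ∀ a ∈ A, listSum (A ∪ B) d (fun l => f ((a :: l).filter (· ∈ A)) *
        g ((a :: l).filter (· ∈ B)))
        = ∑ p ∈ antidiagonal d, (d.choose p.1 : ℚ) *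
          (listSum A p.1 (fun l => f (a :: l)) * listSum B p.2 g) := by
      intro a ha
      rw [← ih]
      simp [ha, disjoint_left.1 h ha]
    have hB : ∀ a ∈ B, listSum (A ∪ B) d (fun l => f ((a :: l).filter (· ∈ A)) *
        g ((a :: l).filter (· ∈ B)))
        = ∑ p ∈ antidiagonal d, (d.choose p.1 : ℚ) *
          (listSum A p.1 f * listSum B p.2 (fun l => g (a :: l))) := by
      intro a ha
      rw [← ih]
      simp [ha, disjoint_right.1 h ha]
    rw [sum_antidiagonal_choose_succ_mul (fun i j => listSum A i f * listSum B j g), listSum,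
      sum_union h, sum_congr rfl hA, sum_congr rfl hB, sum_comm, sum_comm (s := B), add_comm]
    congr 1
    · refine sum_congr rfl fun p _ => ?_
      rw [← mul_sum, ← mul_sum, listSum]
    · refine sum_congr rfl fun p hp => ?_
      rw [← mul_sum, ← sum_mul, ← Nat.choose_symm_of_eq_add (mem_antidiagonal.1 hp).symm, listSum]

end ListSum

noncomputable section Factorizations

variable {α : Type*} [Fintype α] [DecidableEq α]

/-- The transpositions moving only points of `S`. -/
def swapsIn (S : Finset α) : Finset (Perm α) := S.offDiag.image fun p => swap p.1 p.2

lemma mem_swapsIn {S : Finset α} {t : Perm α} :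
    t ∈ swapsIn S ↔ ∃ x ∈ S, ∃ y ∈ S, x ≠ y ∧ swap x y = t := by
  simp only [swapsIn, mem_image, mem_offDiag, Prod.exists, and_assoc]
  grind

lemma sum_offDiag_swap (S : Finset α) (g : Perm α → ℚ) :
    ∑ p ∈ S.offDiag, g (swap p.1 p.2) = 2 * ∑ t ∈ swapsIn S, g t := by
  rw [sum_comp g (fun p : α × α => swap p.1 p.2), mul_sum]
  refine sum_congr rfl fun t ht => ?_
  obtain ⟨x, hx, y, hy, hne, rfl⟩ := mem_swapsIn.1 ht
  have : {p ∈ S.offDiag | swap p.1 p.2 = swap x y} = {(x, y), (y, x)} := by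
    ext ⟨a, b⟩
    simp only [mem_filter, mem_offDiag, mem_insert, mem_singleton, Prod.mk.injEq]
    constructor
    · rintro ⟨⟨-, -, hab⟩, e⟩
      have h1 := congrArg (· a) e
      simp only [swap_apply_left, swap_apply_def] at h1
      split_ifs at h1 <;> simp_all
    · rintro (⟨rfl, rfl⟩ | ⟨rfl, rfl⟩)
      · exact ⟨⟨hx, hy, hne⟩, rfl⟩
      · exact ⟨⟨hy, hx, hne.symm⟩, swap_comm _ _⟩
  rw [this, card_pair (by simp [hne]), nsmul_eq_mul, Nat.cast_ofNat]

lemma swapsIn_mono {S O : Finset α} (h : O ⊆ S) : swapsIn O ⊆ swapsIn S := by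
  intro t ht
  obtain ⟨x, hx, y, hy, hne, rfl⟩ := mem_swapsIn.1 ht
  exact mem_swapsIn.2 ⟨x, h hx, y, h hy, hne, rfl⟩

lemma apply_of_mem_swapsIn {S : Finset α} {t : Perm α} (ht : t ∈ swapsIn S) {z : α} (hz : z ∉ S) :
    t z = z := by
  obtain ⟨x, hx, y, hy, -, rfl⟩ := mem_swapsIn.1 ht
  exact swap_apply_of_ne_of_ne (by rintro rfl; exact hz hx) (by rintro rfl; exact hz hy)

lemma permStable_of_fixed {t : Perm α} {S : Finset α} (h : ∀ z ∈ S, t z = z) : PermStable t S :=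
  fun z hz => by rwa [h z hz]

lemma permStable_of_mem_swapsIn {S : Finset α} {t : Perm α} (ht : t ∈ swapsIn S) :
    PermStable t S := by
  obtain ⟨x, hx, y, hy, -, rfl⟩ := mem_swapsIn.1 ht
  simpa using (permStable_of_fixed (t := 1) (S := S) fun _ _ => rfl).swap_mul hx hy

lemma disjoint_swapsIn {S O : Finset α} (h : Disjoint S O) :
    Disjoint (swapsIn S) (swapsIn O) := by
  rw [disjoint_left]
  intro t ht ht'
  obtain ⟨x, hx, y, hy, hne, rfl⟩ := mem_swapsIn.1 ht
  have := apply_of_mem_swapsIn ht' (disjoint_left.1 h hx)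
  rw [swap_apply_left] at this
  exact hne this.symm

lemma permStable_of_mem_union {S O : Finset α} {t : Perm α}
    (ht : t ∈ swapsIn O ∪ swapsIn (S \ O)) : PermStable t O := by
  rcases mem_union.1 ht with ht | ht
  · exact permStable_of_mem_swapsIn ht
  · exact permStable_of_fixed fun z hz => apply_of_mem_swapsIn ht (by simp [hz])

lemma mem_union_of_permStable {S O : Finset α} {t : Perm α} (ht : t ∈ swapsIn S)
    (h : PermStable t O) : t ∈ swapsIn O ∪ swapsIn (S \ O) := by
  obtain ⟨x, hx, y, hy, hne, rfl⟩ := mem_swapsIn.1 ht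
  rw [mem_union, mem_swapsIn, mem_swapsIn]
  by_cases hxO : x ∈ O
  · have hyO := h x hxO
    rw [swap_apply_left] at hyO
    exact Or.inl ⟨x, hxO, y, hyO, hne, rfl⟩
  · have hyO : y ∉ O := fun hyO => hxO (by simpa using h y hyO)
    exact Or.inr ⟨x, by simp [*], y, by simp [*], hne, rfl⟩

lemma swapsIn_union_subset {S O : Finset α} (hO : O ⊆ S) :
    swapsIn O ∪ swapsIn (S \ O) ⊆ swapsIn S :=
  union_subset (swapsIn_mono hO) (swapsIn_mono sdiff_subset)

lemma prod_apply_of_fixed {l : List (Perm α)} {B : Finset (Perm α)} {O : Finset α}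
    (hB : ∀ t ∈ l, t ∈ B → PermStable t O) (hl : ∀ t ∈ l, t ∉ B → ∀ z ∈ O, t z = z) :
    ∀ z ∈ O, l.prod z = (l.filter (· ∈ B)).prod z ∧ l.prod z ∈ O := by
  induction l with
  | nil => simp
  | cons t l ih =>
    intro z hz
    obtain ⟨h1, h2⟩ := ih (fun u hu => hB u (by simp [hu])) (fun u hu => hl u (by simp [hu])) z hz
    rw [List.prod_cons, Perm.mul_apply]
    by_cases ht : t ∈ B
    · rw [List.filter_cons_of_pos (by simpa using ht), List.prod_cons, Perm.mul_apply, ← h1]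
      exact ⟨rfl, hB t (by simp) ht _ h2⟩
    · rw [List.filter_cons_of_neg (by simpa using ht), ← h1, hl t (by simp) ht _ h2]
      exact ⟨rfl, h2⟩

lemma permStable_prod {l : List (Perm α)} {O : Finset α} (h : ∀ t ∈ l, PermStable t O) :
    PermStable l.prod O := by
  induction l with
  | nil => exact permStable_of_fixed fun _ _ => rfl
  | cons t l ih =>
    intro z hz
    rw [List.prod_cons, Perm.mul_apply]
    exact h t (by simp) _ (ih (fun u hu => h u (by simp [hu])) z hz)

/-- The permutations in `l` act transitively on `S`. -/
def ListTransitive (l : List (Perm α)) (S : Finset α) : Prop :=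
  S.Nonempty ∧ ∀ P ⊆ S, P.Nonempty → (∀ t ∈ l, PermStable t P) → P = S

/-- Adding `swap x y` to `l` joins the `l`-orbits `O ∋ x` and `S \ O ∋ y`. -/
def ListSplits (l : List (Perm α)) (S O : Finset α) : Prop :=
  (∀ t ∈ l, t ∈ swapsIn O ∪ swapsIn (S \ O)) ∧
    ListTransitive (l.filter (· ∈ swapsIn O)) O ∧
    ListTransitive (l.filter (· ∈ swapsIn (S \ O))) (S \ O)

variable {l : List (Perm α)} {S O : Finset α} {x y : α}

lemma ListTransitive.not_listSplits (h : ListTransitive l S) (hO : O ⊆ S) (hx : x ∈ O)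
    (hy : y ∈ S) (hyO : y ∉ O) : ¬ ListSplits l S O := by
  intro hs
  have := h.2 O hO ⟨x, hx⟩ fun t ht => permStable_of_mem_union (hs.1 t ht)
  exact hyO (this ▸ hy)

lemma ListTransitive.cons (h : ListTransitive l S) (t : Perm α) : ListTransitive (t :: l) S :=
  ⟨h.1, fun P hP hne hst => h.2 P hP hne fun u hu => hst u (by simp [hu])⟩

lemma PermStable.inter {t : Perm α} {P : Finset α} (h : PermStable t S) (h' : PermStable t P) :
    PermStable t (S ∩ P) := fun z hz =>
  mem_inter.2 ⟨h z (mem_inter.1 hz).1, h' z (mem_inter.1 hz).2⟩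

lemma ListSplits.listTransitive_cons (hs : ListSplits l S O) (hO : O ⊆ S) (hx : x ∈ O) (hy : y ∈ S)
    (hyO : y ∉ O) : ListTransitive (swap x y :: l) S := by
  refine ⟨⟨y, hy⟩, fun P hP hne hst => ?_⟩
  have hτ : PermStable (swap x y) P := hst _ (by simp)
  have hl : ∀ t ∈ l, PermStable t P := fun t ht => hst t (by simp [ht])
  have h1 : (P ∩ O).Nonempty → P ∩ O = O := fun h => hs.2.1.2 _ inter_subset_right h
    fun t ht => (hl t (List.mem_of_mem_filter ht)).inter
      (permStable_of_mem_swapsIn (by simpa using List.of_mem_filter ht))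
  have h2 : (P ∩ (S \ O)).Nonempty → P ∩ (S \ O) = S \ O := fun h => hs.2.2.2 _ inter_subset_right h
    fun t ht => (hl t (List.mem_of_mem_filter ht)).inter
      (permStable_of_mem_swapsIn (by simpa using List.of_mem_filter ht))
  have hxy : x ∈ P ↔ y ∈ P :=
    ⟨fun h => by simpa using hτ x h, fun h => by simpa using hτ y h⟩
  have hyS : y ∈ S \ O := mem_sdiff.2 ⟨hy, hyO⟩
  have h3 : x ∈ P := by
    obtain ⟨z, hz⟩ := hne
    by_cases hzO : z ∈ O
    · have := h1 ⟨z, mem_inter.2 ⟨hz, hzO⟩⟩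
      rw [← this] at hx
      exact (mem_inter.1 hx).1
    · have := h2 ⟨z, mem_inter.2 ⟨hz, mem_sdiff.2 ⟨hP hz, hzO⟩⟩⟩
      rw [← this] at hyS
      exact hxy.2 (mem_inter.1 hyS).1
  have h4 := h1 ⟨x, mem_inter.2 ⟨h3, hx⟩⟩
  have h5 := h2 ⟨y, mem_inter.2 ⟨hxy.1 h3, hyS⟩⟩
  refine subset_antisymm hP ?_
  rw [← union_sdiff_of_subset hO, ← h4]
  refine union_subset inter_subset_left ?_
  rw [h4, ← h5]
  exact inter_subset_left

open Classical in
lemma exists_unique_listSplits (hl : ∀ t ∈ l, t ∈ swapsIn S) (hx : x ∈ S) (hy : y ∈ S)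
    (hxy : x ≠ y) (h : ListTransitive (swap x y :: l) S) (hn : ¬ ListTransitive l S) :
    ∃ O ⊆ S, x ∈ O ∧ y ∉ O ∧ ListSplits l S O ∧
      ∀ O' ⊆ S, x ∈ O' → ListSplits l S O' → O' = O := by
  set O := S.filter fun z => ∀ P ⊆ S, (∀ t ∈ l, PermStable t P) → x ∈ P → z ∈ P with hOdef
  have hSst : ∀ t ∈ l, PermStable t S := fun t ht => permStable_of_mem_swapsIn (hl t ht)
  have hOS : O ⊆ S := filter_subset _ _
  have hxO : x ∈ O := mem_filter.2 ⟨hx, fun P _ _ h => h⟩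
  have hmin : ∀ P ⊆ S, (∀ t ∈ l, PermStable t P) → x ∈ P → O ⊆ P := fun P hP hst hxP z hz =>
    (mem_filter.1 hz).2 P hP hst hxP
  have hOst : ∀ t ∈ l, PermStable t O := fun t ht z hz =>
    mem_filter.2 ⟨hSst t ht z (hOS hz), fun P hP hst hxP => hst t ht z (hmin P hP hst hxP hz)⟩
  have hfix : ∀ P ⊆ S, x ∉ P → y ∉ P → P.Nonempty → ¬ ∀ t ∈ l, PermStable t P := by
    intro P hP hxP hyP hne hst
    have hτ : PermStable (swap x y) P := permStable_of_fixed fun z hz =>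
      swap_apply_of_ne_of_ne (by rintro rfl; exact hxP hz) (by rintro rfl; exact hyP hz)
    have := h.2 P hP hne (by simpa [hτ] using hst)
    exact hxP (this ▸ hx)
  have hfull : ∀ P ⊆ S, x ∈ P → y ∈ P → (∀ t ∈ l, PermStable t P) → P = S := by
    intro P hP hxP hyP hst
    have hτ : PermStable (swap x y) P := by
      simpa using (permStable_of_fixed (t := 1) (S := P) fun _ _ => rfl).swap_mul hxP hyP
    exact h.2 P hP ⟨x, hxP⟩ (by simpa [hτ] using hst)
  have hyO : y ∉ O := by
    intro hyO
    refine hn ⟨⟨x, hx⟩, fun P hP hne hst => ?_⟩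
    by_cases hxP : x ∈ P
    · exact hfull P hP hxP (hmin P hP hst hxP hyO) hst
    · by_cases hyP : y ∈ P
      · have := hmin (S \ P) sdiff_subset (fun t ht => (hSst t ht).sdiff (hst t ht))
          (mem_sdiff.2 ⟨hx, hxP⟩) hyO
        exact absurd hyP (mem_sdiff.1 this).2
      · exact absurd hst (hfix P hP hxP hyP hne)
  have hmem : ∀ t ∈ l, t ∈ swapsIn O ∪ swapsIn (S \ O) := fun t ht =>
    mem_union_of_permStable (hl t ht) (hOst t ht)
  -- a set stable under the permutations of one block is stable under `l`
  have hlift : ∀ P ⊆ O, (∀ t ∈ l.filter (· ∈ swapsIn O), PermStable t P) →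
      ∀ t ∈ l, PermStable t P := by
    intro P hP hst t ht
    by_cases htO : t ∈ swapsIn O
    · exact hst t (List.mem_filter.2 ⟨ht, by simpa using htO⟩)
    · have := (mem_union.1 (hmem t ht)).resolve_left htO
      exact permStable_of_fixed fun z hz => apply_of_mem_swapsIn this (by simp [hP hz])
  have hlift' : ∀ P ⊆ S \ O, (∀ t ∈ l.filter (· ∈ swapsIn (S \ O)), PermStable t P) →
      ∀ t ∈ l, PermStable t P := by
    intro P hP hst t ht
    by_cases htO : t ∈ swapsIn (S \ O)
    · exact hst t (List.mem_filter.2 ⟨ht, by simpa using htO⟩)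
    · have := (mem_union.1 (hmem t ht)).resolve_right htO
      exact permStable_of_fixed fun z hz => apply_of_mem_swapsIn this (mem_sdiff.1 (hP hz)).2
  refine ⟨O, hOS, hxO, hyO, ⟨hmem, ⟨⟨x, hxO⟩, fun P hP hne hst => ?_⟩,
    ⟨⟨y, mem_sdiff.2 ⟨hy, hyO⟩⟩, fun P hP hne hst => ?_⟩⟩, fun O' hO' hxO' hs => ?_⟩
  · have hst' := hlift P hP hst
    by_cases hxP : x ∈ P
    · exact subset_antisymm hP (hmin P (hP.trans hOS) hst' hxP)
    · have := hmin (O \ P) (sdiff_subset.trans hOS) (fun t ht => (hOst t ht).sdiff (hst' t ht))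
        (mem_sdiff.2 ⟨hxO, hxP⟩)
      obtain ⟨z, hz⟩ := hne
      exact absurd hz (mem_sdiff.1 (this (hP hz))).2
  · have hst' := hlift' P hP hst
    have hPS := hP.trans sdiff_subset
    have hxP : x ∉ P := fun h => (mem_sdiff.1 (hP h)).2 hxO
    by_cases hyP : y ∈ P
    · have := hfull (P ∪ O) (union_subset hPS hOS) (mem_union_right _ hxO) (mem_union_left _ hyP)
        fun t ht => (hst' t ht).union (hOst t ht)
      refine subset_antisymm hP fun z hz => ?_
      rw [← this] at hz
      grind
    · exact absurd hst' (hfix P hPS hxP hyP hne)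
  · have h1 := hmin O' hO' (fun t ht => permStable_of_mem_union (hs.1 t ht)) hxO'
    exact (hs.2.1.2 O h1 ⟨x, hxO⟩ fun t ht => hOst t (List.mem_of_mem_filter ht)).symm

open Classical in
lemma listTransitive_cons_indicator (hl : ∀ t ∈ l, t ∈ swapsIn S) (hx : x ∈ S) (hy : y ∈ S)
    (hxy : x ≠ y) :
    (if ListTransitive (swap x y :: l) S then (1 : ℚ) else 0) =
      (if ListTransitive l S then 1 else 0) +
        ∑ O ∈ S.powerset with x ∈ O ∧ y ∉ O, if ListSplits l S O then 1 else 0 := by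
  by_cases h : ListTransitive l S
  · rw [if_pos h, if_pos (h.cons _), sum_eq_zero, add_zero]
    intro O hO
    rw [mem_filter, mem_powerset] at hO
    exact if_neg (h.not_listSplits hO.1 hO.2.1 hy hO.2.2)
  rw [if_neg h, zero_add]
  by_cases h' : ListTransitive (swap x y :: l) S
  · obtain ⟨O, hO, hxO, hyO, hs, huniq⟩ := exists_unique_listSplits hl hx hy hxy h' h
    rw [if_pos h', sum_eq_single_of_mem O, if_pos hs]
    · simp [*]
    · intro O' hO' hne
      rw [mem_filter, mem_powerset] at hO'
      exact if_neg fun hs' => hne (huniq O' hO'.1 hO'.2.1 hs')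
  · rw [if_neg h', sum_eq_zero]
    intro O hO
    rw [mem_filter, mem_powerset] at hO
    exact if_neg fun hs => h' (hs.listTransitive_cons hO.1 hO.2.1 hy hO.2.2)

/-- `l` is a transitive factorization of the restriction of `σ` to `S`. -/
def IsFactorization (l : List (Perm α)) (S : Finset α) (σ : Perm α) : Prop :=
  (∀ z ∈ S, l.prod z = σ z) ∧ ListTransitive l S

open Classical in
/-- The number of transitive factorizations of `σ` restricted to `S` into `d` transpositions. -/
def factorizationCount (d : ℕ) (S : Finset α) (σ : Perm α) : ℚ :=
  listSum (swapsIn S) d fun l => if IsFactorization l S σ then 1 else 0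

lemma factorizationCount_eq_zero {d : ℕ} {σ : Perm α} (h : ¬ PermStable σ S) :
    factorizationCount d S σ = 0 := by
  rw [factorizationCount]
  refine (listSum_congr ?_).trans (listSum_zero (swapsIn S) d)
  refine fun l _ hl => if_neg fun hf => h fun z hz => ?_
  rw [← hf.1 z hz]
  exact permStable_prod (fun t ht => permStable_of_mem_swapsIn (hl t ht)) z hz

lemma prod_eq_iff_of_mem_union {ρ : Perm α} (hO : O ⊆ S)
    (hl : ∀ t ∈ l, t ∈ swapsIn O ∪ swapsIn (S \ O)) :
    (∀ z ∈ S, l.prod z = ρ z) ↔ (∀ z ∈ O, (l.filter (· ∈ swapsIn O)).prod z = ρ z) ∧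
      ∀ z ∈ S \ O, (l.filter (· ∈ swapsIn (S \ O))).prod z = ρ z := by
  have h1 := prod_apply_of_fixed (l := l) (B := swapsIn O) (O := O)
    (fun t _ ht => permStable_of_mem_swapsIn ht) (fun t ht htO z hz =>
      apply_of_mem_swapsIn ((mem_union.1 (hl t ht)).resolve_left htO) (by simp [hz]))
  have h2 := prod_apply_of_fixed (l := l) (B := swapsIn (S \ O)) (O := S \ O)
    (fun t _ ht => permStable_of_mem_swapsIn ht) (fun t ht htO z hz =>
      apply_of_mem_swapsIn ((mem_union.1 (hl t ht)).resolve_right htO) (mem_sdiff.1 hz).2)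
  constructor
  · intro h
    exact ⟨fun z hz => by rw [← (h1 z hz).1, h z (hO hz)],
      fun z hz => by rw [← (h2 z hz).1, h z (mem_sdiff.1 hz).1]⟩
  · rintro ⟨h3, h4⟩ z hz
    by_cases hzO : z ∈ O
    · rw [(h1 z hzO).1, h3 z hzO]
    · rw [(h2 z (mem_sdiff.2 ⟨hz, hzO⟩)).1, h4 z (mem_sdiff.2 ⟨hz, hzO⟩)]

open Classical in
lemma isFactorization_cons_indicator {σ : Perm α} (hl : ∀ t ∈ l, t ∈ swapsIn S) (hx : x ∈ S)
    (hy : y ∈ S) (hxy : x ≠ y) :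
    (if IsFactorization (swap x y :: l) S σ then (1 : ℚ) else 0) =
      (if IsFactorization l S (swap x y * σ) then 1 else 0) +
        ∑ O ∈ S.powerset with x ∈ O ∧ y ∉ O,
          if ∀ t ∈ l, t ∈ swapsIn O ∪ swapsIn (S \ O) then
            (if IsFactorization (l.filter (· ∈ swapsIn O)) O (swap x y * σ) then (1 : ℚ) else 0) *
            (if IsFactorization (l.filter (· ∈ swapsIn (S \ O))) (S \ O) (swap x y * σ) then 1
              else 0) else 0 := by
  have h1 : (∀ z ∈ S, (swap x y :: l).prod z = σ z) ↔ ∀ z ∈ S, l.prod z = (swap x y * σ) z := by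
    refine forall₂_congr fun z _ => ?_
    rw [List.prod_cons, Perm.mul_apply, Perm.mul_apply, ← swap_inv x y, Perm.eq_inv_iff_eq,
      swap_inv]
  have h2 : ∀ O ∈ S.powerset.filter (fun O => x ∈ O ∧ y ∉ O),
      (if ∀ t ∈ l, t ∈ swapsIn O ∪ swapsIn (S \ O) then
            (if IsFactorization (l.filter (· ∈ swapsIn O)) O (swap x y * σ) then (1 : ℚ) else 0) *
            (if IsFactorization (l.filter (· ∈ swapsIn (S \ O))) (S \ O) (swap x y * σ) then 1
              else 0) else 0)
      = (if ∀ z ∈ S, l.prod z = (swap x y * σ) z then 1 else 0) *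
          (if ListSplits l S O then 1 else 0) := by
    intro O hO
    rw [mem_filter, mem_powerset] at hO
    by_cases hlO : ∀ t ∈ l, t ∈ swapsIn O ∪ swapsIn (S \ O)
    · rw [if_pos hlO, ite_zero_mul_ite_zero, ite_zero_mul_ite_zero, mul_one]
      refine if_congr ?_ rfl rfl
      rw [prod_eq_iff_of_mem_union hO.1 hlO]
      unfold IsFactorization ListSplits
      tauto
    · rw [if_neg hlO, if_neg (fun h : ListSplits l S O => hlO h.1), mul_zero]
  have h3 := listTransitive_cons_indicator hl hx hy hxy
  rw [sum_congr rfl h2, ← mul_sum]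
  unfold IsFactorization
  rw [h1]
  by_cases h : ∀ z ∈ S, l.prod z = (swap x y * σ) z
  · rw [if_pos h, one_mul]
    convert h3 <;> exact and_iff_right h
  · rw [if_neg (fun h' => h h'.1), if_neg (fun h' => h h'.1), if_neg h, zero_mul, add_zero]

/-- The cut-and-join recursion. -/
lemma two_mul_factorizationCount_succ (d : ℕ) (S : Finset α) (σ : Perm α) :
    2 * factorizationCount (d + 1) S σ = ∑ p ∈ S.offDiag,
      (factorizationCount d S (swap p.1 p.2 * σ) +
        ∑ O ∈ S.powerset with p.1 ∈ O ∧ p.2 ∉ O, ∑ q ∈ antidiagonal d, (d.choose q.1 : ℚ) *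
          (factorizationCount q.1 O (swap p.1 p.2 * σ) *
            factorizationCount q.2 (S \ O) (swap p.1 p.2 * σ))) := by
  classical
  rw [factorizationCount, listSum, ← sum_offDiag_swap]
  refine sum_congr rfl fun p hp => ?_
  obtain ⟨hx, hy, hxy⟩ := mem_offDiag.1 hp
  rw [listSum_congr fun l _ hl => isFactorization_cons_indicator hl hx hy hxy, listSum_add,
    listSum_sum]
  congr 1
  refine sum_congr rfl fun O hO => ?_
  rw [mem_filter, mem_powerset] at hO
  rw [listSum_eq_of_subset (swapsIn_union_subset hO.1)]
  · rw [listSum_congr fun l _ hl => if_pos hl]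
    exact listSum_shuffle (disjoint_swapsIn disjoint_sdiff) d
      (fun l => if IsFactorization l O (swap p.1 p.2 * σ) then 1 else 0)
      (fun l => if IsFactorization l (S \ O) (swap p.1 p.2 * σ) then 1 else 0)
  · rintro l ⟨t, ht, ht'⟩
    exact if_neg fun h => ht' (h t ht)

end Factorizations

noncomputable section HurwitzFormula

local notation "v" => cycleWeight

variable {α : Type*} [Fintype α] [DecidableEq α]

/-- The genus zero count divided by the factorial of the number of transpositions. -/
def hurwitzValue (S : Finset α) (σ : Perm α) : ℚ :=
  (∑ c ∈ permOrbits σ S, (c.card : ℚ)) ^ (((permOrbits σ S).card : ℤ) - 3) *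
    ∏ c ∈ permOrbits σ S, v c.card

/-- Hurwitz's formula for factorizations into `d` transpositions, along with the vanishing of the
count for shorter factorizations. -/
def HurwitzFormula (α : Type*) [Fintype α] [DecidableEq α] (d : ℕ) : Prop :=
  ∀ (S : Finset α) (σ : Perm α), S.Nonempty → PermStable σ S →
    (d + 2 < S.card + (permOrbits σ S).card → factorizationCount d S σ = 0) ∧
    (d + 2 = S.card + (permOrbits σ S).card →
      factorizationCount d S σ = d.factorial * hurwitzValue S σ)

variable {S O : Finset α} {σ ρ : Perm α} {x y : α} {d : ℕ}

lemma permOrbits_nonempty (hS : S.Nonempty) : (permOrbits σ S).Nonempty := hS.image _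

lemma card_permOrbits_sdiff (hO : PermStable ρ O) (h : O ⊆ S) :
    (permOrbits ρ (S \ O)).card + (permOrbits ρ O).card = (permOrbits ρ S).card := by
  rw [hO.permOrbits_sdiff]
  exact card_sdiff_add_card_eq_card (image_subset_image h)

lemma listTransitive_nil_iff : ListTransitive ([] : List (Perm α)) S ↔ S.card = 1 := by
  rw [card_eq_one]
  constructor
  · rintro ⟨⟨x, hx⟩, h⟩
    exact ⟨x, (h {x} (by simpa using hx) (by simp) (by simp)).symm⟩
  · rintro ⟨x, rfl⟩
    exact ⟨by simp, fun P hP hne _ => (subset_singleton_iff.1 hP).resolve_left hne.ne_empty⟩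

lemma hurwitzFormula_zero : HurwitzFormula α 0 := by
  intro S σ hS hσ
  have h1 := (permOrbits_nonempty (σ := σ) hS).card_pos
  have h2 : (permOrbits σ S).card ≤ S.card := card_image_le
  simp only [factorizationCount, listSum, IsFactorization, listTransitive_nil_iff]
  refine ⟨fun h => if_neg fun h' => by omega, fun h => ?_⟩
  have h3 : S.card = 1 := by omega
  obtain ⟨x, rfl⟩ := card_eq_one.1 h3
  have hx : σ x = x := by simpa using hσ x (by simp)
  rw [if_pos (by simp [hx]), hurwitzValue]
  obtain ⟨c, hc⟩ := card_eq_one.1 (show (permOrbits σ {x}).card = 1 by omega)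
  have h4 := hσ.sum_card_permOrbits
  rw [hc, sum_singleton, h3] at h4
  rw [hc]
  simp [h4, cycleWeight]

/-- Contribution of the pairs of factorizations of the restrictions to two blocks. -/
lemma sum_antidiagonal_factorizationCount (hd : ∀ e ≤ d, HurwitzFormula α e) (h : O ⊆ S)
    (hO : PermStable ρ O) (hS : PermStable ρ S) (hx : x ∈ O) (hy : y ∈ S \ O) :
    (d + 4 < S.card + (permOrbits ρ S).card → ∑ q ∈ antidiagonal d, (d.choose q.1 : ℚ) *
        (factorizationCount q.1 O ρ * factorizationCount q.2 (S \ O) ρ) = 0) ∧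
    (d + 4 = S.card + (permOrbits ρ S).card → ∑ q ∈ antidiagonal d, (d.choose q.1 : ℚ) *
        (factorizationCount q.1 O ρ * factorizationCount q.2 (S \ O) ρ)
          = d.factorial * (hurwitzValue O ρ * hurwitzValue (S \ O) ρ)) := by
  have hO' := hS.sdiff hO
  have hne : O.Nonempty := ⟨x, hx⟩
  have hne' : (S \ O).Nonempty := ⟨y, hy⟩
  have h1 := card_permOrbits_sdiff hO h
  have h2 := card_sdiff_add_card_eq_card h
  have h3 := (permOrbits_nonempty (σ := ρ) hne).card_pos
  have h4 := (permOrbits_nonempty (σ := ρ) hne').card_pos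
  have h5 := hne.card_pos
  have h6 := hne'.card_pos
  have key : ∀ q ∈ antidiagonal d, q.1 + 2 < O.card + (permOrbits ρ O).card ∨
      q.2 + 2 < (S \ O).card + (permOrbits ρ (S \ O)).card →
      (d.choose q.1 : ℚ) * (factorizationCount q.1 O ρ * factorizationCount q.2 (S \ O) ρ) = 0 := by
    intro q hq hlt
    rw [HasAntidiagonal.mem_antidiagonal] at hq
    rcases hlt with hlt | hlt
    · rw [(hd q.1 (by omega) O ρ hne hO).1 hlt, zero_mul, mul_zero]
    · rw [(hd q.2 (by omega) _ ρ hne' hO').1 hlt, mul_zero, mul_zero]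
  constructor
  · intro hlt
    refine sum_eq_zero fun q hq => key q hq ?_
    rw [HasAntidiagonal.mem_antidiagonal] at hq
    omega
  · intro heq
    obtain ⟨a, ha⟩ := Nat.exists_eq_add_of_le (show 2 ≤ O.card + (permOrbits ρ O).card by omega)
    obtain ⟨b, hb⟩ := Nat.exists_eq_add_of_le
      (show 2 ≤ (S \ O).card + (permOrbits ρ (S \ O)).card by omega)
    have hab : (a, b) ∈ antidiagonal d := by rw [HasAntidiagonal.mem_antidiagonal]; omega
    rw [sum_eq_single_of_mem (a, b) hab]
    · have hab' := HasAntidiagonal.mem_antidiagonal.1 hab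
      simp only at hab'
      rw [(hd a (by omega) O ρ hne hO).2 (by omega), (hd b (by omega) _ ρ hne' hO').2 (by omega),
        ← hab', ← Nat.add_choose_mul_factorial_mul_factorial a b,
        Nat.choose_symm_of_eq_add (add_comm a b)]
      push_cast
      ring
    · intro q hq hne
      refine key q hq ?_
      rw [HasAntidiagonal.mem_antidiagonal] at hq
      by_contra! hcon
      exact hne (Prod.ext (by simp only; omega) (by simp only; omega))

open Classical in
/-- The contribution of `swap x y` to the recursion, in the non-vanishing case. -/
def swapContribution (S : Finset α) (σ : Perm α) (x y : α) : ℚ :=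
  if σ.SameCycle x y then
    ∑ O ∈ S.powerset with (x ∈ O ∧ y ∉ O) ∧ PermStable (swap x y * σ) O,
      hurwitzValue O (swap x y * σ) * hurwitzValue (S \ O) (swap x y * σ)
  else hurwitzValue S (swap x y * σ)

lemma card_permOrbits_cut (hS : PermStable σ S) (hx : x ∈ S) (h : σ.SameCycle x y) (hne : x ≠ y) :
    (permOrbits (swap x y * σ) S).card = (permOrbits σ S).card + 1 := by
  obtain ⟨r, h0, hr, e⟩ := exists_pow_of_sameCycle h hne
  obtain ⟨hn, -, -, hu⟩ := permOrbit_cut h0 hr e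
  have hmem : permOrbit σ x ∈ permOrbits σ S := mem_permOrbits.2 ⟨x, hx, rfl⟩
  have hC : ∀ c ∈ (permOrbits σ S).erase (permOrbit σ x), x ∉ c ∧ y ∉ c := by
    intro c hc
    rw [mem_erase] at hc
    refine ⟨fun hxc => hc.1 (eq_permOrbit_of_mem hc.2 hxc), fun hyc => hc.1 ?_⟩
    rw [eq_permOrbit_of_mem hc.2 hyc, permOrbit_eq h]
  rw [permOrbits_cut hS hx h hne, card_insert_of_notMem, card_insert_of_notMem,
    card_erase_of_mem hmem]
  · have := card_pos.2 ⟨_, hmem⟩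
    omega
  · intro hc
    exact (hC _ hc).2 (self_mem_permOrbit _ y)
  · rw [mem_insert]
    rintro (hc | hc)
    · exact hn (mem_permOrbit.1 (hc ▸ self_mem_permOrbit _ y))
    · exact (hC _ hc).1 (self_mem_permOrbit _ x)

lemma card_permOrbits_join (hS : PermStable σ S) (hx : x ∈ S) (hy : y ∈ S)
    (h : ¬ σ.SameCycle x y) :
    (permOrbits (swap x y * σ) S).card + 1 = (permOrbits σ S).card := by
  have hne : x ≠ y := by rintro rfl; exact h (.refl _ _)
  have := card_permOrbits_cut (hS.swap_mul hx hy) hx (sameCycle_swap_mul_of_not h) hne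
  rwa [swap_mul_self_mul, eq_comm] at this

lemma sum_splits_eq (hd : ∀ e ≤ d, HurwitzFormula α e) (hS : PermStable σ S) (hx : x ∈ S)
    (hy : y ∈ S) (hne : x ≠ y) :
    (d + 3 < S.card + (permOrbits σ S).card → factorizationCount d S (swap x y * σ) +
        ∑ O ∈ S.powerset with x ∈ O ∧ y ∉ O, ∑ q ∈ antidiagonal d, (d.choose q.1 : ℚ) *
          (factorizationCount q.1 O (swap x y * σ) *
            factorizationCount q.2 (S \ O) (swap x y * σ)) = 0) ∧
    (d + 3 = S.card + (permOrbits σ S).card → factorizationCount d S (swap x y * σ) +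
        ∑ O ∈ S.powerset with x ∈ O ∧ y ∉ O, ∑ q ∈ antidiagonal d, (d.choose q.1 : ℚ) *
          (factorizationCount q.1 O (swap x y * σ) *
            factorizationCount q.2 (S \ O) (swap x y * σ))
          = d.factorial * swapContribution S σ x y) := by
  classical
  have hρ := hS.swap_mul hx hy
  have hcount := hd d le_rfl S (swap x y * σ) ⟨x, hx⟩ hρ
  have hsum : ∑ O ∈ S.powerset with x ∈ O ∧ y ∉ O, ∑ q ∈ antidiagonal d, (d.choose q.1 : ℚ) *
          (factorizationCount q.1 O (swap x y * σ) *
            factorizationCount q.2 (S \ O) (swap x y * σ))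
      = ∑ O ∈ S.powerset with (x ∈ O ∧ y ∉ O) ∧ PermStable (swap x y * σ) O,
        ∑ q ∈ antidiagonal d, (d.choose q.1 : ℚ) * (factorizationCount q.1 O (swap x y * σ) *
            factorizationCount q.2 (S \ O) (swap x y * σ)) := by
    rw [← filter_filter (fun O => x ∈ O ∧ y ∉ O) (fun O => PermStable (swap x y * σ) O)]
    refine (sum_filter_of_ne fun O _ h0 => ?_).symm
    by_contra hst
    exact h0 (sum_eq_zero fun q _ => by rw [factorizationCount_eq_zero hst, zero_mul, mul_zero])
  have hmem : ∀ O ∈ S.powerset.filter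
      (fun O => (x ∈ O ∧ y ∉ O) ∧ PermStable (swap x y * σ) O),
      O ⊆ S ∧ PermStable (swap x y * σ) O ∧ x ∈ O ∧ y ∈ S \ O := by
    intro O hO
    rw [mem_filter, mem_powerset] at hO
    exact ⟨hO.1, hO.2.2, hO.2.1.1, mem_sdiff.2 ⟨hy, hO.2.1.2⟩⟩
  rw [hsum, swapContribution]
  by_cases h : σ.SameCycle x y
  · have hcard := card_permOrbits_cut hS hx h hne
    have key := fun O hO => sum_antidiagonal_factorizationCount hd (hmem O hO).1 (hmem O hO).2.1 hρ
      (hmem O hO).2.2.1 (hmem O hO).2.2.2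
    rw [if_pos h]
    constructor
    · intro hlt
      rw [hcount.1 (by omega), zero_add]
      exact sum_eq_zero fun O hO => (key O hO).1 (by omega)
    · intro heq
      rw [hcount.1 (by omega), zero_add, mul_sum]
      exact sum_congr rfl fun O hO => (key O hO).2 (by omega)
  · have hcard := card_permOrbits_join hS hx hy h
    have hempty : S.powerset.filter
        (fun O => (x ∈ O ∧ y ∉ O) ∧ PermStable (swap x y * σ) O) = ∅ := by
      rw [filter_eq_empty_iff]
      rintro O - ⟨⟨hxO, hyO⟩, hst⟩
      exact hyO (hst.mem_of_sameCycle hxO (sameCycle_swap_mul_of_not h))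
    rw [hempty, sum_empty, add_zero, if_neg h]
    exact ⟨fun hlt => hcount.1 (by omega), fun heq => hcount.2 (by omega)⟩

lemma swapContribution_join (hS : PermStable σ S) (hx : x ∈ S) (hy : y ∈ S)
    (h : ¬ σ.SameCycle x y) : swapContribution S σ x y =
      (∑ c ∈ permOrbits σ S, (c.card : ℚ)) ^ (((permOrbits σ S).card : ℤ) - 4) *
        (v ((permOrbit σ x).card + (permOrbit σ y).card) *
          ∏ c ∈ ((permOrbits σ S).erase (permOrbit σ x)).erase (permOrbit σ y), v c.card) := by
  have hρ := hS.swap_mul hx hy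
  have hcard := card_permOrbits_join hS hx hy h
  have hsum : ∑ c ∈ permOrbits (swap x y * σ) S, (c.card : ℚ)
      = ∑ c ∈ permOrbits σ S, (c.card : ℚ) := by
    exact_mod_cast hρ.sum_card_permOrbits.trans hS.sum_card_permOrbits.symm
  rw [swapContribution, if_neg h, hurwitzValue, hsum, ← hcard]
  congr 1
  · congr 1
    push_cast
    ring
  · rw [permOrbits_join hS hx hy h, prod_insert, card_union_of_disjoint]
    · rw [disjoint_left]
      intro z hz hz'
      exact h ((mem_permOrbit.1 hz).trans (mem_permOrbit.1 hz').symm)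
    · intro hc
      rw [mem_erase, mem_erase] at hc
      exact hc.2.1 (eq_permOrbit_of_mem hc.2.2 (mem_union_left _ (self_mem_permOrbit σ x)))

lemma swapContribution_cut {r : ℕ} (hS : PermStable σ S) (hx : x ∈ S) (h0 : 0 < r)
    (hr : r < (permOrbit σ x).card) (hy : (σ ^ r) x = y) : swapContribution S σ x y =
      ∑ I ∈ ((permOrbits σ S).erase (permOrbit σ x)).powerset,
        (((r : ℚ) + ∑ c ∈ I, (c.card : ℚ)) ^ ((I.card : ℤ) - 2) * (v r * ∏ c ∈ I, v c.card)) *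
        (((((permOrbit σ x).card - r : ℕ) : ℚ) +
            ∑ c ∈ (permOrbits σ S).erase (permOrbit σ x) \ I, (c.card : ℚ)) ^
            ((((permOrbits σ S).erase (permOrbit σ x) \ I).card : ℤ) - 2) *
          (v ((permOrbit σ x).card - r) *
            ∏ c ∈ (permOrbits σ S).erase (permOrbit σ x) \ I, v c.card)) := by
  classical
  obtain ⟨hn, hca, hcb, hu⟩ := permOrbit_cut h0 hr hy
  have hxy : σ.SameCycle x y := ⟨r, by simpa using hy⟩
  have hne : x ≠ y := by rintro rfl; exact hn (.refl _ _)
  have hyS : y ∈ S := hS.mem_of_sameCycle hx hxy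
  have hρ := hS.swap_mul hx hyS
  have horb := permOrbits_cut hS hx hxy hne
  have hC : ∀ c ∈ (permOrbits σ S).erase (permOrbit σ x), x ∉ c ∧ y ∉ c := by
    intro c hc
    rw [mem_erase] at hc
    refine ⟨fun hxc => hc.1 (eq_permOrbit_of_mem hc.2 hxc), fun hyc => hc.1 ?_⟩
    rw [eq_permOrbit_of_mem hc.2 hyc, permOrbit_eq hxy]
  set ρ := swap x y * σ
  set C := (permOrbits σ S).erase (permOrbit σ x)
  set a := permOrbit ρ x
  set b := permOrbit ρ y
  have hxa : x ∈ a := self_mem_permOrbit ρ x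
  have hyb : y ∈ b := self_mem_permOrbit ρ y
  have hya : y ∉ a := fun h => hn (mem_permOrbit.1 h)
  have hab : a ≠ b := fun h => hya (h ▸ hyb)
  have haC : a ∉ C := fun h => (hC a h).1 hxa
  have hbC : b ∉ C := fun h => (hC b h).2 hyb
  have hsub : ∀ I ⊆ C, insert a I ⊆ permOrbits ρ S := by
    intro I hI
    rw [horb]
    exact insert_subset_insert _ (hI.trans (subset_insert _ _))
  rw [swapContribution, if_pos hxy]
  symm
  refine sum_bij' (fun I _ => (insert a I).biUnion id) (fun O _ => (permOrbits ρ O).erase a)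
    ?_ ?_ ?_ ?_ ?_
  · intro I hI
    rw [mem_powerset] at hI
    rw [mem_filter, mem_powerset]
    refine ⟨?_, ⟨?_, ?_⟩, permStable_biUnion (hsub I hI)⟩
    · rw [biUnion_subset]
      exact fun c hc => hρ.subset_of_mem (hsub I hI hc)
    · exact mem_biUnion.2 ⟨a, mem_insert_self _ _, hxa⟩
    · rw [mem_biUnion]
      rintro ⟨c, hc, hyc⟩
      rcases mem_insert.1 hc with rfl | hc
      · exact hya hyc
      · exact (hC c (hI hc)).2 hyc
  · intro O hO
    rw [mem_filter, mem_powerset] at hO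
    obtain ⟨hOS, ⟨hxO, hyO⟩, hst⟩ := hO
    rw [mem_powerset]
    intro c hc
    rw [mem_erase] at hc
    have h1 : c ∈ permOrbits ρ S := image_subset_image hOS hc.2
    rw [horb, mem_insert, mem_insert] at h1
    rcases h1 with h1 | rfl | h1
    · exact absurd h1 hc.1
    · exact absurd (hst.subset_of_mem hc.2 hyb) hyO
    · exact h1
  · intro I hI
    rw [mem_powerset] at hI
    rw [permOrbits_biUnion (hsub I hI), erase_insert (fun h => haC (hI h))]
  · intro O hO
    rw [mem_filter, mem_powerset] at hO
    obtain ⟨hOS, ⟨hxO, hyO⟩, hst⟩ := hO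
    rw [insert_erase (mem_permOrbits.2 ⟨x, hxO, rfl⟩), hst.biUnion_permOrbits]
  · intro I hI
    rw [mem_powerset] at hI
    have haI : a ∉ I := fun h => haC (hI h)
    have h1 : permOrbits ρ (S \ (insert a I).biUnion id) = insert b (C \ I) := by
      rw [(permStable_biUnion (hsub I hI)).permOrbits_sdiff, permOrbits_biUnion (hsub I hI), horb]
      ext c
      simp only [mem_sdiff, mem_insert]
      constructor
      · tauto
      · rintro (rfl | ⟨h, h'⟩)
        · exact ⟨Or.inr (Or.inl rfl), fun h => h.elim (fun h => hab h.symm) fun h => hbC (hI h)⟩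
        · exact ⟨Or.inr (Or.inr h), fun h'' => h''.elim (fun e => haC (e ▸ h)) h'⟩
    have hbI : b ∉ C \ I := fun h => hbC (mem_sdiff.1 h).1
    simp only [hurwitzValue]
    rw [h1, permOrbits_biUnion (hsub I hI), sum_insert haI, prod_insert haI, sum_insert hbI,
      prod_insert hbI, card_insert_of_notMem haI, card_insert_of_notMem hbI, hca, hcb]
    push_cast
    congr 3 <;> ring

lemma sum_swapContribution (hS : PermStable σ S) (hne : S.Nonempty) :
    ∑ p ∈ S.offDiag, swapContribution S σ p.1 p.2 =
      2 * ((S.card : ℚ) + (permOrbits σ S).card - 2) * hurwitzValue S σ := by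
  have hcard : ∑ c ∈ permOrbits σ S, (c.card : ℚ) = S.card := by
    exact_mod_cast hS.sum_card_permOrbits
  have hpos : ∀ c ∈ permOrbits σ S, 0 < c.card := by
    intro c hc
    obtain ⟨x, -, rfl⟩ := mem_permOrbits.1 hc
    exact card_pos.2 ⟨x, self_mem_permOrbit σ x⟩
  have h1 : ∑ p ∈ S.offDiag, swapContribution S σ p.1 p.2
      = ∑ x ∈ S, ∑ y ∈ S.erase x, swapContribution S σ x y := by
    rw [sum_sigma']
    refine sum_nbij' (fun p => ⟨p.1, p.2⟩) (fun p => (p.1, p.2)) ?_ ?_ ?_ ?_ ?_ <;>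
      simp +contextual [mem_offDiag, eq_comm]
  rw [h1, ← hcard, hurwitzValue, ← hurwitz_recursion _ _ (permOrbits_nonempty hne) hpos,
    ← hS.sum_permOrbits, ← sum_add_distrib]
  refine sum_congr rfl fun c hc => ?_
  have h2 : ∀ x ∈ c, ∑ y ∈ S.erase x, swapContribution S σ x y =
      (∑ c' ∈ (permOrbits σ S).erase c, (c'.card : ℚ) *
        ((∑ c ∈ permOrbits σ S, (c.card : ℚ)) ^ (((permOrbits σ S).card : ℤ) - 4) *
        (v (c.card + c'.card) * ∏ c ∈ ((permOrbits σ S).erase c).erase c', v c.card))) +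
      ∑ r ∈ Ico 1 c.card, ∑ I ∈ ((permOrbits σ S).erase c).powerset,
        (((r : ℚ) + ∑ c ∈ I, (c.card : ℚ)) ^ ((I.card : ℤ) - 2) * (v r * ∏ c ∈ I, v c.card)) *
        ((((c.card - r : ℕ) : ℚ) + ∑ c ∈ (permOrbits σ S).erase c \ I, (c.card : ℚ)) ^
            ((((permOrbits σ S).erase c \ I).card : ℤ) - 2) *
          (v (c.card - r) * ∏ c ∈ (permOrbits σ S).erase c \ I, v c.card)) := by
    intro x hxc
    have hxS := hS.subset_of_mem hc hxc
    obtain rfl := eq_permOrbit_of_mem hc hxc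
    have hst := permStable_permOrbit σ x
    have hsplit : S.erase x = (S \ permOrbit σ x) ∪ (permOrbit σ x).erase x := by
      ext z
      have : z ∈ permOrbit σ x → z ∈ S := fun h => hS.subset_of_mem hc h
      simp only [mem_erase, mem_union, mem_sdiff]
      constructor
      · tauto
      · rintro (⟨h, h'⟩ | ⟨h, h'⟩)
        · exact ⟨fun e => h' (e ▸ hxc), h⟩
        · exact ⟨h, this h'⟩
    rw [hsplit, sum_union, sum_permOrbit_erase, ← (hS.sdiff hst).sum_permOrbits,
      hst.permOrbits_sdiff, permOrbits_permOrbit, sdiff_singleton_eq_erase]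
    · congr 1
      · refine sum_congr rfl fun c' hc' => ?_
        rw [mem_erase] at hc'
        rw [← nsmul_eq_mul, ← sum_const]
        refine sum_congr rfl fun y hy => ?_
        obtain rfl := eq_permOrbit_of_mem hc'.2 hy
        exact swapContribution_join hS hxS (hS.subset_of_mem hc'.2 hy)
          fun h => hc'.1 (permOrbit_eq h).symm
      · refine sum_congr rfl fun r hr => ?_
        rw [mem_Ico] at hr
        exact swapContribution_cut hS hxS hr.1 hr.2 rfl
    · rw [disjoint_left]
      intro z hz hz'
      exact (mem_sdiff.1 hz).2 (mem_of_mem_erase hz')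
  rw [sum_congr rfl h2, sum_const, nsmul_eq_mul, mul_add, mul_sum]
  congr 1
  exact sum_congr rfl fun c' _ => by ring

theorem hurwitzFormula (d : ℕ) : HurwitzFormula α d := by
  induction d using Nat.strong_induction_on with
  | _ d ih =>
  rcases d with _ | d
  · exact hurwitzFormula_zero
  intro S σ hne hS
  have key := fun p (hp : p ∈ S.offDiag) => sum_splits_eq (d := d) (fun e he => ih e (by omega)) hS
    (mem_offDiag.1 hp).1 (mem_offDiag.1 hp).2.1 (mem_offDiag.1 hp).2.2
  have hrec := two_mul_factorizationCount_succ d S σ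
  constructor
  · intro hlt
    rw [sum_eq_zero fun p hp => (key p hp).1 (by omega)] at hrec
    linarith
  · intro heq
    rw [sum_congr rfl fun p hp => (key p hp).2 (by omega), ← mul_sum,
      sum_swapContribution hS hne] at hrec
    have heq' : (S.card : ℚ) + (permOrbits σ S).card - 2 = d + 1 := by
      rw [sub_eq_iff_eq_add]
      exact_mod_cast heq.symm
    rw [heq'] at hrec
    rw [Nat.factorial_succ]
    push_cast
    linarith

end HurwitzFormula

section OrbitSizes

variable {α : Type*} [Fintype α] [DecidableEq α]

lemma map_card_permOrbits_support (σ : Perm α) :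
    (permOrbits σ σ.support).val.map card = σ.cycleType := by
  have h : permOrbits σ σ.support = σ.cycleFactorsFinset.image Perm.support := by
    ext c
    simp only [mem_permOrbits, mem_image]
    have hsupp : ∀ x ∈ σ.support, (σ.cycleOf x).support = permOrbit σ x := by
      intro x hx
      ext y
      rw [mem_permOrbit, Perm.mem_support_cycleOf_iff]
      exact and_iff_left hx
    constructor
    · rintro ⟨x, hx, rfl⟩
      exact ⟨σ.cycleOf x, Perm.cycleOf_mem_cycleFactorsFinset_iff.2 hx, hsupp x hx⟩
    · rintro ⟨g, hg, rfl⟩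
      obtain ⟨x, hx⟩ := (Perm.mem_cycleFactorsFinset_iff.1 hg).1.nonempty_support
      have hx' := Perm.mem_cycleFactorsFinset_support_le hg hx
      refine ⟨x, hx', ?_⟩
      rw [← hsupp x hx', ← Perm.cycle_is_cycleOf hx hg]
  have hinj : Set.InjOn Perm.support (σ.cycleFactorsFinset : Set (Perm α)) := by
    intro g hg g' hg' hgg
    obtain ⟨x, hx⟩ := (Perm.mem_cycleFactorsFinset_iff.1 (mem_coe.1 hg)).1.nonempty_support
    rw [Perm.cycle_is_cycleOf hx (mem_coe.1 hg),
      Perm.cycle_is_cycleOf (hgg ▸ hx) (mem_coe.1 hg')]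
  rw [h, image_val_of_injOn hinj, Multiset.map_map, Perm.cycleType_def]

lemma permOrbit_of_fixed {σ : Perm α} {x : α} (h : σ x = x) : permOrbit σ x = {x} := by
  ext y
  rw [mem_permOrbit, mem_singleton]
  constructor
  · rintro hy
    exact (hy.eq_of_left h).symm
  · rintro rfl
    rfl

lemma map_card_permOrbits_univ (σ : Perm α) :
    (permOrbits σ univ).val.map card =
      σ.cycleType + Multiset.replicate (Fintype.card α - σ.support.card) 1 := by
  have hfix : ∀ x ∈ σ.supportᶜ, permOrbit σ x = {x} := fun x hx =>
    permOrbit_of_fixed (by simpa using hx)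
  have hdisj : Disjoint (permOrbits σ σ.support) (permOrbits σ σ.supportᶜ) := by
    rw [disjoint_left]
    intro c hc hc'
    obtain ⟨x, hx, rfl⟩ := mem_permOrbits.1 hc
    obtain ⟨y, hy, hxy⟩ := mem_permOrbits.1 hc'
    have := self_mem_permOrbit σ x
    rw [← hxy, hfix y hy, mem_singleton] at this
    exact mem_compl.1 hy (this ▸ hx)
  have hinj : Set.InjOn (permOrbit σ) (σ.supportᶜ : Finset α) := by
    intro x hx y hy hxy
    rw [hfix x (mem_coe.1 hx), hfix y (mem_coe.1 hy)] at hxy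
    exact singleton_injective hxy
  rw [← union_compl σ.support, permOrbits_union, ← disjUnion_eq_union _ _ hdisj, disjUnion_val,
    Multiset.map_add, map_card_permOrbits_support, permOrbits, image_val_of_injOn hinj,
    Multiset.map_map]
  congr 1
  rw [Multiset.eq_replicate]
  refine ⟨by rw [Multiset.card_map, card_val, card_compl], fun b hb => ?_⟩
  obtain ⟨x, hx, rfl⟩ := Multiset.mem_map.1 hb
  simp [hfix x hx]

end OrbitSizes

lemma map_card_permOrbits_eq_fullCycleType {k : ℕ} (σ : Perm (Fin k)) :
    (permOrbits σ univ).val.map card = fullCycleType σ := by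
  rw [map_card_permOrbits_univ, Fintype.card_fin, fullCycleType]

lemma hurwitzValue_univ {k n : ℕ} {kk : Fin n → ℕ} {σ : Perm (Fin k)}
    (h : fullCycleType σ = (List.ofFn kk : Multiset ℕ)) :
    hurwitzValue univ σ = (∑ i, (kk i : ℚ)) ^ ((n : ℤ) - 3) * ∏ i, cycleWeight (kk i) := by
  rw [← map_card_permOrbits_eq_fullCycleType] at h
  have hn : (permOrbits σ univ).card = n := by
    simpa using congrArg Multiset.card h
  have hs := congrArg (fun m : Multiset ℕ => (m.map (Nat.cast : ℕ → ℚ)).sum) h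
  have hp := congrArg (fun m : Multiset ℕ => (m.map cycleWeight).prod) h
  simp only [Multiset.map_map, Multiset.map_coe, Multiset.sum_coe, Multiset.prod_coe,
    List.map_ofFn, List.sum_ofFn, List.prod_ofFn] at hs hp
  rw [hurwitzValue, hn]
  exact congrArg₂ (fun a b => a ^ ((n : ℤ) - 3) * b) hs hp

lemma isTransitiveFamily_iff {k d : ℕ} (hk : 0 < k) (τ : Fin d → Perm (Fin k)) :
    ListTransitive (List.ofFn τ) univ ↔ IsTransitiveFamily τ := by
  classical
  constructor
  · rintro ⟨-, h⟩ x y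
    have := h (univ.filter fun z => ∃ p ∈ Subgroup.closure (Set.range τ), p x = z)
      (subset_univ _) ⟨x, by simpa using ⟨1, one_mem _, rfl⟩⟩ ?_
    · have hy := mem_univ y
      rw [← this] at hy
      exact (mem_filter.1 hy).2
    · rintro t ht z hz
      obtain ⟨i, rfl⟩ := (List.mem_ofFn' _ _).1 ht
      obtain ⟨-, p, hp, rfl⟩ := mem_filter.1 hz
      exact mem_filter.2 ⟨mem_univ _, τ i * p,
        mul_mem (Subgroup.subset_closure ⟨i, rfl⟩) hp, rfl⟩
  · intro h
    refine ⟨⟨⟨0, hk⟩, mem_univ _⟩, fun P _ hP hst => ?_⟩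
    have hcl : ∀ p ∈ Subgroup.closure (Set.range τ), PermStable p P := by
      intro p hp
      induction hp using Subgroup.closure_induction with
      | mem p hp =>
        obtain ⟨i, rfl⟩ := hp
        exact hst _ ((List.mem_ofFn' _ _).2 ⟨i, rfl⟩)
      | one => exact fun z hz => hz
      | mul p q _ _ hp hq => exact fun z hz => hp _ (hq z hz)
      | inv p _ hp => exact fun z hz => hp.mem_of_sameCycle hz ⟨-1, by simp⟩
    obtain ⟨x, hx⟩ := hP
    refine eq_univ_iff_forall.2 fun y => ?_
    obtain ⟨p, hp, rfl⟩ := h x y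
    exact hcl p hp x hx

lemma mem_swapsIn_univ {α : Type*} [Fintype α] [DecidableEq α] {t : Perm α} :
    t ∈ swapsIn univ ↔ t.IsSwap := by
  simp only [mem_swapsIn, mem_univ, true_and, Perm.IsSwap, eq_comm]

lemma hurwitzCount_zero_eq_sum (n : ℕ) (kk : Fin n → ℕ) (hk : 0 < ∑ i, kk i) :
    (hurwitzCount 0 n kk : ℚ) =
      ∑ σ : Perm (Fin (∑ i, kk i)) with fullCycleType σ = (List.ofFn kk : Multiset ℕ),
        factorizationCount ((∑ i, kk i) + n - 2) univ σ := by
  classical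
  simp only [factorizationCount, listSum_eq_sum_piFinset]
  rw [sum_comm, hurwitzCount, Nat.card_eq_fintype_card, Fintype.card_subtype]
  have hd : (∑ i, kk i) + n + 2 * 0 - 2 = (∑ i, kk i) + n - 2 := by omega
  rw [hd, card_filter, Nat.cast_sum,
    ← sum_subset (subset_univ (Fintype.piFinset fun _ => swapsIn univ))]
  · refine sum_congr rfl fun τ hτ => ?_
    have hτ' : ∀ i, (τ i).IsSwap := fun i => mem_swapsIn_univ.1 (Fintype.mem_piFinset.1 hτ i)
    simp only [IsFactorization, mem_univ, true_implies, isTransitiveFamily_iff hk,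
      ← Equiv.ext_iff, hτ', implies_true, true_and]
    by_cases ht : IsTransitiveFamily τ
    · simp [ht, sum_ite_eq]
    · simp [ht]
  · intro τ _ hτ
    rw [if_neg, Nat.cast_zero]
    rintro ⟨h, -⟩
    exact hτ (Fintype.mem_piFinset.2 fun i => mem_swapsIn_univ.2 (h i))

lemma filter_two_le_add_replicate {M : Multiset ℕ} (hM : ∀ a ∈ M, 0 < a) :
    M.filter (2 ≤ ·) + Multiset.replicate (M.count 1) 1 = M := by
  conv_rhs => rw [← Multiset.filter_add_not (2 ≤ ·) M]
  rw [← Multiset.filter_eq']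
  congr 1
  refine Multiset.filter_congr fun a ha => ?_
  have := hM a ha
  omega

lemma fullCycleType_eq_iff {k : ℕ} {M : Multiset ℕ} (hM : ∀ a ∈ M, 0 < a) (hs : M.sum = k)
    (σ : Perm (Fin k)) : fullCycleType σ = M ↔ σ.cycleType = M.filter (2 ≤ ·) := by
  have hsplit := filter_two_le_add_replicate hM
  constructor
  · rintro rfl
    rw [fullCycleType, Multiset.filter_add,
      Multiset.filter_eq_self.2 fun a ha => Perm.two_le_of_mem_cycleType ha,
      Multiset.filter_eq_nil.2, add_zero]
    intro a ha
    rw [Multiset.eq_of_mem_replicate ha]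
    omega
  · intro h
    have hsum := congrArg Multiset.sum hsplit
    rw [Multiset.sum_add, Multiset.sum_replicate, smul_eq_mul, mul_one, ← h,
      Perm.sum_cycleType, hs] at hsum
    rw [fullCycleType, h, show k - σ.support.card = M.count 1 by omega, hsplit]

lemma card_fullCycleType_mul {k : ℕ} {M : Multiset ℕ} (hM : ∀ a ∈ M, 0 < a) (hs : M.sum = k) :
    #{σ : Perm (Fin k) | fullCycleType σ = M} *
      (M.prod * ∏ a ∈ M.toFinset, (M.count a).factorial) = k.factorial := by
  have hsplit := filter_two_le_add_replicate hM
  have hsum : (M.filter (2 ≤ ·)).sum + M.count 1 = k := by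
    simpa [hs] using congrArg Multiset.sum hsplit
  have hprod : (M.filter (2 ≤ ·)).prod = M.prod := by
    simpa using congrArg Multiset.prod hsplit
  have hcount : ∏ a ∈ M.toFinset, (M.count a).factorial = (M.count 1).factorial *
      ∏ a ∈ (M.filter (2 ≤ ·)).toFinset, ((M.filter (2 ≤ ·)).count a).factorial := by
    rw [prod_subset (s₂ := insert 1 (M.filter (2 ≤ ·)).toFinset), prod_insert (by simp)]
    · congr 1
      refine prod_congr rfl fun a ha => ?_
      rw [Multiset.count_filter_of_pos (Multiset.of_mem_filter (Multiset.mem_toFinset.1 ha))]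
    · intro a ha
      have ha' := Multiset.mem_toFinset.1 ha
      have := hM a ha'
      rw [mem_insert, Multiset.mem_toFinset, Multiset.mem_filter]
      by_cases h1 : a = 1
      · exact .inl h1
      · exact .inr ⟨ha', by omega⟩
    · intro a _ ha
      rw [Multiset.count_eq_zero.2 fun h => ha (Multiset.mem_toFinset.2 h), Nat.factorial_zero]
  have key := Perm.card_of_cycleType_mul_eq (Fin k) (M.filter (2 ≤ ·))
  rw [Fintype.card_fin, if_pos ⟨by omega, fun a ha => Multiset.of_mem_filter ha⟩,
    show k - (M.filter (2 ≤ ·)).sum = M.count 1 by omega, hprod] at key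
  rw [← key, hcount]
  simp only [fullCycleType_eq_iff hM hs]
  ring

lemma autCount_eq (n : ℕ) (kk : Fin n → ℕ) :
    autCount n kk = ∏ a ∈ (List.ofFn kk : Multiset ℕ).toFinset,
      ((List.ofFn kk : Multiset ℕ).count a).factorial := by
  classical
  have h := DomMulAct.stabilizer_card' kk
  have hM : (List.ofFn kk : Multiset ℕ) = univ.val.map kk := (Fin.univ_val_map kk).symm
  have hcard : autCount n kk = Fintype.card {g : Perm (Fin n) // kk ∘ g = kk} := by
    rw [← Nat.card_eq_fintype_card]
    exact Nat.card_congr (Equiv.subtypeEquivRight fun π => funext_iff.symm)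
  rw [hcard, h]
  refine prod_congr ?_ fun a _ => ?_
  · ext a
    simp
  · rw [hM, Multiset.count_map, Fintype.card_subtype]
    simp only [eq_comm]
    rfl

lemma hurwitzCount_zero_mul (n : ℕ) (hn : 1 ≤ n) (kk : Fin n → ℕ) (hpos : ∀ i, 0 < kk i) :
    (hurwitzCount 0 n kk : ℚ) * autCount n kk =
      ((∑ i, kk i).factorial : ℚ) * (((∑ i, kk i) + n - 2).factorial : ℚ)
        * (∑ i, kk i : ℚ) ^ ((n : ℤ) - 3)
        * ∏ i, (kk i : ℚ) ^ (kk i) / ((kk i).factorial : ℚ) := by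
  have hk : 0 < ∑ i, kk i := sum_pos (fun i _ => hpos i) ⟨⟨0, hn⟩, mem_univ _⟩
  have hN := card_fullCycleType_mul (k := ∑ i, kk i) (M := (List.ofFn kk : Multiset ℕ))
    (fun a ha => by
      obtain ⟨i, rfl⟩ := (List.mem_ofFn' _ _).1 (Multiset.mem_coe.1 ha)
      exact hpos i)
    (by rw [Multiset.sum_coe, List.sum_ofFn])
  rw [← autCount_eq, Multiset.prod_coe, List.prod_ofFn] at hN
  have hcount (σ : Perm (Fin (∑ i, kk i))) (hσ : fullCycleType σ = (List.ofFn kk : Multiset ℕ)) :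
      factorizationCount ((∑ i, kk i) + n - 2) univ σ = (((∑ i, kk i) + n - 2).factorial : ℚ) *
        ((∑ i, (kk i : ℚ)) ^ ((n : ℤ) - 3) * ∏ i, cycleWeight (kk i)) := by
    rw [← hurwitzValue_univ hσ]
    refine (hurwitzFormula _ univ σ ⟨⟨0, hk⟩, mem_univ _⟩ fun z _ => mem_univ _).2 ?_
    have hcard : (permOrbits σ univ).card = n := by
      simpa using congrArg Multiset.card ((map_card_permOrbits_eq_fullCycleType σ).trans hσ)
    rw [hcard, card_univ, Fintype.card_fin]
    omega
  rw [hurwitzCount_zero_eq_sum n kk hk, sum_congr rfl fun σ hσ => hcount σ (mem_filter.1 hσ).2,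
    sum_const, nsmul_eq_mul, ← hN]
  simp only [cycleWeight, selfPowDivFactorial, prod_mul_distrib]
  push_cast
  ring

end TranspositionFactorizations

/-- Genus-zero case of Theorem 1.1 (Hurwitz's formula):
`h_{0;k₁,…,kₙ} = ((k+n-2)! ⬝ k^{n-3} / #Aut(k₁,…,kₙ)) ⬝ ∏ kᵢ^{kᵢ}/kᵢ!`, and equivalently
the number of transitive transposition factorizations of cycle type `(k₁,…,kₙ)` of length
`k + n - 2` equals `k! ⬝ (k+n-2)! ⬝ k^{n-3} ⬝ ∏ (kᵢ^{kᵢ}/kᵢ!) / #Aut(k₁,…,kₙ)`. -/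
theorem hurwitz_formula_genus_zero (n : ℕ) (hn : 1 ≤ n)
    (kk : Fin n → ℕ) (hpos : ∀ i, 0 < kk i) :
    hurwitzNumber 0 n kk
      = ((((∑ i, kk i) + n - 2).factorial : ℚ) * (∑ i, kk i : ℚ) ^ ((n : ℤ) - 3)
          / (autCount n kk : ℚ))
        * ∏ i, (kk i : ℚ) ^ (kk i) / ((kk i).factorial : ℚ) ∧
    (hurwitzCount 0 n kk : ℚ)
      = ((∑ i, kk i).factorial : ℚ) * (((∑ i, kk i) + n - 2).factorial : ℚ)
          * (∑ i, kk i : ℚ) ^ ((n : ℤ) - 3)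
          * (∏ i, (kk i : ℚ) ^ (kk i) / ((kk i).factorial : ℚ))
          / (autCount n kk : ℚ) := by
  have haut : (autCount n kk : ℚ) ≠ 0 := by
    rw [autCount_eq]
    exact_mod_cast Finset.prod_ne_zero_iff.2 fun a _ => Nat.factorial_ne_zero _
  have hcount := eq_div_of_mul_eq haut (hurwitzCount_zero_mul n hn kk hpos)
  refine ⟨?_, hcount⟩
  have hfact : ((∑ i, kk i).factorial : ℚ) ≠ 0 := Nat.cast_ne_zero.2 (Nat.factorial_ne_zero _)
  rw [hurwitzNumber, hcount]
  field_simp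
end

section
/- (Theorem 6 of Shapiro–Shapiro–Vainshtein, used in deriving Theorem 1.2.) Let k ≥ 1 and fix a k-cycle σ ∈ S_k. For d ≥ 0 let N_d(σ) be the number of d-tuples (τ1, …, τd) of transpositions in S_k with τ1⋯τd = σ. Then the exponential generating function satisfies ∑_{d≥0} N_d(σ) x^d / d! = (2 sinh(kx/2))^{k−1} / k! for all real x, i.e., N_d(σ) = (1/k!) ∑_{j=0}^{k−1} (−1)^j C(k−1, j) (k(k−1−2j)/2)^d for every d ≥ 0. -/
open Equiv

namespace Matrix

open Polynomial

variable {n R : Type*} [Fintype n] [DecidableEq n] [CommRing R]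

theorem derivative_det_eq_trace_adjugate_mul (M : Matrix n n R[X]) :
    derivative M.det = (M.adjugate * M.map derivative).trace := by
  have h (i : n) : (M.adjugate * M.map derivative) i i =
      (M.updateCol i fun j ↦ derivative (M j i)).det := by
    rw [← cramer_apply, cramer_eq_adjugate_mulVec]
    rfl
  simp only [trace, diag, h, det_apply, map_sum, derivative_smul, derivative_prod_finset,
    Finset.smul_sum]
  rw [Finset.sum_comm]
  refine Finset.sum_congr rfl fun i _ ↦ Finset.sum_congr rfl fun g _ ↦ ?_
  rw [← Finset.mul_prod_erase _ _ (Finset.mem_univ i), mul_comm]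
  congr 2
  · simp
  · refine Finset.prod_congr rfl fun j hj ↦ ?_
    simp [Finset.ne_of_mem_erase hj]

theorem det_add_single_sub_single (B : Matrix n n R) (u : n → R) {i j : n} (hij : i ≠ j) :
    (B + vecMulVec u (Pi.single i 1 - Pi.single j 1)).det =
      B.det + (B.adjugate *ᵥ u) i - (B.adjugate *ᵥ u) j := by
  have h : B + vecMulVec u (Pi.single i 1 - Pi.single j 1) =
      (B.updateCol i (B.col i + u)).updateCol j (B.col j + -u) := by
    ext a b
    by_cases hb : b = j
    · subst hb
      simp [vecMulVec_apply, hij.symm]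
    · by_cases hc : b = i
      · subst hc
        simp [vecMulVec_apply, hij]
      · simp [vecMulVec_apply, hb, hc]
  have hj : (B.updateCol i u).updateCol j (B.col j) = B.updateCol i u := by
    ext a b
    by_cases hb : b = j
    · subst hb; simp [hij.symm]
    · simp [hb]
  have hi (v : n → R) : (B.updateCol i (B.col i)).updateCol j v = B.updateCol j v := by
    congr 1
    exact updateCol_eq_self B i
  have h0 : ((B.updateCol i u).updateCol j u).det = 0 :=
    det_zero_of_column_eq hij (by simp [hij])
  have hc (v : n → R) (w : n → R) : (B.updateCol i v).updateCol j w =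
      (B.updateCol j w).updateCol i v := by
    ext a b
    by_cases hb : b = j
    · subst hb; simp [hij.symm]
    · by_cases hc : b = i
      · subst hc; simp [hij]
      · simp [hb, hc]
  have hneg (M : Matrix n n R) (v : n → R) :
      (M.updateCol j (-v)).det = -(M.updateCol j v).det := by
    simpa using det_updateCol_smul M j (-1) v
  rw [h, det_updateCol_add, hneg]
  rw [hc, hc _ u, det_updateCol_add, det_updateCol_add, ← hc, ← hc, ← hc, ← hc, h0, hj, hi, hi,
    show B.updateCol j (B.col j) = B from updateCol_eq_self B j,
    ← cramer_eq_adjugate_mulVec, cramer_apply, cramer_apply]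
  ring

end Matrix

theorem two_mul_sum_isSwap {n R : Type*} [Fintype n] [DecidableEq n] [CommRing R]
    [Fintype {τ : Perm n // τ.IsSwap}] (f : Perm n → R) :
    2 * ∑ τ : {τ : Perm n // τ.IsSwap}, f τ =
      ∑ p ∈ (Finset.univ : Finset n).offDiag, f (swap p.1 p.2) := by
  classical
  have h := Finset.sum_subtype (F := inferInstance) (p := fun τ : Perm n ↦ τ.IsSwap)
    {τ | τ.IsSwap} (by simp) f
  rw [← h, Finset.mul_sum, ← Finset.sum_fiberwise_of_maps_to
    (t := {τ | τ.IsSwap}) (g := fun p : n × n ↦ swap p.1 p.2)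
    (fun p hp ↦ by simpa using ⟨p.1, p.2, by simpa using hp, rfl⟩)]
  refine Finset.sum_congr rfl fun τ hτ ↦ ?_
  obtain ⟨a, b, hab, rfl⟩ : τ.IsSwap := by simpa using hτ
  have hf : Finset.filter (fun p : n × n ↦ swap p.1 p.2 = swap a b)
      (Finset.univ : Finset n).offDiag = {(a, b), (b, a)} := by
    ext ⟨x, y⟩
    simp only [Finset.mem_filter, Finset.mem_offDiag, Finset.mem_univ, true_and,
      Finset.mem_insert, Finset.mem_singleton, Prod.mk.injEq]
    constructor
    · rintro ⟨hxy, h⟩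
      have h1 := DFunLike.congr_fun h a
      have h2 := DFunLike.congr_fun h b
      simp only [swap_apply_left, swap_apply_right, swap_apply_def] at h1 h2
      grind
    · rintro (⟨rfl, rfl⟩ | ⟨rfl, rfl⟩)
      · exact ⟨hab, rfl⟩
      · exact ⟨hab.symm, swap_comm _ _⟩
  rw [hf, Finset.sum_pair (by simp [hab]), swap_comm b a]
  ring

namespace Equiv.Perm

open Polynomial Matrix

variable {n : Type*} [Fintype n] [DecidableEq n]

/-- The polynomial `det (1 + X P)`, where `P` is the permutation matrix of `g`. -/
noncomputable def detOneAddX (g : Perm n) : ℝ[X] :=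
  (1 + (X : ℝ[X]) • g.permMatrix ℝ[X]).det

theorem derivative_detOneAddX (g : Perm n) :
    derivative g.detOneAddX =
      ((1 + (X : ℝ[X]) • g.permMatrix ℝ[X]).adjugate * g.permMatrix ℝ[X]).trace := by
  rw [detOneAddX, derivative_det_eq_trace_adjugate_mul]
  congr 2
  ext1 i j
  simp only [map_apply, Matrix.add_apply, Matrix.smul_apply, Matrix.one_apply,
    PEquiv.toMatrix_apply]
  split_ifs <;> simp

theorem detOneAddX_swap_mul (g : Perm n) {i j : n} (hij : i ≠ j) :
    (swap i j * g).detOneAddX = g.detOneAddX - X *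
      (let M := (1 + (X : ℝ[X]) • g.permMatrix ℝ[X]).adjugate * g.permMatrix ℝ[X]
       M i i + M j j - M i j - M j i) := by
  have h : (1 + (X : ℝ[X]) • (swap i j * g).permMatrix ℝ[X]) =
      (1 + (X : ℝ[X]) • g.permMatrix ℝ[X]) + vecMulVec
        (-(X : ℝ[X]) • (g.permMatrix ℝ[X] *ᵥ (Pi.single i 1 - Pi.single j 1)))
        (Pi.single i 1 - Pi.single j 1) := by
    rw [permMatrix_mulVec]
    ext1 a b
    simp only [Matrix.add_apply, Matrix.smul_apply, PEquiv.toMatrix_apply, vecMulVec_apply,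
      toPEquiv_apply, coe_mul, Function.comp_apply, Pi.smul_apply, Pi.sub_apply, Pi.single_apply,
      swap_apply_def, Option.mem_some_iff, smul_eq_mul, add_assoc]
    congr 1
    by_cases h1 : g a = i
    · by_cases hb : b = i <;> by_cases hc : b = j <;> grind
    · by_cases h2 : g a = j
      · by_cases hb : b = i <;> by_cases hc : b = j <;> grind
      · grind
  rw [detOneAddX, h, det_add_single_sub_single _ _ hij, mulVec_smul, mulVec_mulVec, mulVec_sub]
  simp only [detOneAddX, Pi.smul_apply, Pi.sub_apply, mulVec_single_one, col_apply, smul_eq_mul]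
  ring

theorem one_add_X_mul_sum_adjugate_mul (g : Perm n) :
    (1 + (X : ℝ[X])) * ∑ i, ∑ j,
      ((1 + (X : ℝ[X]) • g.permMatrix ℝ[X]).adjugate * g.permMatrix ℝ[X]) i j =
      (Fintype.card n : ℝ[X]) * g.detOneAddX := by
  set B := 1 + (X : ℝ[X]) • g.permMatrix ℝ[X] with hB
  have h1 : g.permMatrix ℝ[X] *ᵥ 1 = 1 := by rw [permMatrix_mulVec]; rfl
  have h2 : B *ᵥ 1 = (1 + (X : ℝ[X])) • 1 := by
    rw [hB, add_mulVec, smul_mulVec, h1, one_mulVec, add_smul, one_smul]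
  have h3 : (1 + (X : ℝ[X])) • ((B.adjugate * g.permMatrix ℝ[X]) *ᵥ 1) = B.det • 1 := by
    rw [← mulVec_mulVec, h1, ← mulVec_smul, ← h2, mulVec_mulVec, adjugate_mul, smul_mulVec,
      one_mulVec]
  have h4 (i : n) : (1 + (X : ℝ[X])) * ∑ j, (B.adjugate * g.permMatrix ℝ[X]) i j = B.det := by
    simpa [mulVec, dotProduct] using congrFun h3 i
  rw [Finset.mul_sum, Finset.sum_congr rfl fun i _ ↦ h4 i]
  simp [detOneAddX, ← hB]

theorem sum_isSwap_detOneAddX_mul [Fintype {τ : Perm n // τ.IsSwap}] (g : Perm n) :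
    (1 + X) * (2 * ∑ τ : {τ : Perm n // τ.IsSwap}, (τ.1 * g).detOneAddX) =
      (1 + X) * ((Fintype.card n : ℝ[X]) * ((Fintype.card n : ℝ[X]) - 1)) * g.detOneAddX
        - 2 * X * (1 + X) * (Fintype.card n : ℝ[X]) * derivative g.detOneAddX
        + 2 * X * (Fintype.card n : ℝ[X]) * g.detOneAddX := by
  rw [two_mul_sum_isSwap fun τ : Perm n ↦ (τ * g).detOneAddX]
  have hJ := one_add_X_mul_sum_adjugate_mul g
  rw [derivative_detOneAddX]
  set M := (1 + (X : ℝ[X]) • g.permMatrix ℝ[X]).adjugate * g.permMatrix ℝ[X] with hM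
  have h1 : ∑ p ∈ (Finset.univ : Finset n).offDiag, (swap p.1 p.2 * g).detOneAddX =
      ∑ p ∈ (Finset.univ : Finset n).offDiag, (g.detOneAddX - X *
        (M p.1 p.1 + M p.2 p.2 - M p.1 p.2 - M p.2 p.1)) :=
    Finset.sum_congr rfl fun p hp ↦ detOneAddX_swap_mul g (by simpa using hp)
  have h2 : ∑ p ∈ (Finset.univ : Finset n).offDiag,
      (M p.1 p.1 + M p.2 p.2 - M p.1 p.2 - M p.2 p.1) =
      ∑ i, ∑ j, (M i i + M j j - M i j - M j i) := by
    rw [← Finset.sum_product', ← Finset.diag_union_offDiag,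
      Finset.sum_union (Finset.disjoint_diag_offDiag _)]
    simp [Finset.sum_add_distrib]
  have h3 : ∑ i, ∑ j, (M i i + M j j - M i j - M j i) =
      2 * (Fintype.card n : ℝ[X]) * M.trace - 2 * ∑ i, ∑ j, M i j := by
    simp only [Finset.sum_add_distrib, Finset.sum_sub_distrib]
    rw [Finset.sum_comm (f := fun i j ↦ M j i)]
    simp only [Finset.sum_const, Finset.card_univ, nsmul_eq_mul, trace, diag_apply,
      ← Finset.mul_sum]
    ring
  have h4 : (((Finset.univ : Finset n).offDiag.card : ℕ) : ℝ[X]) =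
      (Fintype.card n : ℝ[X]) * ((Fintype.card n : ℝ[X]) - 1) := by
    rw [Finset.offDiag_card, Nat.cast_sub (Nat.le_mul_self _)]
    push_cast
    rw [Finset.card_univ]
    ring
  rw [h1, Finset.sum_sub_distrib, ← Finset.mul_sum, h2, h3, Finset.sum_const, nsmul_eq_mul, h4]
  linear_combination (2 * X) * hJ

theorem IsCycle.detOneAddX_eq {g : Perm n} (hg : g.IsCycle) (hs : g.support = Finset.univ) :
    g.detOneAddX = 1 - C ((-1 : ℝ) ^ Fintype.card n) * X ^ Fintype.card n := by
  have hne (i : n) : g i ≠ i := mem_support.1 (hs ▸ Finset.mem_univ i)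
  have hkey (π : Perm n) (h : ∀ i, π i = i ∨ g (π i) = i) : π = 1 ∨ π = g⁻¹ := by
    by_cases hf : ∃ i, π i = i
    · obtain ⟨i, hi⟩ := hf
      left
      have hstep (x : n) (hx : π x = x) : π (g x) = g x := by
        refine (h (g x)).resolve_right fun h' ↦ hne x ?_
        exact π.injective ((g.injective h').trans hx.symm)
      have hpow (a : ℕ) : π ((g ^ a) i) = (g ^ a) i := by
        induction a with
        | zero => simpa using hi
        | succ a ih => simpa [pow_succ'] using hstep _ ih
      ext j
      obtain ⟨a, rfl⟩ := (hg.sameCycle (hne i) (hne j)).exists_nat_pow_eq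
      simpa using hpow a
    · right
      push Not at hf
      ext j
      rw [eq_inv_iff_eq]
      exact (h j).resolve_left (hf j)
  have h1 : (1 : Perm n) ≠ g⁻¹ := fun h ↦ hg.ne_one (inv_eq_one.1 h.symm)
  have hsgn : Perm.sign g = -(-1) ^ Fintype.card n := by rw [hg.sign, hs, Finset.card_univ]
  rw [detOneAddX, det_apply, ← Finset.sum_subset (Finset.subset_univ {1, g⁻¹}),
    Finset.sum_pair h1]
  · have hinv (i : n) : g.symm i ≠ i := fun h ↦ hne i ((symm_apply_eq g).1 h).symm
    simp [PEquiv.toMatrix_apply, hne, hinv, hsgn, Units.smul_def, sub_eq_add_neg]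
  · intro π _ hπ
    have : ¬ ∀ i, π i = i ∨ g (π i) = i := fun h ↦ hπ (by simpa using hkey π h)
    push Not at this
    obtain ⟨i, hi, hi'⟩ := this
    rw [Finset.prod_eq_zero (Finset.mem_univ i), smul_zero]
    simp [PEquiv.toMatrix_apply, hi, hi']

theorem eval_derivative_detOneAddX_of_not_sameCycle {g : Perm n} {x y : n}
    (hxy : ¬ g.SameCycle x y) : (derivative g.detOneAddX).eval (-1) = 0 := by
  classical
  have hadj (i j : n) :
      ((1 + (X : ℝ[X]) • g.permMatrix ℝ[X]).adjugate i j).eval (-1) = 0 := by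
    rw [adjugate_apply, ← coe_evalRingHom, RingHom.map_det, RingHom.mapMatrix_apply,
      map_updateRow, ← exists_mulVec_eq_zero_iff]
    refine ⟨fun z ↦ if g.SameCycle i z then 0 else 1, fun h0 ↦ hxy ?_, ?_⟩
    · have h (z : n) : g.SameCycle i z := by simpa using congrFun h0 z
      exact (h x).symm.trans (h y)
    · have hmap : (1 + (X : ℝ[X]) • g.permMatrix ℝ[X]).map (evalRingHom (-1 : ℝ)) =
          1 - g.permMatrix ℝ := by
        ext a b
        simp only [map_apply, Matrix.add_apply, Matrix.smul_apply, Matrix.sub_apply,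
          Matrix.one_apply, PEquiv.toMatrix_apply]
        split_ifs <;> simp
      ext a
      by_cases ha : a = j
      · subst ha
        simp [mulVec, dotProduct, Pi.single_apply, apply_ite, SameCycle.refl]
      · have hfun := congrFun (sub_mulVec (1 : Matrix n n ℝ) (g.permMatrix ℝ)
          fun z ↦ if g.SameCycle i z then 0 else 1) a
        rw [one_mulVec, permMatrix_mulVec] at hfun
        rw [hmap]
        simp only [mulVec, updateRow_ne ha] at hfun ⊢
        rw [hfun]
        simp
  rw [derivative_detOneAddX]
  simp only [trace, diag_apply, Matrix.mul_apply, eval_finsetSum, eval_mul, hadj, zero_mul,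
    Finset.sum_const_zero]

theorem eval_derivative_detOneAddX [Nontrivial n] (g : Perm n) :
    (derivative g.detOneAddX).eval (-1) =
      if g.cycleType = {Fintype.card n} then (Fintype.card n : ℝ) else 0 := by
  split_ifs with h
  · have hg : g.IsCycle := card_cycleType_eq_one.1 (by simp [h])
    have hs : g.support = Finset.univ := by
      rw [← Finset.card_eq_iff_eq_univ, ← sum_cycleType, h, Multiset.sum_singleton]
    obtain ⟨m, hm⟩ : ∃ m, Fintype.card n = m + 1 :=
      Nat.exists_eq_add_one.2 Fintype.card_pos
    rw [hg.detOneAddX_eq hs, hm]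
    have : ((-1 : ℝ) ^ m) * (-1) ^ m = 1 := by rw [← mul_pow]; simp
    simp only [derivative_sub, derivative_one, derivative_C_mul, derivative_X_pow, eval_sub,
      eval_mul, eval_pow, eval_C, eval_X, eval_zero, eval_natCast, Nat.add_sub_cancel, map_natCast]
    rw [pow_succ]
    push_cast
    linear_combination ((m : ℝ) + 1) * this
  · by_cases hc : ∀ x y, g.SameCycle x y
    · refine absurd ?_ h
      have hne (x : n) : g x ≠ x := fun hx ↦ by
        obtain ⟨y, hy⟩ := exists_ne x
        exact hy ((hc x y).eq_of_left hx).symm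
      have hg : g.IsCycle := by
        obtain ⟨x⟩ := (inferInstance : Nonempty n)
        exact ⟨x, hne x, fun y _ ↦ hc x y⟩
      rw [hg.cycleType, Finset.card_eq_iff_eq_univ _ |>.2]
      ext x
      simp [hne]
    · push Not at hc
      obtain ⟨x, y, hxy⟩ := hc
      exact eval_derivative_detOneAddX_of_not_sameCycle hxy

end Equiv.Perm

section Counting

open Polynomial Equiv.Perm

/-- The polynomial `∑ j < k, C(k - 1, j) c_j ^ d X ^ j` with `c_j = k (k - 1 - 2 j) / 2`. -/
noncomputable def contentPolynomial (k d : ℕ) : ℝ[X] :=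
  ∑ j ∈ Finset.range k, C (((k - 1).choose j : ℝ) *
    ((k : ℝ) * ((k : ℝ) - 1 - 2 * (j : ℝ)) / 2) ^ d) * X ^ j

theorem contentPolynomial_zero {k : ℕ} (hk : 1 ≤ k) :
    contentPolynomial k 0 = (1 + X) ^ (k - 1) := by
  rw [contentPolynomial, add_comm 1 X, add_pow, Nat.sub_add_cancel hk]
  exact Finset.sum_congr rfl fun j _ ↦ by simp [mul_comm]

theorem two_mul_contentPolynomial_succ (k d : ℕ) :
    2 * contentPolynomial k (d + 1) = (k : ℝ[X]) * ((k : ℝ[X]) - 1) * contentPolynomial k d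
      - 2 * (k : ℝ[X]) * X * derivative (contentPolynomial k d) := by
  simp only [contentPolynomial, derivative_sum, Finset.mul_sum, ← Finset.sum_sub_distrib]
  refine Finset.sum_congr rfl fun j _ ↦ ?_
  have hX : X * derivative (X ^ j : ℝ[X]) = (j : ℝ[X]) * X ^ j := by
    cases j with
    | zero => simp
    | succ j => rw [derivative_X_pow]; simp [pow_succ]; ring
  have hC : (2 : ℝ[X]) * C ((k : ℝ) * ((k : ℝ) - 1 - 2 * (j : ℝ)) / 2) =
      (k : ℝ[X]) * ((k : ℝ[X]) - 1 - 2 * (j : ℝ[X])) := by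
    rw [← C_ofNat, ← C_mul, mul_div_cancel₀ _ two_ne_zero]
    simp
  rw [derivative_C_mul, pow_succ, ← mul_assoc, C_mul, C_mul]
  set c := C (((k - 1).choose j : ℝ))
  rw [C_mul]
  linear_combination (c * C (((k : ℝ) * ((k : ℝ) - 1 - 2 * (j : ℝ)) / 2) ^ d) * X ^ j) * hC
    + 2 * (k : ℝ[X]) * c * C (((k : ℝ) * ((k : ℝ) - 1 - 2 * (j : ℝ)) / 2) ^ d) * hX

theorem sum_detOneAddX_prod_ofFn {n : Type*} [Fintype n] [DecidableEq n] [Nonempty n]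
    [Fintype {τ : Perm n // τ.IsSwap}] (d : ℕ) :
    ∑ t : Fin d → {τ : Perm n // τ.IsSwap}, (List.ofFn fun i ↦ (t i).1).prod.detOneAddX =
      (1 + X) * contentPolynomial (Fintype.card n) d := by
  have hX : (1 + X : ℝ[X]) ≠ 0 := by
    rw [add_comm, ← C_1]
    exact X_add_C_ne_zero 1
  induction d with
  | zero =>
    have h : (1 : Matrix n n ℝ[X]) + (X : ℝ[X]) • 1 = (1 + X : ℝ[X]) • 1 := by
      rw [add_smul, one_smul]
    rw [contentPolynomial_zero Fintype.card_pos, ← pow_succ',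
      Nat.sub_add_cancel Fintype.card_pos]
    simp [detOneAddX, h]
  | succ d ih =>
    rw [← (Fin.consEquiv fun _ ↦ {τ : Perm n // τ.IsSwap}).sum_comp, Fintype.sum_prod_type_right]
    simp only [Fin.consEquiv_apply, List.ofFn_succ, Fin.cons_zero, Fin.cons_succ, List.prod_cons]
    refine mul_left_cancel₀ hX (mul_left_cancel₀ (two_ne_zero : (2 : ℝ[X]) ≠ 0) ?_)
    have h := Finset.sum_congr rfl
      fun (t : Fin d → {τ : Perm n // τ.IsSwap}) (_ : t ∈ Finset.univ) ↦
        sum_isSwap_detOneAddX_mul (List.ofFn fun i ↦ (t i).1).prod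
    simp only [Finset.sum_add_distrib, Finset.sum_sub_distrib, ← Finset.mul_sum,
      ← derivative_sum, ih, derivative_mul, derivative_add, derivative_one, derivative_X] at h
    linear_combination h - (1 + X) ^ 2 *
      two_mul_contentPolynomial_succ (Fintype.card n) d

theorem card_prod_ofFn_eq_of_isConj {n : Type*} [DecidableEq n] (d : ℕ) {g g' : Perm n}
    (h : IsConj g g') :
    Nat.card {t : Fin d → {τ : Perm n // τ.IsSwap} // (List.ofFn fun i ↦ (t i).1).prod = g} =
      Nat.card {t : Fin d → {τ : Perm n // τ.IsSwap} //
        (List.ofFn fun i ↦ (t i).1).prod = g'} := by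
  obtain ⟨c, rfl⟩ := isConj_iff.1 h
  have hswap (τ : Perm n) : τ.IsSwap ↔ (MulAut.conj c τ).IsSwap := by
    have key (a τ : Perm n) (h : τ.IsSwap) : (a * τ * a⁻¹).IsSwap := by
      obtain ⟨x, y, hxy, rfl⟩ := h
      exact ⟨a x, a y, a.injective.ne hxy, by rw [mul_swap_eq_swap_mul, mul_inv_cancel_right]⟩
    refine ⟨key c τ, fun h ↦ ?_⟩
    simpa [mul_assoc] using key c⁻¹ _ h
  let e : {τ : Perm n // τ.IsSwap} ≃ {τ : Perm n // τ.IsSwap} :=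
    (MulAut.conj c).toEquiv.subtypeEquiv hswap
  refine Nat.card_congr (((Equiv.refl (Fin d)).arrowCongr e).subtypeEquiv fun t ↦ ?_)
  have hprod : (List.ofFn fun i ↦ (((Equiv.refl (Fin d)).arrowCongr e) t i).1).prod =
      MulAut.conj c (List.ofFn fun i ↦ (t i).1).prod := by
    rw [map_list_prod, List.map_ofFn]
    rfl
  rw [hprod, ← MulAut.conj_apply, (MulAut.conj c).injective.eq_iff]

theorem factorial_mul_card_prod_ofFn_of_cycleType {n : Type*} [Fintype n] [DecidableEq n] [Nontrivial n]
    (d : ℕ) {σ : Perm n} (hσ : σ.cycleType = {Fintype.card n}) :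
    ((Fintype.card n).factorial : ℝ) * Nat.card {t : Fin d → {τ : Perm n // τ.IsSwap} //
        (List.ofFn fun i ↦ (t i).1).prod = σ} =
      (contentPolynomial (Fintype.card n) d).eval (-1) := by
  classical
  have h := congrArg (fun p ↦ (derivative p).eval (-1)) (sum_detOneAddX_prod_ofFn (n := n) d)
  simp only [derivative_sum, eval_finsetSum, eval_derivative_detOneAddX, derivative_mul,
    derivative_add, derivative_one, derivative_X, eval_add, eval_mul, eval_one, eval_X,
    zero_add, one_mul, add_neg_cancel, zero_mul, add_zero] at h
  rw [← h, ← Finset.sum_filter, Finset.sum_const, nsmul_eq_mul]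
  rw [Finset.card_eq_sum_card_fiberwise (t := {g : Perm n | g.cycleType = {Fintype.card n}})
    (f := fun t ↦ (List.ofFn fun i ↦ (t i).1).prod) (fun t ht ↦ by simpa using ht)]
  have hfib (g : Perm n) (hg : g ∈ ({g : Perm n | g.cycleType = {Fintype.card n}} : Finset _)) :
      (Finset.filter (fun t : Fin d → {τ : Perm n // τ.IsSwap} ↦
          (List.ofFn fun i ↦ (t i).1).prod = g)
        {t | (List.ofFn fun i ↦ (t i).1).prod.cycleType = {Fintype.card n}}).card =
      Nat.card {t : Fin d → {τ : Perm n // τ.IsSwap} //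
        (List.ofFn fun i ↦ (t i).1).prod = σ} := by
    have hg' : g.cycleType = {Fintype.card n} := by simpa using hg
    rw [card_prod_ofFn_eq_of_isConj d (isConj_of_cycleType_eq (hσ.trans hg'.symm)),
      Nat.card_eq_fintype_card, Fintype.card_subtype, Finset.filter_filter]
    congr 1
    ext t
    simp only [Finset.mem_filter, Finset.mem_univ, true_and, and_iff_right_iff_imp]
    rintro rfl
    exact hg'
  rw [Finset.sum_congr rfl hfib, Finset.sum_const, smul_eq_mul,
    card_of_cycleType_singleton Fintype.one_lt_card le_rfl, Nat.choose_self, mul_one,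
    ← Nat.mul_factorial_pred Fintype.card_ne_zero]
  push_cast
  ring

theorem eval_neg_one_contentPolynomial (k d : ℕ) :
    (contentPolynomial k d).eval (-1) = ∑ j ∈ Finset.range k, (-1 : ℝ) ^ j *
      ((k - 1).choose j : ℝ) * ((k : ℝ) * ((k : ℝ) - 1 - 2 * (j : ℝ)) / 2) ^ d := by
  simp only [contentPolynomial, Polynomial.eval_finsetSum, Polynomial.eval_mul,
    Polynomial.eval_C, Polynomial.eval_pow, Polynomial.eval_X]
  exact Finset.sum_congr rfl fun j _ ↦ by ring

theorem card_isSwap_and_prod_ofFn_eq {n : Type*} [DecidableEq n] (d : ℕ) (σ : Perm n) :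
    Nat.card {τ : Fin d → Perm n // (∀ i, (τ i).IsSwap) ∧ (List.ofFn τ).prod = σ} =
      Nat.card {t : Fin d → {τ : Perm n // τ.IsSwap} //
        (List.ofFn fun i ↦ (t i).1).prod = σ} :=
  Nat.card_congr
    { toFun t := ⟨fun i ↦ ⟨t.1 i, t.2.1 i⟩, t.2.2⟩
      invFun t := ⟨fun i ↦ (t.1 i).1, fun i ↦ (t.1 i).2, t.2⟩
      left_inv _ := rfl
      right_inv _ := rfl }

theorem factorial_mul_card_prod_ofFn {k : ℕ} (hk : 1 ≤ k) (d : ℕ) {σ : Perm (Fin k)}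
    (hσ : fullCycleType σ = {k}) :
    (k.factorial : ℝ) * Nat.card {t : Fin d → {τ : Perm (Fin k) // τ.IsSwap} //
        (List.ofFn fun i ↦ (t i).1).prod = σ} =
      (contentPolynomial k d).eval (-1) := by
  obtain rfl | hk' := hk.eq_or_lt
  · have : IsEmpty {τ : Perm (Fin 1) // τ.IsSwap} :=
      ⟨fun ⟨_, x, y, hxy, _⟩ ↦ hxy (Subsingleton.elim x y)⟩
    cases d with
    | zero => simp [eval_neg_one_contentPolynomial, Subsingleton.elim σ 1]
    | succ d => simp [eval_neg_one_contentPolynomial]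
  · have : Nontrivial (Fin k) := Fin.nontrivial_iff_two_le.2 hk'
    have hcycle : σ.cycleType = {k} := by
      have hcard := σ.support.card_le_univ
      rw [Fintype.card_fin] at hcard
      have hmem : 1 ∉ Multiset.replicate (k - σ.support.card) 1 := fun h ↦ by
        have h1 : 1 ∈ fullCycleType σ := Multiset.mem_add.2 (Or.inr h)
        rw [hσ, Multiset.mem_singleton] at h1
        omega
      have hzero : k - σ.support.card = 0 := by
        by_contra h
        exact hmem (Multiset.mem_replicate.2 ⟨h, rfl⟩)
      simpa [fullCycleType, hzero] using hσ
    simpa using factorial_mul_card_prod_ofFn_of_cycleType d (σ := σ) (by simpa using hcycle)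

end Counting

theorem tsum_sum_mul_pow_div_factorial (c : ℕ → ℝ) (a : ℕ → ℝ) (s : Finset ℕ) (x : ℝ) :
    ∑' d : ℕ, (∑ j ∈ s, c j * a j ^ d) * x ^ d / (d.factorial : ℝ) =
      ∑ j ∈ s, c j * Real.exp (a j * x) := by
  refine HasSum.tsum_eq ?_
  have h (j : ℕ) : HasSum (fun d : ℕ ↦ c j * ((a j * x) ^ d / (d.factorial : ℝ)))
      (c j * Real.exp (a j * x)) := by
    rw [Real.exp_eq_exp_ℝ]
    exact (NormedSpace.expSeries_div_hasSum_exp (a j * x)).mul_left _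
  convert hasSum_sum fun j (_ : j ∈ s) ↦ h j using 2 with d
  rw [Finset.sum_mul, Finset.sum_div]
  exact Finset.sum_congr rfl fun j _ ↦ by ring

theorem two_mul_sinh_pow (y : ℝ) (m : ℕ) :
    (2 * Real.sinh y) ^ m = ∑ j ∈ Finset.range (m + 1),
      (-1 : ℝ) ^ j * (m.choose j : ℝ) * Real.exp (((m : ℝ) - 2 * (j : ℝ)) * y) := by
  rw [Real.sinh_eq, mul_div_cancel₀ _ two_ne_zero, sub_eq_neg_add, add_pow]
  refine Finset.sum_congr rfl fun j hj ↦ ?_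
  have hj' : j ≤ m := Nat.lt_succ_iff.1 (Finset.mem_range.1 hj)
  rw [neg_pow, ← Real.exp_nat_mul, ← Real.exp_nat_mul, Nat.cast_sub hj',
    show ((m : ℝ) - 2 * (j : ℝ)) * y = (j : ℝ) * -y + ((m : ℝ) - j) * y by ring, Real.exp_add]
  ring

/-- Theorem 6 of Shapiro–Shapiro–Vainshtein: if `σ ∈ S_k` is a `k`-cycle and `N_d(σ)`
denotes the number of `d`-tuples of transpositions in `S_k` with product `σ`, then
`∑_{d≥0} N_d(σ) x^d/d! = (2 sinh(kx/2))^{k-1}/k!`, i.e.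
`N_d(σ) = (1/k!) ∑_{j=0}^{k-1} (-1)^j C(k-1,j) (k(k-1-2j)/2)^d`. -/
theorem transposition_factorizations_of_cycle (k : ℕ) (hk : 1 ≤ k)
    (σ : Perm (Fin k)) (hσ : fullCycleType σ = {k})
    (N : ℕ → ℕ)
    (hN : ∀ d, N d = Nat.card {τ : Fin d → Perm (Fin k) //
        (∀ i, (τ i).IsSwap) ∧ (List.ofFn τ).prod = σ}) :
    (∀ x : ℝ, ∑' d : ℕ, (N d : ℝ) * x ^ d / (d.factorial : ℝ)
        = (2 * Real.sinh ((k : ℝ) * x / 2)) ^ (k - 1) / (k.factorial : ℝ)) ∧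
    ∀ d : ℕ, (N d : ℝ) = (1 / (k.factorial : ℝ)) *
        ∑ j ∈ Finset.range k, (-1 : ℝ) ^ j * ((k - 1).choose j : ℝ) *
          ((k : ℝ) * ((k : ℝ) - 1 - 2 * (j : ℝ)) / 2) ^ d := by
  have hformula (d : ℕ) : (N d : ℝ) = (1 / (k.factorial : ℝ)) *
      ∑ j ∈ Finset.range k, (-1 : ℝ) ^ j * ((k - 1).choose j : ℝ) *
        ((k : ℝ) * ((k : ℝ) - 1 - 2 * (j : ℝ)) / 2) ^ d := by
    rw [hN d, card_isSwap_and_prod_ofFn_eq, ← eval_neg_one_contentPolynomial,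
      ← factorial_mul_card_prod_ofFn hk d hσ]
    field_simp
  refine ⟨fun x ↦ ?_, hformula⟩
  simp only [hformula, Finset.mul_sum, ← mul_assoc]
  rw [tsum_sum_mul_pow_div_factorial, two_mul_sinh_pow, Nat.sub_add_cancel hk, Finset.sum_div]
  refine Finset.sum_congr rfl fun j _ ↦ ?_
  rw [Nat.cast_pred hk, show (k : ℝ) * ((k : ℝ) - 1 - 2 * (j : ℝ)) / 2 * x =
    ((k : ℝ) - 1 - 2 * (j : ℝ)) * ((k : ℝ) * x / 2) by ring]
  ring
end

section
/- (Combinatorial form of Theorem 1.2, obtained by combining Theorem 1.1 with Theorem 6 of [16]; equivalent, under t ↦ it, to the Faber–Pandharipande identity 1 + ∑_{g≥1} t^{2g} ∫_{M̄_{g,1}} (k^g + k^{g−1}c_1(Λ) + ⋯ + c_g(Λ))/(1 − c_1(L_1)) = ((t/2)/sin(t/2))^{k+1}.) Let k ≥ 1, and for g ≥ 0 let N_{g,k} be the number of (k + 2g − 1)-tuples (τ1, …, τ_{k+2g−1}) of transpositions in S_k whose product τ1⋯τ_{k+2g−1} is a single k-cycle. Then for every real t ≠ 0, ∑_{g≥0}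 N_{g,k} · t^{2g} / ((k + 2g − 1)! · k^{k+2g−2}) = (2 sinh(t/2) / t)^{k−1}; in particular the g = 0 term equals 1, i.e., N_{0,k} = (k−1)! k^{k−2}. -/
open Equiv

/-- `N_{g,k}`: the number of `(k + 2g - 1)`-tuples of transpositions in `S_k` whose
product is a single `k`-cycle. -/
noncomputable def oneHoleCount (g k : ℕ) : ℕ :=
  Nat.card {τ : Fin (k + 2 * g - 1) → Perm (Fin k) //
    (∀ i, (τ i).IsSwap) ∧ fullCycleType (List.ofFn τ).prod = ({k} : Multiset ℕ)}

namespace OneHole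
open Polynomial Matrix

theorem permMatrix_swap_eq {ι : Type*} [DecidableEq ι] (i j : ι) :
    (swap i j).permMatrix ℝ =
      1 - vecMulVec (Pi.single i 1 - Pi.single j 1) (Pi.single i 1 - Pi.single j 1) := by
  ext a b
  simp only [PEquiv.toMatrix_apply, toPEquiv_apply, Option.mem_def, Option.some.injEq,
    Matrix.sub_apply, Matrix.one_apply, vecMulVec_apply, Pi.sub_apply, Pi.single_apply,
    swap_apply_def]
  grind

section
variable {ι : Type*} [Fintype ι] [DecidableEq ι]

theorem derivative_charpoly_eval (M : Matrix ι ι ℝ) (x : ℝ) (hx : M.charpoly.eval x ≠ 0) :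
    (derivative M.charpoly).eval x = M.charpoly.eval x * trace (scalar ι x - M)⁻¹ := by
  have hu : IsUnit (scalar ι x - M).det := by
    rw [← eval_charpoly]; exact hx.isUnit
  have key : M.charpoly.comp (X + C x) = C (M.charpoly.eval x) *
      det (1 + (X : ℝ[X]) • (scalar ι x - M)⁻¹.map C) := by
    apply Polynomial.funext
    intro y
    rw [eval_comp, eval_mul, eval_C, eval_charpoly, eval_charpoly, eval_det, ← det_mul]
    congr 1
    simp only [eval_add, eval_X, eval_C]
    have : (matPolyEquiv (1 + (X : ℝ[X]) • (scalar ι x - M)⁻¹.map C)).eval (scalar ι y)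
        = 1 + y • (scalar ι x - M)⁻¹ := by
      ext a b
      rw [matPolyEquiv_eval]
      by_cases h : a = b <;> simp [h, mul_comm y]
    rw [this, mul_add, mul_smul_comm, mul_nonsing_inv _ hu, mul_one]
    ext a b
    by_cases h : a = b
    · simp [h]
      ring
    · simp [h]
  have h2 := congrArg (fun p => (derivative p).eval 0) key
  simpa [derivative_comp, derivative_det_one_add_X_smul] using h2

theorem charpoly_permMatrix_swap_mul_eval (σ : Perm ι) (x : ℝ)
    (hx : (σ.permMatrix ℝ).charpoly.eval x ≠ 0) (i j : ι) (B : Matrix ι ι ℝ)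
    (hB : B = (scalar ι x - σ.permMatrix ℝ)⁻¹ * σ.permMatrix ℝ) :
    ((swap i j * σ).permMatrix ℝ).charpoly.eval x =
      (σ.permMatrix ℝ).charpoly.eval x * (1 + (B i i + B j j - B i j - B j i)) := by
  have hu : IsUnit (scalar ι x - σ.permMatrix ℝ).det := by
    rw [← eval_charpoly]; exact hx.isUnit
  rw [eval_charpoly, eval_charpoly, permMatrix_mul, permMatrix_swap_eq]
  set v : ι → ℝ := Pi.single i 1 - Pi.single j 1 with hv
  have : scalar ι x - σ.permMatrix ℝ * (1 - vecMulVec v v) =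
      (scalar ι x - σ.permMatrix ℝ) +
        replicateCol Unit (σ.permMatrix ℝ *ᵥ v) * replicateRow Unit v := by
    rw [mul_sub, mul_one, mul_vecMulVec, ← vecMulVec_eq]
    abel
  rw [this, det_add_replicateCol_mul_replicateRow hu]
  congr 1
  rw [det_unique, Matrix.add_apply, one_apply_eq, Matrix.mul_assoc, ← replicateCol_mulVec,
    mulVec_mulVec, ← hB, replicateRow_mul_replicateCol_apply]
  congr 1
  rw [hv, mulVec_sub, sub_dotProduct, dotProduct_sub, dotProduct_sub]
  simp
  ring

theorem permMatrix_mulVec_one (σ : Perm ι) : σ.permMatrix ℝ *ᵥ (fun _ => 1) = fun _ => 1 := by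
  rw [permMatrix_mulVec]; rfl

theorem charpoly_permMatrix_eval_one [Nonempty ι] (σ : Perm ι) :
    (σ.permMatrix ℝ).charpoly.eval 1 = 0 := by
  rw [eval_charpoly, ← exists_mulVec_eq_zero_iff]
  refine ⟨fun _ => 1, ?_, ?_⟩
  · intro h
    have := congrFun h (Classical.arbitrary ι)
    simp at this
  · rw [sub_mulVec, permMatrix_mulVec_one]
    ext i
    simp

theorem sum_charpoly_permMatrix_swap_mul [Nonempty ι] (σ : Perm ι) :
    (X - 1) * ∑ i : ι, ∑ j : ι, ((swap i j * σ).permMatrix ℝ).charpoly =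
      (X - 1) * (2 * C (Fintype.card ι : ℝ) * X * derivative (σ.permMatrix ℝ).charpoly
        - C (Fintype.card ι : ℝ) ^ 2 * (σ.permMatrix ℝ).charpoly)
      - 2 * C (Fintype.card ι : ℝ) * (σ.permMatrix ℝ).charpoly := by
  have hne : (σ.permMatrix ℝ).charpoly ≠ 0 := (charpoly_monic _).ne_zero
  rw [← mul_left_inj' hne]
  apply Polynomial.funext
  intro x
  rw [eval_mul (q := (σ.permMatrix ℝ).charpoly), eval_mul (q := (σ.permMatrix ℝ).charpoly)]
  by_cases hx : (σ.permMatrix ℝ).charpoly.eval x = 0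
  · simp only [hx, mul_zero]
  congr 1
  have hx1 : x - 1 ≠ 0 := by
    intro h
    apply hx
    rw [sub_eq_zero.mp h, charpoly_permMatrix_eval_one]
  have hu : IsUnit (scalar ι x - σ.permMatrix ℝ).det := by
    rw [← eval_charpoly]; exact (Ne.isUnit hx)
  set A := scalar ι x - σ.permMatrix ℝ with hA
  have hAone : A⁻¹ *ᵥ (fun _ => 1) = fun _ => (x - 1)⁻¹ := by
    have h1 : A *ᵥ (fun _ => 1) = (x - 1) • (fun _ => 1) := by
      rw [hA, sub_mulVec, permMatrix_mulVec_one]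
      ext i
      simp
    have h2 := congrArg (fun w => (x - 1)⁻¹ • (A⁻¹ *ᵥ w)) h1
    simp only [mulVec_mulVec, nonsing_inv_mul _ hu, one_mulVec, mulVec_smul, smul_smul,
      inv_mul_cancel₀ hx1, one_smul] at h2
    rw [← h2]
    ext i
    simp
  obtain ⟨B, hB⟩ : ∃ B, B = A⁻¹ * σ.permMatrix ℝ := ⟨_, rfl⟩
  have hB' : B = x • A⁻¹ - 1 := by
    have : σ.permMatrix ℝ = scalar ι x - A := by rw [hA]; abel
    rw [hB, this, mul_sub, nonsing_inv_mul _ hu]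
    ext a b
    simp [mul_comm]
  have hBone : ∑ i, ∑ j, B i j = (Fintype.card ι : ℝ) * (x - 1)⁻¹ := by
    have : ∀ i, ∑ j, B i j = (x - 1)⁻¹ := by
      intro i
      have h3 : (B *ᵥ (fun _ => 1)) i = ∑ j, B i j := by simp [mulVec, dotProduct]
      rw [← h3, hB, ← mulVec_mulVec, permMatrix_mulVec_one, hAone]
    simp [this]
  have htr : (σ.permMatrix ℝ).charpoly.eval x * ∑ i, B i i =
      x * (derivative (σ.permMatrix ℝ).charpoly).eval x
        - Fintype.card ι * (σ.permMatrix ℝ).charpoly.eval x := by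
    rw [derivative_charpoly_eval _ _ hx, ← hA]
    have : ∑ i, B i i = trace B := rfl
    rw [this, hB', trace_sub, trace_smul, trace_one, smul_eq_mul]
    ring
  have hsum : ∑ i : ι, ∑ j : ι, ((swap i j * σ).permMatrix ℝ).charpoly.eval x =
      (σ.permMatrix ℝ).charpoly.eval x * ((Fintype.card ι : ℝ) ^ 2 +
        2 * Fintype.card ι * (∑ i, B i i) - 2 * ∑ i, ∑ j, B i j) := by
    have h4 : ∀ i j, ((swap i j * σ).permMatrix ℝ).charpoly.eval x = _ :=
      fun i j => charpoly_permMatrix_swap_mul_eval σ x hx i j B hB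
    simp_rw [h4, ← Finset.mul_sum]
    congr 1
    simp only [Finset.sum_add_distrib, Finset.sum_sub_distrib, Finset.sum_const, Finset.card_univ,
      nsmul_eq_mul, ← Finset.mul_sum]
    rw [Finset.sum_comm (f := fun i j => B j i)]
    ring
  simp only [eval_mul, eval_sub, eval_X, eval_one, eval_finsetSum, eval_C, eval_ofNat, eval_pow]
  rw [hsum, hBone]
  have e1 : (x - 1) * ((σ.permMatrix ℝ).charpoly.eval x * ((Fintype.card ι : ℝ) ^ 2 +
        2 * Fintype.card ι * (∑ i, B i i) - 2 * ((Fintype.card ι : ℝ) * (x - 1)⁻¹))) =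
      (x - 1) * ((Fintype.card ι : ℝ) ^ 2 * (σ.permMatrix ℝ).charpoly.eval x +
        2 * Fintype.card ι * ((σ.permMatrix ℝ).charpoly.eval x * ∑ i, B i i))
        - 2 * Fintype.card ι * (σ.permMatrix ℝ).charpoly.eval x * ((x - 1) * (x - 1)⁻¹) := by ring
  rw [e1, htr, mul_inv_cancel₀ hx1]
  ring
end

section
variable {ι : Type*} [Fintype ι] [DecidableEq ι]

/-- The characteristic polynomial of a permutation acting on the quotient of the permutation
representation by its constant vectors. -/
noncomputable def reducedCharpoly (σ : Perm ι) : ℝ[X] :=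
  (σ.permMatrix ℝ).charpoly /ₘ (X - C 1)

theorem X_sub_one_mul_reducedCharpoly [Nonempty ι] (σ : Perm ι) :
    (X - 1) * reducedCharpoly σ = (σ.permMatrix ℝ).charpoly := by
  have := mul_divByMonic_eq_iff_isRoot.2 (charpoly_permMatrix_eval_one σ)
  simpa [reducedCharpoly] using this

theorem X_sub_one_ne_zero : (X - 1 : ℝ[X]) ≠ 0 := by
  simpa using X_sub_C_ne_zero (1 : ℝ)

theorem sum_reducedCharpoly_swap_mul [Nonempty ι] (σ : Perm ι) :
    ∑ i : ι, ∑ j : ι, reducedCharpoly (swap i j * σ) =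
      (2 * C (Fintype.card ι : ℝ) - C (Fintype.card ι : ℝ) ^ 2) * reducedCharpoly σ
        + 2 * C (Fintype.card ι : ℝ) * X * derivative (reducedCharpoly σ) := by
  have h := sum_charpoly_permMatrix_swap_mul σ
  simp_rw [← X_sub_one_mul_reducedCharpoly, ← Finset.mul_sum] at h
  have h1 : derivative ((X - 1 : ℝ[X]) * reducedCharpoly σ) =
      reducedCharpoly σ + (X - 1) * derivative (reducedCharpoly σ) := by
    simp
  rw [h1] at h
  refine mul_left_cancel₀ X_sub_one_ne_zero (mul_left_cancel₀ X_sub_one_ne_zero ?_)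
  rw [h]
  ring

theorem reducedCharpoly_one [Nonempty ι] :
    reducedCharpoly (1 : Perm ι) = (X - 1) ^ (Fintype.card ι - 1) := by
  refine mul_left_cancel₀ X_sub_one_ne_zero ?_
  rw [X_sub_one_mul_reducedCharpoly, permMatrix_one, charpoly_one, ← pow_succ',
    Nat.sub_add_cancel Fintype.card_pos]

theorem charpoly_permMatrix_of_sameCycle (σ : Perm ι) (a : ι) (h : ∀ b, σ.SameCycle a b) :
    (σ.permMatrix ℝ).charpoly = X ^ Fintype.card ι - 1 := by
  set P := σ.permMatrix ℝ with hP
  have hn : Nonempty ι := ⟨a⟩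
  have hk : 0 < Fintype.card ι := Fintype.card_pos
  have hpow : ∀ n : ℕ, P ^ n = (σ ^ n).permMatrix ℝ := by
    intro n
    induction n with
    | zero => simp
    | succ n ih => rw [pow_succ, ih, pow_succ', permMatrix_mul]
  have hcyc : σ.IsCycleOn (Finset.univ : Finset ι) := by
    refine ⟨by simp, ?_⟩
    intro x _ y _
    exact (h x).symm.trans (h y)
  have hσ : σ ^ Fintype.card ι = 1 := by
    ext b
    exact hcyc.pow_card_apply (Finset.mem_univ b)
  have haeval : aeval P (X ^ Fintype.card ι - 1 : ℝ[X]) = 0 := by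
    simp [hpow, hσ]
  have hmonic : (X ^ Fintype.card ι - 1 : ℝ[X]).Monic := by
    simpa using monic_X_pow_sub_C (1 : ℝ) hk.ne'
  have hint : IsIntegral ℝ P := ⟨_, hmonic, by simpa [aeval_def] using haeval⟩
  have hdeg : Fintype.card ι ≤ (minpoly ℝ P).natDegree := by
    by_contra! hlt
    apply minpoly.ne_zero hint
    have h0 := minpoly.aeval ℝ P
    rw [aeval_eq_sum_range' hlt] at h0
    ext d
    rw [coeff_zero]
    by_cases hd : d < Fintype.card ι
    · have h1 := congrFun (congrFun h0 a) ((σ ^ d) a)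
      rw [Matrix.sum_apply, Finset.sum_eq_single d] at h1
      · simpa [hpow, PEquiv.toMatrix_apply] using h1
      · intro e he hed
        have : (σ ^ e) a ≠ (σ ^ d) a := by
          intro heq
          apply hed
          have := (hcyc.pow_apply_eq_pow_apply (Finset.mem_univ a)).1 heq
          exact Nat.ModEq.eq_of_lt_of_lt this (by simpa using he) (by simpa using hd)
        simp [hpow, PEquiv.toMatrix_apply, this]
      · intro hd'
        simp [hd] at hd'
    · exact coeff_eq_zero_of_natDegree_lt (by omega)
  have e1 : minpoly ℝ P = P.charpoly :=
    .symm <| eq_of_monic_of_dvd_of_natDegree_le (minpoly.monic hint) (charpoly_monic P)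
      (minpoly_dvd_charpoly P) (by rw [charpoly_natDegree_eq_dim]; exact hdeg)
  have e2 : minpoly ℝ P = X ^ Fintype.card ι - 1 :=
    .symm <| eq_of_monic_of_dvd_of_natDegree_le (minpoly.monic hint) hmonic
      (minpoly.dvd ℝ P haeval) (by
        have := natDegree_X_pow_sub_C (n := Fintype.card ι) (r := (1 : ℝ))
        rw [C_1] at this
        rw [this]; exact hdeg)
  rw [← e1, e2]

theorem reducedCharpoly_eval_one_of_sameCycle (σ : Perm ι) (a : ι)
    (h : ∀ b, σ.SameCycle a b) : (reducedCharpoly σ).eval 1 = Fintype.card ι := by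
  have : Nonempty ι := ⟨a⟩
  have : reducedCharpoly σ = ∑ i ∈ Finset.range (Fintype.card ι), (X : ℝ[X]) ^ i := by
    refine mul_left_cancel₀ X_sub_one_ne_zero ?_
    rw [X_sub_one_mul_reducedCharpoly, charpoly_permMatrix_of_sameCycle σ a h, mul_geom_sum]
  rw [this, eval_geom_sum]
  simp

theorem det_charmatrix_block_eval_one (σ : Perm ι) (p : ι → Prop) [DecidablePred p]
    (hp : ∀ i, p i ↔ p (σ i)) (a : ι) (ha : p a) :
    (toSquareBlockProp (charmatrix (σ.permMatrix ℝ)) p).det.eval 1 = 0 := by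
  rw [← coe_evalRingHom, RingHom.map_det, ← exists_mulVec_eq_zero_iff]
  refine ⟨fun _ => 1, ?_, ?_⟩
  · intro h
    have := congrFun h ⟨a, ha⟩
    simp at this
  · ext ⟨i, hi⟩
    have h1 : ∀ j : {j // p j}, ((evalRingHom (1 : ℝ)).mapMatrix
        (toSquareBlockProp (charmatrix (σ.permMatrix ℝ)) p)) ⟨i, hi⟩ j =
          (if (⟨i, hi⟩ : {j // p j}) = j then 1 else 0)
            - if (⟨σ i, (hp i).1 hi⟩ : {j // p j}) = j then 1 else 0 := by
      rintro ⟨j, hj⟩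
      by_cases hij : i = j
      · subst hij
        simp [toSquareBlockProp, PEquiv.toMatrix_apply]
        split_ifs <;> simp
      · simp [toSquareBlockProp, PEquiv.toMatrix_apply, hij]
        split_ifs <;> simp
    simp [mulVec, dotProduct, h1]

theorem reducedCharpoly_eval_one_of_not_sameCycle (σ : Perm ι) (a b : ι)
    (h : ¬ σ.SameCycle a b) : (reducedCharpoly σ).eval 1 = 0 := by
  classical
  have : Nonempty ι := ⟨a⟩
  let p : ι → Prop := fun i => σ.SameCycle a i
  have hp : ∀ i, p i ↔ p (σ i) := fun i => Perm.sameCycle_apply_right.symm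
  have hdet := twoBlockTriangular_det (charmatrix (σ.permMatrix ℝ)) p (by
    intro i hi j hj
    have hij : i ≠ j := by rintro rfl; exact hi hj
    have hσ : σ i ≠ j := by rintro rfl; exact hi ((hp i).2 hj)
    simp [PEquiv.toMatrix_apply, hij, hσ])
  have h1 := det_charmatrix_block_eval_one σ p hp a (Perm.SameCycle.refl σ a)
  have h2 := det_charmatrix_block_eval_one σ (fun i => ¬ p i) (fun i => not_congr (hp i)) b h
  obtain ⟨q, hq⟩ := dvd_iff_isRoot.2 h1
  have h3 : reducedCharpoly σ =
      q * (toSquareBlockProp (charmatrix (σ.permMatrix ℝ)) fun i => ¬ p i).det := by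
    refine mul_left_cancel₀ X_sub_one_ne_zero ?_
    rw [X_sub_one_mul_reducedCharpoly, Matrix.charpoly, hdet, hq, C_1, mul_assoc]
  rw [h3, eval_mul, h2, mul_zero]

end

theorem fullCycleType_eq_singleton_iff {k : ℕ} (σ : Perm (Fin k)) (a : Fin k) :
    fullCycleType σ = {k} ↔ ∀ b, σ.SameCycle a b := by
  have hk : 0 < k := a.pos
  rcases Nat.lt_or_ge 1 k with hk1 | hk1
  · have : Nontrivial (Fin k) := Fin.nontrivial_iff_two_le.2 hk1
    constructor
    · intro h
      have h1 : k ∈ fullCycleType σ := h ▸ Multiset.mem_singleton_self k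
      rw [fullCycleType, Multiset.mem_add] at h1
      have h2 : k ∈ σ.cycleType := by
        rcases h1 with h1 | h1
        · exact h1
        · have := Multiset.eq_of_mem_replicate h1
          omega
      have h3 : σ.cycleType = {k} := by
        refine (Multiset.eq_of_le_of_card_le (Multiset.singleton_le.2 h2) ?_).symm
        have := congrArg Multiset.card h
        simp only [fullCycleType, Multiset.card_add] at this
        simp only [Multiset.card_singleton] at this ⊢
        omega
      have hc : σ.IsCycle := by
        rw [← Perm.card_cycleType_eq_one, h3, Multiset.card_singleton]
      have hs : σ.support = Finset.univ := by
        rw [← Finset.card_eq_iff_eq_univ, ← Perm.sum_cycleType, h3]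
        simp
      have hm : ∀ b, σ b ≠ b := fun b => by
        rw [← Perm.mem_support, hs]; exact Finset.mem_univ b
      exact fun b => hc.sameCycle (hm a) (hm b)
    · intro h
      have hm : ∀ b, σ b ≠ b := by
        intro b hb
        obtain ⟨c, hc⟩ := exists_ne b
        have := (h b).symm.trans (h c)
        exact hc (((Perm.SameCycle.eq_of_left this) hb).symm)
      have hc : σ.IsCycle := ⟨a, hm a, fun b _ => h b⟩
      have hs : σ.support = Finset.univ := by
        ext b; simp [hm b]
      rw [fullCycleType, hc.cycleType, hs]
      simp
  · obtain rfl : k = 1 := by omega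
    constructor
    · intro _ b
      rw [Subsingleton.elim b a]
    · intro _
      rw [Subsingleton.elim σ 1]
      simp [fullCycleType]

theorem sum_swap_eq {k : ℕ} [Fintype {τ : Perm (Fin k) // τ.IsSwap}] {M : Type*}
    [AddCommMonoid M] (f : Perm (Fin k) → M) :
    ∑ i, ∑ j, f (swap i j) = k • f 1 + 2 • ∑ τ : {τ : Perm (Fin k) // τ.IsSwap}, f τ := by
  classical
  have hlt : ∑ x : Fin k × Fin k with x.1 < x.2, f (swap x.1 x.2) =
      ∑ τ : {τ : Perm (Fin k) // τ.IsSwap}, f τ := by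
    refine Finset.sum_bij (fun x hx => ⟨swap x.1 x.2, x.1, x.2,
      (Finset.mem_filter.1 hx).2.ne, rfl⟩) ?_ ?_ ?_ ?_
    · intro x hx; exact Finset.mem_univ _
    · rintro ⟨i, j⟩ hx ⟨i', j'⟩ hy hxy
      simp only [Finset.mem_filter, Finset.mem_univ, true_and] at hx hy
      have hxy' : swap i j = swap i' j' := congrArg Subtype.val hxy
      have h1 := congrArg (fun e : Perm (Fin k) => e i) hxy'
      have h2 := congrArg (fun e : Perm (Fin k) => e j) hxy'
      simp only [swap_apply_left, swap_apply_right, swap_apply_def] at h1 h2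
      grind
    · rintro ⟨τ, i, j, hij, rfl⟩ _
      rcases hij.lt_or_gt with h | h
      · exact ⟨(i, j), by simpa using h, rfl⟩
      · exact ⟨(j, i), by simpa using h, Subtype.ext (Equiv.swap_comm j i)⟩
    · intro x hx; rfl
  have hgt : ∑ x : Fin k × Fin k with x.2 < x.1, f (swap x.1 x.2) =
      ∑ x : Fin k × Fin k with x.1 < x.2, f (swap x.1 x.2) := by
    refine Finset.sum_bij (fun x _ => x.swap) ?_ ?_ ?_ ?_
    · intro x hx; simpa using hx
    · intro x _ y _ h; exact Prod.swap_injective h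
    · intro x hx; exact ⟨x.swap, by simpa using hx, by simp⟩
    · intro x _; simp [Equiv.swap_comm]
  have heq : ∑ x : Fin k × Fin k with x.1 = x.2, f (swap x.1 x.2) = k • f 1 := by
    rw [Finset.sum_filter, Fintype.sum_prod_type]
    simp [← Perm.one_def]
  rw [two_nsmul, ← hlt]
  nth_rewrite 1 [← hgt]
  rw [← heq, ← Fintype.sum_prod_type', Finset.sum_filter, Finset.sum_filter, Finset.sum_filter,
    ← Finset.sum_add_distrib, ← Finset.sum_add_distrib]
  refine Finset.sum_congr rfl fun x _ => ?_
  rcases lt_trichotomy x.1 x.2 with h | h | h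
  · simp [h, h.ne, h.not_gt]
  · simp [h]
  · simp [h, h.ne', h.not_gt]

theorem reducedCharpoly_eval_one {k : ℕ} [NeZero k] (σ : Perm (Fin k))
    [Decidable (fullCycleType σ = {k})] :
    (reducedCharpoly σ).eval 1 = if fullCycleType σ = {k} then (k : ℝ) else 0 := by
  have h := fullCycleType_eq_singleton_iff σ 0
  split_ifs with hσ
  · simpa using reducedCharpoly_eval_one_of_sameCycle σ 0 (h.1 hσ)
  · rw [h] at hσ
    push Not at hσ
    obtain ⟨b, hb⟩ := hσ
    exact reducedCharpoly_eval_one_of_not_sameCycle σ 0 b hb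

section
variable {k : ℕ} [Fintype {τ : Perm (Fin k) // τ.IsSwap}]

/-- The sum of the reduced characteristic polynomials of all products of `n` transpositions. -/
noncomputable def swapProdPoly (k n : ℕ) [Fintype {τ : Perm (Fin k) // τ.IsSwap}] : ℝ[X] :=
  ∑ τ : Fin n → {τ : Perm (Fin k) // τ.IsSwap},
    reducedCharpoly (List.ofFn fun i => (τ i : Perm (Fin k))).prod

theorem swapProdPoly_zero [NeZero k] : swapProdPoly k 0 = (X - 1) ^ (k - 1) := by
  simp [swapProdPoly, reducedCharpoly_one]

theorem two_mul_swapProdPoly_succ [NeZero k] (n : ℕ) :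
    2 * swapProdPoly k (n + 1) =
      C ((k : ℝ) - k ^ 2) * swapProdPoly k n +
        C (2 * k : ℝ) * (X * derivative (swapProdPoly k n)) := by
  have h1 : swapProdPoly k (n + 1) = ∑ τ : Fin n → {τ : Perm (Fin k) // τ.IsSwap},
      ∑ τ₀ : {τ : Perm (Fin k) // τ.IsSwap},
        reducedCharpoly ((τ₀ : Perm (Fin k)) * (List.ofFn fun i => (τ i : Perm (Fin k))).prod) := by
    rw [swapProdPoly, ← (Fin.consEquiv fun _ => {τ : Perm (Fin k) // τ.IsSwap}).sum_comp,
      Fintype.sum_prod_type_right]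
    simp [Fin.consEquiv, List.ofFn_succ]
  have h2 : ∀ σ : Perm (Fin k),
      2 * ∑ τ₀ : {τ : Perm (Fin k) // τ.IsSwap}, reducedCharpoly ((τ₀ : Perm (Fin k)) * σ) =
      C ((k : ℝ) - k ^ 2) * reducedCharpoly σ
        + C (2 * k : ℝ) * (X * derivative (reducedCharpoly σ)) := by
    intro σ
    have h3 := sum_swap_eq (fun τ => reducedCharpoly (τ * σ))
    rw [sum_reducedCharpoly_swap_mul, one_mul, Fintype.card_fin] at h3
    simp only [nsmul_eq_mul, Nat.cast_ofNat] at h3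
    simp only [C_sub, C_mul, C_pow, map_natCast, map_ofNat] at h3 ⊢
    linear_combination -h3
  rw [h1, Finset.mul_sum, Finset.sum_congr rfl fun τ _ => h2 _, Finset.sum_add_distrib,
    ← Finset.mul_sum, ← Finset.mul_sum, ← Finset.mul_sum, swapProdPoly, derivative_sum]

theorem coeff_swapProdPoly [NeZero k] (n r : ℕ) :
    (swapProdPoly k n).coeff r =
      (-1) ^ (k - 1 - r) * ((k - 1).choose r : ℝ) * (k * (r - ((k - 1 : ℕ) : ℝ) / 2)) ^ n := by
  induction n with
  | zero =>
    have h := coeff_X_add_C_pow (-1 : ℝ) (k - 1) r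
    rw [C_neg, C_1, ← sub_eq_add_neg] at h
    rw [swapProdPoly_zero, h, pow_zero, mul_one]
  | succ n ih =>
    have h := congrArg (fun p => coeff p r) (two_mul_swapProdPoly_succ (k := k) n)
    have hX : (X * derivative (swapProdPoly k n)).coeff r = r * (swapProdPoly k n).coeff r := by
      cases r with
      | zero => simp
      | succ r => rw [coeff_X_mul, coeff_derivative]; push_cast; ring
    have h2 : (2 * swapProdPoly k (n + 1)).coeff r = 2 * (swapProdPoly k (n + 1)).coeff r := by
      rw [← C_ofNat, coeff_C_mul]
    simp only [coeff_add, coeff_C_mul, hX, h2, ih] at h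
    have hk : ((k - 1 : ℕ) : ℝ) = k - 1 := by
      rw [Nat.cast_sub (NeZero.one_le), Nat.cast_one]
    rw [hk] at h ⊢
    rw [pow_succ]
    linear_combination h / 2

theorem swapProdPoly_eval_one [NeZero k] (n : ℕ) :
    (swapProdPoly k n).eval 1 =
      k ^ n * ∑ r ∈ Finset.range (k - 1 + 1),
        (-1) ^ (k - 1 - r) * ((k - 1).choose r : ℝ) * (r - ((k - 1 : ℕ) : ℝ) / 2) ^ n := by
  have hdeg : (swapProdPoly k n).natDegree < k - 1 + 1 := by
    rw [Nat.lt_succ_iff, natDegree_le_iff_coeff_eq_zero]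
    intro r hr
    rw [coeff_swapProdPoly, Nat.choose_eq_zero_of_lt hr]
    simp
  rw [eval_eq_sum_range' hdeg, Finset.mul_sum]
  refine Finset.sum_congr rfl fun r _ => ?_
  rw [coeff_swapProdPoly, mul_pow]
  ring

theorem swapProdPoly_eval_one_eq_card [NeZero k] (n : ℕ) :
    (swapProdPoly k n).eval 1 = k * (Nat.card {τ : Fin n → Perm (Fin k) //
      (∀ i, (τ i).IsSwap) ∧ fullCycleType (List.ofFn τ).prod = ({k} : Multiset ℕ)} : ℝ) := by
  classical
  let e : {τ : Fin n → Perm (Fin k) //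
      (∀ i, (τ i).IsSwap) ∧ fullCycleType (List.ofFn τ).prod = ({k} : Multiset ℕ)} ≃
      {τ : Fin n → {τ : Perm (Fin k) // τ.IsSwap} //
        fullCycleType (List.ofFn fun i => (τ i : Perm (Fin k))).prod = {k}} :=
    { toFun := fun τ => ⟨fun i => ⟨τ.1 i, τ.2.1 i⟩, τ.2.2⟩
      invFun := fun τ => ⟨fun i => τ.1 i, fun i => (τ.1 i).2, τ.2⟩
      left_inv := fun _ => rfl
      right_inv := fun _ => rfl }
  rw [Nat.card_congr e, Nat.card_eq_fintype_card, Fintype.card_subtype, swapProdPoly,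
    eval_finsetSum]
  simp_rw [reducedCharpoly_eval_one]
  rw [← Finset.sum_filter, Finset.sum_const, nsmul_eq_mul, mul_comm]

end

/-- The number of `n`-tuples of transpositions in `S_k` whose product is a `k`-cycle, as an
alternating sum. -/
theorem card_swap_factorizations (k n : ℕ) [NeZero k] :
    (k : ℝ) * (Nat.card {τ : Fin n → Perm (Fin k) //
      (∀ i, (τ i).IsSwap) ∧ fullCycleType (List.ofFn τ).prod = ({k} : Multiset ℕ)} : ℝ) =
      k ^ n * ∑ r ∈ Finset.range (k - 1 + 1),
        (-1) ^ (k - 1 - r) * ((k - 1).choose r : ℝ) * (r - ((k - 1 : ℕ) : ℝ) / 2) ^ n := by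
  classical
  rw [← swapProdPoly_eval_one_eq_card, swapProdPoly_eval_one]

/-- The alternating sum `∑ r, (-1) ^ (m - r) * m.choose r * (r - m / 2) ^ n`: the central
difference of order `m` of `x ^ n` at `0`. -/
noncomputable def centralDiffPow (m n : ℕ) : ℝ :=
  ∑ r ∈ Finset.range (m + 1), (-1) ^ (m - r) * (m.choose r : ℝ) * (r - (m : ℝ) / 2) ^ n

theorem centralDiffPow_eq_fwdDiff (m n : ℕ) :
    centralDiffPow m n = (fwdDiff (1 : ℝ))^[m] (((X - C ((m : ℝ) / 2)) ^ n).eval ·) 0 := by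
  rw [fwdDiff_iter_eq_sum_shift, centralDiffPow]
  refine Finset.sum_congr rfl fun r _ => ?_
  simp

theorem centralDiffPow_eq_zero_of_lt {m n : ℕ} (h : n < m) : centralDiffPow m n = 0 := by
  rw [centralDiffPow_eq_fwdDiff, fwdDiff_iter_eq_zero_of_degree_lt]
  · rfl
  · rwa [natDegree_pow, natDegree_X_sub_C, mul_one]

theorem centralDiffPow_self (m : ℕ) : centralDiffPow m m = m.factorial := by
  have hd : ((X - C ((m : ℝ) / 2)) ^ m).natDegree = m := by
    rw [natDegree_pow, natDegree_X_sub_C, mul_one]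
  have hl : ((X - C ((m : ℝ) / 2)) ^ m).leadingCoeff = 1 := (monic_X_sub_C _).pow m
  have h := congrFun (fwdDiff_iter_degree_eq_factorial ((X - C ((m : ℝ) / 2)) ^ m)) 0
  rw [hd, hl, one_smul] at h
  rw [centralDiffPow_eq_fwdDiff, h]
  rfl

theorem centralDiffPow_eq_zero_of_odd {m n : ℕ} (h : Odd (m + n)) : centralDiffPow m n = 0 := by
  have h1 : centralDiffPow m n = (-1) ^ (m + n) * centralDiffPow m n := by
    conv_lhs => rw [centralDiffPow, ← Finset.sum_range_reflect]
    rw [centralDiffPow, Finset.mul_sum]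
    refine Finset.sum_congr rfl fun r hr => ?_
    obtain ⟨s, rfl⟩ := Nat.exists_eq_add_of_le (Nat.lt_succ_iff.1 (Finset.mem_range.1 hr))
    have e1 : r + s + 1 - 1 - r = s := by omega
    have e2 : r + s - s = r := by omega
    have e3 : r + s - r = s := by omega
    have e4 : (s : ℝ) - ((r + s : ℕ) : ℝ) / 2 = (-1) * (r - ((r + s : ℕ) : ℝ) / 2) := by
      push_cast; ring
    have e5 : (r + s).choose s = (r + s).choose r := (Nat.choose_symm_add).symm
    have e6 : ((-1 : ℝ)) ^ s * (-1) ^ s = 1 := by rw [← mul_pow]; simp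
    rw [e1, e2, e3, e4, e5, mul_pow, pow_add, pow_add]
    linear_combination (-(-1) ^ r * ((r + s).choose r : ℝ) * (-1) ^ n *
      (r - ((r + s : ℕ) : ℝ) / 2) ^ n) * e6
  rw [h.neg_one_pow] at h1
  linarith

theorem hasSum_centralDiffPow (m : ℕ) (t : ℝ) :
    HasSum (fun n : ℕ => centralDiffPow m n * t ^ n / n.factorial)
      ((2 * Real.sinh (t / 2)) ^ m) := by
  have h : HasSum (fun n : ℕ => centralDiffPow m n * t ^ n / n.factorial)
      (∑ r ∈ Finset.range (m + 1), (-1) ^ (m - r) * (m.choose r : ℝ) *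
        Real.exp ((r - (m : ℝ) / 2) * t)) := by
    have : (fun n : ℕ => centralDiffPow m n * t ^ n / n.factorial) =
        fun n : ℕ => ∑ r ∈ Finset.range (m + 1), (-1) ^ (m - r) * (m.choose r : ℝ) *
          (((r - (m : ℝ) / 2) * t) ^ n / n.factorial) := by
      ext n
      rw [centralDiffPow, Finset.sum_mul, Finset.sum_div]
      refine Finset.sum_congr rfl fun r _ => ?_
      rw [mul_pow]
      ring
    rw [this]
    refine hasSum_sum fun r _ => ?_
    have hexp : HasSum (fun n : ℕ => ((r - (m : ℝ) / 2) * t) ^ n / n.factorial)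
        (Real.exp ((r - (m : ℝ) / 2) * t)) := by
      rw [Real.exp_eq_exp_ℝ]
      exact NormedSpace.expSeries_div_hasSum_exp ((r - (m : ℝ) / 2) * t)
    exact hexp.mul_left ((-1) ^ (m - r) * (m.choose r : ℝ))
  convert h using 1
  have h2 : 2 * Real.sinh (t / 2) = Real.exp (t / 2) + -Real.exp (-(t / 2)) := by
    rw [Real.sinh_eq]; ring
  rw [h2, add_pow]
  refine Finset.sum_congr rfl fun r hr => ?_
  obtain ⟨s, rfl⟩ := Nat.exists_eq_add_of_le (Nat.lt_succ_iff.1 (Finset.mem_range.1 hr))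
  rw [Nat.add_sub_cancel_left, neg_pow, ← Real.exp_nat_mul, ← Real.exp_nat_mul]
  have : ((r : ℝ) - ((r + s : ℕ) : ℝ) / 2) * t = r * (t / 2) + s * (-(t / 2)) := by
    push_cast; ring
  rw [this, Real.exp_add]
  ring

theorem hasSum_centralDiffPow_div (m : ℕ) {t : ℝ} (ht : t ≠ 0) :
    HasSum (fun g : ℕ => centralDiffPow m (m + 2 * g) * t ^ (2 * g) / (m + 2 * g).factorial)
      ((2 * Real.sinh (t / 2) / t) ^ m) := by
  have hinj : Function.Injective fun g : ℕ => m + 2 * g := fun a b h => by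
    simp only at h; omega
  have h := (hinj.hasSum_iff (fun n hn => ?_)).2 (hasSum_centralDiffPow m t)
  · have h' := h.div_const (t ^ m)
    rw [← div_pow] at h'
    refine h'.congr_fun fun g => ?_
    simp only [Function.comp_apply]
    rw [pow_add]
    field_simp
  · have : centralDiffPow m n = 0 := by
      rcases lt_or_ge n m with hlt | hge
      · exact centralDiffPow_eq_zero_of_lt hlt
      · apply centralDiffPow_eq_zero_of_odd
        by_contra hodd
        rw [Nat.not_odd_iff_even] at hodd
        obtain ⟨c, hc⟩ := hodd
        exact hn ⟨c - m, by simp only; omega⟩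
    simp [this]

theorem mul_oneHoleCount (g k : ℕ) [NeZero k] :
    (k : ℝ) * oneHoleCount g k = k ^ (k - 1 + 2 * g) * centralDiffPow (k - 1) (k - 1 + 2 * g) := by
  have : k + 2 * g - 1 = k - 1 + 2 * g := by
    have := NeZero.one_le (n := k)
    omega
  rw [oneHoleCount, this, card_swap_factorizations, centralDiffPow]

end OneHole

/-- Combinatorial form of Theorem 1.2 (Faber–Pandharipande identity): for `k ≥ 1`,
`∑_{g≥0} N_{g,k} t^{2g} / ((k+2g-1)! k^{k+2g-2}) = (2 sinh(t/2)/t)^{k-1}` for all real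
`t ≠ 0`; in particular the `g = 0` term equals `1`, i.e. `N_{0,k} = (k-1)! k^{k-2}`. -/
theorem one_hole_hurwitz_generating_function (k : ℕ) (hk : 1 ≤ k) :
    (∀ t : ℝ, t ≠ 0 →
      ∑' g : ℕ, (oneHoleCount g k : ℝ) * t ^ (2 * g)
          / (((k + 2 * g - 1).factorial : ℝ) * (k : ℝ) ^ ((k : ℤ) + 2 * (g : ℤ) - 2))
        = (2 * Real.sinh (t / 2) / t) ^ (k - 1)) ∧
    (oneHoleCount 0 k : ℝ) = ((k - 1).factorial : ℝ) * (k : ℝ) ^ ((k : ℤ) - 2) := by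
  have : NeZero k := ⟨by omega⟩
  have hk0 : (k : ℝ) ≠ 0 := NeZero.ne _
  have hcount : ∀ g : ℕ, (oneHoleCount g k : ℝ) = (k : ℝ) ^ ((k : ℤ) + 2 * (g : ℤ) - 2) *
      OneHole.centralDiffPow (k - 1) (k - 1 + 2 * g) := by
    intro g
    have h := OneHole.mul_oneHoleCount g k
    have he : ((k - 1 + 2 * g : ℕ) : ℤ) = ((k : ℤ) + 2 * (g : ℤ) - 2) + 1 := by omega
    rw [← zpow_natCast, he, zpow_add_one₀ hk0] at h
    refine mul_left_cancel₀ hk0 ?_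
    rw [h]
    ring
  constructor
  · intro t ht
    rw [← (OneHole.hasSum_centralDiffPow_div (k - 1) ht).tsum_eq]
    refine tsum_congr fun g => ?_
    have hz : (k : ℝ) ^ ((k : ℤ) + 2 * (g : ℤ) - 2) ≠ 0 := zpow_ne_zero _ hk0
    have he : k + 2 * g - 1 = k - 1 + 2 * g := by omega
    rw [hcount, he]
    field_simp
  · have h := hcount 0
    rw [mul_zero, add_zero, OneHole.centralDiffPow_self] at h
    rw [h, mul_comm]
    simp
end
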